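/- arXiv:1509.05783 — 3 statements merged into one kernel-verified Lean document; each statement's English description precedes it below -/
import Mathlib

section
/- There is an absolute constant C > 0 with the following property: for every n ≥ 1 and every family {P_i : i ∈ I} of closed half-spaces in ℝⁿ such that the intersection P = ⋂_{i∈I} P_i has positive Lebesgue measure, there exist s ≤ 2n and indices i_1, …, i_s ∈ I such that |P_{i_1} ∩ ⋯ ∩ P_{i_s}| ≤ (Cn)^{3n/2} |⋂_{i∈I} P_i|. -/
open MeasureTheory
open scoped RealInnerProductSpace

open Matrix Finset Module
open scoped Nat MatrixOrder Matrix.Norms.L2Operator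

/-- The second moment matrix `∑ c i • u i (u i)ᵀ` of a weighted family of vectors. -/
noncomputable def momentMatrix {ι : Type*} [Fintype ι] {n : ℕ} (c : ι → ℝ)
    (u : ι → Fin n → ℝ) : Matrix (Fin n) (Fin n) ℝ :=
  ∑ i, c i • vecMulVec (u i) (u i)

theorem factorial_mul_det_momentMatrix {ι : Type*} [Fintype ι] {n : ℕ} (c : ι → ℝ)
    (u : ι → Fin n → ℝ) :
    (n ! : ℝ) * (momentMatrix c u).det =
      ∑ f : Fin n → ι, (∏ j, c (f j)) * (of fun j => u (f j)).det ^ 2 := by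
  classical
  have expand : (momentMatrix c u).det =
      ∑ f : Fin n → ι, (∏ j, c (f j)) * (∏ j, u (f j) j) * (of fun j => u (f j)).det := by
    have h : momentMatrix c u = fun j => ∑ i, (c i * u i j) • u i := by
      ext j k
      simp [momentMatrix, Matrix.sum_apply, vecMulVec_apply, Finset.sum_apply, mul_assoc]
    rw [h]
    change detRowAlternating.toMultilinearMap _ = _
    rw [MultilinearMap.map_sum]
    refine Finset.sum_congr rfl fun f _ => ?_
    rw [MultilinearMap.map_smul_univ, Finset.prod_mul_distrib]
    rfl
  have perm (σ : Equiv.Perm (Fin n)) : (momentMatrix c u).det =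
      ∑ f : Fin n → ι, (∏ j, c (f j)) * (of fun j => u (f j)).det *
        ((Equiv.Perm.sign σ : ℤ) * ∏ j, u (f (σ j)) j) := by
    rw [expand, ← (Equiv.arrowCongr σ.symm (Equiv.refl ι)).sum_comp]
    refine Finset.sum_congr rfl fun f _ => ?_
    have h1 : ∏ j, c (f (σ j)) = ∏ j, c (f j) := Equiv.prod_comp σ fun j => c (f j)
    have h2 : (of fun j => u (f (σ j))).det
        = (Equiv.Perm.sign σ : ℤ) * (of fun j => u (f j)).det :=
      det_permute σ (of fun j => u (f j))
    simp only [Equiv.arrowCongr_apply, Equiv.symm_symm, Equiv.coe_refl, Function.comp_apply, id]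
    rw [h1, h2]
    ring
  calc (n ! : ℝ) * (momentMatrix c u).det
      = ∑ _σ : Equiv.Perm (Fin n), (momentMatrix c u).det := by
        simp [Fintype.card_perm]
    _ = ∑ f : Fin n → ι, (∏ j, c (f j)) * (of fun j => u (f j)).det *
          (of fun j => u (f j)).det := by
        rw [Finset.sum_congr rfl fun σ _ => perm σ, Finset.sum_comm]
        refine Finset.sum_congr rfl fun f _ => ?_
        rw [← Finset.mul_sum]
        congr 1
        exact (det_apply' (of fun j => u (f j))).symm
    _ = _ := by
        refine Finset.sum_congr rfl fun f _ => ?_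
        ring

theorem factorial_mul_det_momentMatrix_le {ι : Type*} [Fintype ι] {n : ℕ} {c : ι → ℝ}
    (hc : c ∈ stdSimplex ℝ ι) (u : ι → Fin n → ℝ) {D : ℝ}
    (hD : ∀ f : Fin n → ι, |(of fun j => u (f j)).det| ≤ D) :
    (n ! : ℝ) * (momentMatrix c u).det ≤ D ^ 2 := by
  classical
  rw [factorial_mul_det_momentMatrix]
  have hsum : ∑ f : Fin n → ι, ∏ j, c (f j) = 1 := by
    rw [← Fintype.piFinset_univ, ← Finset.prod_univ_sum]
    simp [hc.2]
  calc _ ≤ ∑ f : Fin n → ι, (∏ j, c (f j)) * D ^ 2 := by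
        refine Finset.sum_le_sum fun f _ => ?_
        refine mul_le_mul_of_nonneg_left ?_ (Finset.prod_nonneg fun j _ => hc.1 _)
        rw [← sq_abs]
        exact pow_le_pow_left₀ (abs_nonneg _) (hD f) 2
    _ = D ^ 2 := by rw [← Finset.sum_mul, hsum, one_mul]

theorem dotProduct_momentMatrix_mulVec {ι : Type*} [Fintype ι] {n : ℕ} (c : ι → ℝ)
    (u : ι → Fin n → ℝ) (x : Fin n → ℝ) :
    x ⬝ᵥ momentMatrix c u *ᵥ x = ∑ i, c i * (x ⬝ᵥ u i) ^ 2 := by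
  simp only [momentMatrix, Matrix.sum_mulVec, dotProduct_sum]
  refine Finset.sum_congr rfl fun i _ => ?_
  rw [smul_mulVec, vecMulVec_mulVec, dotProduct_smul, dotProduct_comm (u i) x]
  simp only [dotProduct_smul, op_smul_eq_smul, smul_eq_mul]
  ring

theorem posSemidef_momentMatrix {ι : Type*} [Fintype ι] {n : ℕ} {c : ι → ℝ}
    (hc : ∀ i, 0 ≤ c i) (u : ι → Fin n → ℝ) : (momentMatrix c u).PosSemidef := by
  refine Matrix.PosSemidef.of_dotProduct_mulVec_nonneg ?_ fun x => ?_
  · ext j k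
    simp [momentMatrix, Matrix.sum_apply, vecMulVec_apply, mul_comm]
  · rw [star_trivial, dotProduct_momentMatrix_mulVec]
    exact Finset.sum_nonneg fun i _ => mul_nonneg (hc i) (sq_nonneg _)

theorem posDef_momentMatrix {ι : Type*} [Fintype ι] {n : ℕ} {c : ι → ℝ}
    (hc : ∀ i, 0 < c i) {u : ι → Fin n → ℝ} (hu : ∀ x, (∀ i, x ⬝ᵥ u i = 0) → x = 0) :
    (momentMatrix c u).PosDef := by
  refine Matrix.PosDef.of_dotProduct_mulVec_pos
    (posSemidef_momentMatrix (fun i => (hc i).le) u).1 fun x hx => ?_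
  rw [star_trivial, dotProduct_momentMatrix_mulVec]
  obtain ⟨i, hi⟩ : ∃ i, x ⬝ᵥ u i ≠ 0 := by
    by_contra! h
    exact hx (hu x h)
  exact Finset.sum_pos' (fun i _ => mul_nonneg (hc i).le (sq_nonneg _))
    ⟨i, Finset.mem_univ i, mul_pos (hc i) (by positivity)⟩

theorem le_of_forall_one_sub_pow_mul_le {n : ℕ} (hn : 1 ≤ n) {q : ℝ}
    (h : ∀ t : ℝ, 0 < t → t < 1 → (1 - t) ^ n * (1 + t / (1 - t) * q) ≤ 1) : q ≤ n := by
  by_contra! hq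
  obtain ⟨m, rfl⟩ : ∃ m, n = m + 1 := ⟨n - 1, by omega⟩
  push_cast at hq
  have hq1 : 0 < q - 1 := by
    have : (0:ℝ) ≤ m := m.cast_nonneg
    linarith
  set d := q - (m + 1) with hd
  have hdpos : 0 < d := by linarith
  have hm : (0:ℝ) ≤ m := m.cast_nonneg
  set t := d / (2 * (d + m * (q - 1)) + 2 * d) with ht
  have hden : 0 < 2 * (d + m * (q - 1)) + 2 * d := by positivity
  have ht0 : 0 < t := by positivity
  have ht1 : t < 1 := by
    rw [ht, div_lt_one hden]
    nlinarith [mul_nonneg hm hq1.le]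
  have h1 := h t ht0 ht1
  have h2 : (1 - t) ^ (m + 1) * (1 + t / (1 - t) * q) = (1 - t) ^ m * (1 + t * (q - 1)) := by
    have : 1 - t ≠ 0 := by linarith
    field_simp
    ring
  have h3 : 1 - m * t ≤ (1 - t) ^ m := by
    have := one_add_mul_le_pow (a := -t) (by linarith) m
    calc 1 - m * t = 1 + m * (-t) := by ring
      _ ≤ _ := this
      _ = _ := by ring
  have h4 : (1 - m * t) * (1 + t * (q - 1)) ≤ 1 := by
    rw [h2] at h1
    exact (mul_le_mul_of_nonneg_right h3 (by positivity)).trans h1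
  have h5 : t * (d - m * t * (q - 1)) ≤ 0 := by
    have : (1 - m * t) * (1 + t * (q - 1)) = 1 + t * (d - m * t * (q - 1)) := by
      rw [hd]; ring
    linarith
  have h6 : t * (2 * (d + m * (q - 1)) + 2 * d) = d := div_mul_cancel₀ _ hden.ne'
  have h7 : 0 < d - m * t * (q - 1) := by
    nlinarith [mul_nonneg hm hq1.le, mul_pos ht0 hdpos,
      mul_nonneg ht0.le (mul_nonneg hm hq1.le)]
  nlinarith [mul_pos ht0 h7]

/-- Existence of a D-optimal design and the Kiefer-Wolfowitz bound. -/
theorem exists_optimal_design {ι : Type*} [Fintype ι] {n : ℕ} (hn : 1 ≤ n)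
    {u : ι → Fin n → ℝ} (hu : ∀ x, (∀ i, x ⬝ᵥ u i = 0) → x = 0) :
    ∃ c ∈ stdSimplex ℝ ι, 0 < (momentMatrix c u).det ∧
      ∀ i, u i ⬝ᵥ (momentMatrix c u)⁻¹ *ᵥ u i ≤ n := by
  classical
  have : NeZero n := ⟨by omega⟩
  have : Nonempty ι := by
    by_contra h
    rw [not_nonempty_iff] at h
    have := congrFun (hu 1 fun i => (h.false i).elim) 0
    simp at this
  have hunif : (fun _ : ι => (Fintype.card ι : ℝ)⁻¹) ∈ stdSimplex ℝ ι := by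
    refine ⟨fun _ => by positivity, ?_⟩
    simp
  have hcont : Continuous fun c : ι → ℝ => (momentMatrix c u).det := by
    unfold momentMatrix
    fun_prop
  obtain ⟨c, hc, hmax⟩ := (isCompact_stdSimplex ℝ ι).exists_isMaxOn ⟨_, hunif⟩ hcont.continuousOn
  have hpos : 0 < (momentMatrix c u).det :=
    (posDef_momentMatrix (fun _ => by positivity) hu).det_pos.trans_le (hmax hunif)
  refine ⟨c, hc, hpos, fun i => ?_⟩
  refine le_of_forall_one_sub_pow_mul_le hn fun t ht0 ht1 => ?_
  have hs : 0 < 1 - t := by linarith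
  have hmem : (1 - t) • c + t • Pi.single i 1 ∈ stdSimplex ℝ ι :=
    convex_stdSimplex ℝ ι hc (single_mem_stdSimplex ℝ i) hs.le ht0.le (by ring)
  have hmat : momentMatrix ((1 - t) • c + t • Pi.single i 1) u =
      (1 - t) • (momentMatrix c u +
        replicateCol Unit ((t / (1 - t)) • u i) * replicateRow Unit (u i)) := by
    have h1 : momentMatrix ((1 - t) • c + t • Pi.single i 1) u =
        (1 - t) • momentMatrix c u + t • vecMulVec (u i) (u i) := by
      simp [momentMatrix, add_smul, Finset.sum_add_distrib, Finset.smul_sum, mul_smul,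
        Pi.single_apply, ite_smul]
    rw [h1, ← vecMulVec_eq, smul_vecMulVec, smul_add, smul_smul, mul_div_cancel₀ _ hs.ne']
  have hle := hmax hmem
  simp only [Set.mem_ofPred_eq] at hle
  rw [hmat, det_smul, Fintype.card_fin, det_add_replicateCol_mul_replicateRow
    (isUnit_iff_ne_zero.2 hpos.ne')] at hle
  have hdet : (1 + replicateRow Unit (u i) * (momentMatrix c u)⁻¹ *
      replicateCol Unit ((t / (1 - t)) • u i)).det =
      1 + t / (1 - t) * (u i ⬝ᵥ (momentMatrix c u)⁻¹ *ᵥ u i) := by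
    rw [det_unique, Matrix.mul_assoc, ← replicateCol_mulVec, mulVec_smul]
    simp [Matrix.mul_apply, dotProduct, Finset.mul_sum]
  rw [hdet] at hle
  have : (momentMatrix c u).det * ((1 - t) ^ n *
      (1 + t / (1 - t) * (u i ⬝ᵥ (momentMatrix c u)⁻¹ *ᵥ u i))) ≤
      (momentMatrix c u).det * 1 := by linarith
  exact le_of_mul_le_mul_left this hpos

theorem volume_preimage_mulVec {n : ℕ} {B : Matrix (Fin n) (Fin n) ℝ} (hB : B.det ≠ 0)
    (s : Set (Fin n → ℝ)) :
    volume ((fun x => B *ᵥ x) ⁻¹' s) = ENNReal.ofReal |B.det|⁻¹ * volume s := by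
  have := Measure.addHaar_preimage_linearMap (volume : Measure (Fin n → ℝ))
    (f := B.toLin') (by rwa [LinearMap.det_toLin']) s
  rw [LinearMap.det_toLin', abs_inv] at this
  exact this

theorem volume_sum_abs_le {n : ℕ} (hn : 1 ≤ n) {r : ℝ} (hr : 0 ≤ r) :
    volume {x : Fin n → ℝ | ∑ i, |x i| ≤ r} = ENNReal.ofReal ((2 * r) ^ n / n !) := by
  have : NeZero n := ⟨by omega⟩
  have h := MeasureTheory.volume_sum_rpow_le (ι := Fin n) le_rfl r
  simp only [Real.rpow_one, div_one, Fintype.card_fin, one_add_one_eq_two, Real.Gamma_two,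
    mul_one, Real.Gamma_nat_eq_factorial] at h
  rw [h, ← ENNReal.ofReal_pow hr, ← ENNReal.ofReal_mul (by positivity), mul_pow]
  congr 1
  ring

/-- The volume of a simplex cut out by the `n` constraints `⟪x, a j⟫ ≤ 1` and a bound on
the sum of the `⟪x, a j⟫`. -/
theorem volume_simplex_le {n : ℕ} (hn : 1 ≤ n) {a : Fin n → Fin n → ℝ} (ha : (of a).det ≠ 0)
    {r : ℝ} (hr : 0 ≤ r) :
    volume {x : Fin n → ℝ | (∀ j, x ⬝ᵥ a j ≤ 1) ∧ -r ≤ ∑ j, x ⬝ᵥ a j} ≤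
      ENNReal.ofReal ((2 * (n + r)) ^ n / n ! / |(of a).det|) := by
  have hsub : {x : Fin n → ℝ | (∀ j, x ⬝ᵥ a j ≤ 1) ∧ -r ≤ ∑ j, x ⬝ᵥ a j} ⊆
      (fun x => of a *ᵥ x) ⁻¹' ((fun z => z + -1) ⁻¹' {z | ∑ i, |z i| ≤ n + r}) := by
    rintro x ⟨h1, h2⟩
    have h3 (j) : |(of a *ᵥ x + -1) j| = 1 - x ⬝ᵥ a j := by
      have h4 : (of a *ᵥ x + -1) j = x ⬝ᵥ a j - 1 := by
        simp [mulVec, dotProduct_comm (a j), sub_eq_add_neg]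
      rw [h4, abs_of_nonpos (sub_nonpos.2 (h1 j)), neg_sub]
    simp only [Set.mem_preimage, Set.mem_ofPred_eq, h3]
    simp
    linarith
  refine (measure_mono hsub).trans_eq ?_
  rw [volume_preimage_mulVec ha, measure_preimage_add_right, volume_sum_abs_le hn (by positivity),
    ← ENNReal.ofReal_mul (by positivity)]
  congr 1
  ring

/-- Volume bound for the polar of a finite set of vectors that are bounded in the dual of the
norm given by a positive definite matrix. -/
theorem le_volume_polar {ι : Type*} {n : ℕ} (hn : 1 ≤ n) {u : ι → Fin n → ℝ}
    {M : Matrix (Fin n) (Fin n) ℝ} (hM : M.PosSemidef) (hdet : 0 < M.det)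
    (hu : ∀ i, u i ⬝ᵥ M⁻¹ *ᵥ u i ≤ n) :
    ENNReal.ofReal ((2 / n) ^ n / √M.det) ≤ volume {x : Fin n → ℝ | ∀ i, x ⬝ᵥ u i ≤ 1} := by
  obtain ⟨B, rfl⟩ : ∃ B, M = Bᵀ * B := by
    obtain ⟨B, hB⟩ := CStarAlgebra.nonneg_iff_eq_star_mul_self.1 hM.nonneg
    exact ⟨B, by rw [hB, star_eq_conjTranspose, conjTranspose_eq_transpose_of_trivial]⟩
  have hB2 : (Bᵀ * B).det = B.det ^ 2 := by rw [det_mul, det_transpose, sq]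
  have hB : B.det ≠ 0 := by
    intro h
    rw [hB2, h] at hdet
    simp at hdet
  have hunit : IsUnit B.det := isUnit_iff_ne_zero.2 hB
  have hn0 : (0:ℝ) < n := by exact_mod_cast hn
  have hsub : (fun x => B *ᵥ x) ⁻¹' Set.Icc (fun _ => -(1 / n : ℝ)) (fun _ => 1 / n) ⊆
      {x : Fin n → ℝ | ∀ i, x ⬝ᵥ u i ≤ 1} := by
    rintro x ⟨h1, h2⟩ i
    have hx (j) : |(B *ᵥ x) j| ≤ 1 / n := abs_le.2 ⟨h1 j, h2 j⟩
    set v := (Bᵀ)⁻¹ *ᵥ u i with hv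
    have hv1 : v ⬝ᵥ v ≤ n := by
      have := hu i
      rw [Matrix.mul_inv_rev, ← mulVec_mulVec, dotProduct_mulVec, ← mulVec_transpose,
        transpose_nonsing_inv] at this
      exact this
    have hv2 : x ⬝ᵥ u i = (B *ᵥ x) ⬝ᵥ v := by
      rw [hv, dotProduct_mulVec, ← vecMul_transpose, vecMul_vecMul,
        mul_nonsing_inv _ (by rwa [det_transpose]), vecMul_one]
    have hcs : ∑ j, |v j| ≤ n := by
      have := Finset.sum_le_sum fun j (_ : j ∈ univ) =>
        (show |v j| ≤ (1 + v j * v j) / 2 by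
          nlinarith [sq_nonneg (|v j| - 1), abs_mul_abs_self (v j)])
      rw [← Finset.sum_div, Finset.sum_add_distrib] at this
      simp only [dotProduct] at hv1
      simp at this
      linarith
    rw [hv2]
    calc (B *ᵥ x) ⬝ᵥ v ≤ ∑ j, 1 / n * |v j| := by
          refine Finset.sum_le_sum fun j _ => (le_abs_self _).trans ?_
          rw [abs_mul]
          exact mul_le_mul_of_nonneg_right (hx j) (abs_nonneg _)
      _ ≤ 1 := by
          rw [← Finset.mul_sum, one_div, inv_mul_le_iff₀ hn0]
          linarith
  refine le_trans (le_of_eq ?_) (measure_mono hsub)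
  rw [volume_preimage_mulVec hB, Real.volume_Icc_pi, hB2, Real.sqrt_sq_eq_abs,
    Finset.prod_const, ← ENNReal.ofReal_pow (by rw [sub_neg_eq_add]; positivity),
    ← ENNReal.ofReal_mul (by positivity)]
  congr 1
  rw [Finset.card_fin]
  ring

/-- The Farkas lemma for the polar of a finite set of vectors. -/
theorem exists_sum_smul_of_polar {ι : Type*} [Fintype ι] {n : ℕ} {u : ι → Fin n → ℝ}
    {y : Fin n → ℝ} (hy : ∀ x, (∀ i, x ⬝ᵥ u i ≤ 1) → x ⬝ᵥ y ≤ 1) :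
    ∃ c : ι → ℝ, (∀ i, 0 ≤ c i) ∧ ∑ i, c i ≤ 1 ∧ ∑ i, c i • u i = y := by
  classical
  set A : Set (ι → ℝ) := {c | (∀ i, 0 ≤ c i) ∧ ∑ i, c i ≤ 1} with hA
  have hAconv : Convex ℝ A := by
    rintro c ⟨hc, hc'⟩ d ⟨hd, hd'⟩ s t hs ht hst
    refine ⟨fun i => add_nonneg (mul_nonneg hs (hc i)) (mul_nonneg ht (hd i)), ?_⟩
    simp only [Pi.add_apply, Pi.smul_apply, smul_eq_mul, Finset.sum_add_distrib, ← Finset.mul_sum]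
    nlinarith
  have hAcomp : IsCompact A := by
    refine (isCompact_Icc (a := (0 : ι → ℝ)) (b := 1)).of_isClosed_subset ?_ ?_
    · have h1 : IsClosed {c : ι → ℝ | ∀ i, 0 ≤ c i} := by
        simp only [Set.ofPred_forall]
        exact isClosed_iInter fun i => isClosed_le continuous_const (continuous_apply i)
      exact h1.inter (isClosed_le (f := fun c : ι → ℝ => ∑ i, c i) (by fun_prop) continuous_const)
    · rintro c ⟨hc, hc'⟩
      exact ⟨hc, fun i => (Finset.single_le_sum (fun j _ => hc j) (Finset.mem_univ i)).trans hc'⟩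
  let L : (ι → ℝ) →ₗ[ℝ] (Fin n → ℝ) := Fintype.linearCombination ℝ u
  have hL (c) : L c = ∑ i, c i • u i := rfl
  have hLc : Continuous L := L.continuous_of_finiteDimensional
  by_contra! hne
  have hy' : y ∉ L '' A := by
    rintro ⟨c, hc, rfl⟩
    exact hne c hc.1 hc.2 rfl
  obtain ⟨f, r, hfr, hfy⟩ := geometric_hahn_banach_closed_point (hAconv.linear_image L)
    (hAcomp.image hLc).isClosed hy'
  have hr : 0 < r := by
    simpa using hfr (L 0) ⟨0, ⟨fun _ => le_rfl, by simp⟩, rfl⟩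
  set x : Fin n → ℝ := fun j => r⁻¹ * f (Pi.single j 1) with hx
  have hfx (z) : x ⬝ᵥ z = r⁻¹ * f z := by
    conv_rhs => rw [← Finset.univ_sum_single z]
    rw [map_sum, Finset.mul_sum]
    refine Finset.sum_congr rfl fun j _ => ?_
    have : Pi.single j (z j) = z j • (Pi.single j 1 : Fin n → ℝ) := by
      rw [← Pi.single_smul, smul_eq_mul, mul_one]
    rw [this, map_smul, hx, smul_eq_mul]
    ring
  have h1 : x ⬝ᵥ y ≤ 1 := by
    refine hy x fun i => ?_
    rw [hfx, inv_mul_le_iff₀ hr, mul_one]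
    refine (hfr (u i) ⟨Pi.single i 1, ⟨fun j => ?_, by simp⟩, ?_⟩).le
    · by_cases h : j = i <;> simp [h]
    · rw [hL]
      simp [Pi.single_apply]
  rw [hfx, inv_mul_le_iff₀ hr, mul_one] at h1
  linarith

/-- A Carathéodory type theorem: a nonnegative combination of vectors in `ℝⁿ` can be replaced by
one of at most `n` of them without increasing the total weight. -/
theorem exists_sum_smul_card_le {ι : Type*} [Fintype ι] {n : ℕ} {u : ι → Fin n → ℝ}
    {c : ι → ℝ} (hc : ∀ i, 0 ≤ c i) :
    ∃ d : ι → ℝ, (∀ i, 0 ≤ d i) ∧ ∑ i, d i ≤ ∑ i, c i ∧ ∑ i, d i • u i = ∑ i, c i • u i ∧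
      #{i | d i ≠ 0} ≤ n := by
  classical
  induction hk : #{i | c i ≠ 0} using Nat.strong_induction_on generalizing c with
  | _ k ih =>
  by_cases hkn : k ≤ n
  · exact ⟨c, hc, le_rfl, rfl, hk ▸ hkn⟩
  set S : Finset ι := {i | c i ≠ 0} with hS
  obtain ⟨e, he0, hesum, heS, i₁, hi₁⟩ : ∃ e : ι → ℝ, ∑ i, e i • u i = 0 ∧ 0 ≤ ∑ i, e i ∧
      (∀ i ∉ S, e i = 0) ∧ ∃ i, 0 < e i := by
    have hdep : ¬ LinearIndepOn ℝ u (S : Set ι) := by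
      intro h
      have := h.linearIndependent.fintype_card_le_finrank
      simp at this
      omega
    rw [linearIndepOn_finset_iff] at hdep
    push Not at hdep
    obtain ⟨g, hg, i₀, hi₀, hgi⟩ := hdep
    set e : ι → ℝ := fun i => if i ∈ S then g i else 0 with he
    have he1 : ∑ i, e i • u i = 0 := by
      rw [← hg]
      simp [he, ite_smul]
    have he2 : ∃ i, e i ≠ 0 := ⟨i₀, by simpa [he, hi₀] using hgi⟩
    have he3 : ∀ i ∉ S, e i = 0 := fun i hi => by simp [he, hi]
    have key : ∀ e : ι → ℝ, 0 ≤ ∑ i, e i → (∃ i, e i ≠ 0) → ∃ i, 0 < e i := by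
      rintro e h ⟨i, hi⟩
      by_contra! hneg
      exact hi ((Finset.sum_eq_zero_iff_of_nonpos fun i _ => hneg i).1
        (le_antisymm (Finset.sum_nonpos fun i _ => hneg i) h) i (Finset.mem_univ i))
    rcases le_total 0 (∑ i, e i) with h | h
    · exact ⟨e, he1, h, he3, key e h he2⟩
    · refine ⟨-e, by simp [he1], by simpa using h, fun i hi => by simp [he3 i hi],
        key (-e) (by simpa using h) ?_⟩
      simpa using he2
  obtain ⟨i₂, hi₂, hmin⟩ := Finset.exists_min_image {i | 0 < e i} (fun i => c i / e i)
    ⟨i₁, by simpa using hi₁⟩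
  have hi₂ : 0 < e i₂ := by simpa using hi₂
  set τ := c i₂ / e i₂ with hτ
  have hτ0 : 0 ≤ τ := div_nonneg (hc _) hi₂.le
  set c' : ι → ℝ := fun i => c i - τ * e i with hc'
  have hc'0 : ∀ i, 0 ≤ c' i := by
    intro i
    rcases le_or_gt (e i) 0 with h | h
    · have := mul_nonpos_of_nonneg_of_nonpos hτ0 h
      have := hc i
      simp only [hc']
      linarith
    · have := hmin i (by simpa using h)
      rw [le_div_iff₀ h] at this
      simp only [hc']
      linarith
  have hcard : #{i | c' i ≠ 0} < k := by
    rw [← hk]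
    refine Finset.card_lt_card ((Finset.ssubset_iff_of_subset ?_).2 ⟨i₂, ?_, ?_⟩)
    · intro i hi
      by_contra hiS
      have : c i = 0 := by simpa [hS] using hiS
      simp [hc', heS i hiS, this] at hi
    · by_contra hiS
      exact hi₂.ne' (heS _ hiS)
    · simp [hc', hτ, hi₂.ne']
  obtain ⟨d, hd0, hds, hdu, hdc⟩ := ih _ hcard hc'0 rfl
  refine ⟨d, hd0, hds.trans ?_, hdu.trans ?_, hdc⟩
  · simp only [hc', Finset.sum_sub_distrib, ← Finset.mul_sum]
    nlinarith [mul_nonneg hτ0 hesum]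
  · simp only [hc', sub_smul, mul_smul, Finset.sum_sub_distrib, ← Finset.smul_sum, he0]
    simp

/-- A convex set with nonempty interior and finite volume is bounded. -/
theorem isBounded_of_volume_lt_top {E : Type*} [NormedAddCommGroup E] [NormedSpace ℝ E]
    [MeasurableSpace E] [BorelSpace E] {μ : Measure E} [μ.IsAddHaarMeasure]
    {P : Set E} (hP : Convex ℝ P) (hint : (interior P).Nonempty) (hvol : μ P < ⊤) :
    Bornology.IsBounded P := by
  obtain ⟨a, ha⟩ := hint
  obtain ⟨r, hr, hball⟩ := Metric.isOpen_iff.1 isOpen_interior a ha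
  have hballP : Metric.ball a r ⊆ P := hball.trans interior_subset
  have hv : μ (Metric.ball (0 : E) (r / 2)) ≠ 0 :=
    (Metric.measure_ball_pos μ _ (by positivity)).ne'
  obtain ⟨N, hN⟩ := ENNReal.exists_nat_mul_gt hv hvol.ne
  refine (Metric.isBounded_iff_subset_closedBall a).2 ⟨2 * N * r, fun y hy => ?_⟩
  rw [mem_closedBall_iff_norm]
  by_contra! hL
  set L := ‖y - a‖ with hLdef
  have hL0 : 0 < L := lt_of_le_of_lt (by positivity) hL
  set z : ℕ → E := fun k => a + (k * r / L) • (y - a) with hz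
  have hdist (k l : ℕ) : dist (z k) (z l) = |(k : ℝ) - l| * r := by
    rw [dist_eq_norm, hz]
    simp only [add_sub_add_left_eq_sub]
    rw [← sub_smul, norm_smul, ← hLdef, ← sub_div, ← sub_mul, Real.norm_eq_abs, abs_div, abs_mul,
      abs_of_pos hL0, abs_of_pos hr, div_mul_cancel₀ _ hL0.ne']
  have hdisj : (Finset.range N : Set ℕ).PairwiseDisjoint fun k => Metric.ball (z k) (r / 2) := by
    intro k _ l _ hkl
    refine Metric.ball_disjoint_ball ?_
    rw [hdist, add_halves]
    have : (1 : ℝ) ≤ |(k : ℝ) - l| := by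
      have : (1 : ℤ) ≤ |(k : ℤ) - l| := Int.one_le_abs (by omega)
      exact_mod_cast this
    nlinarith
  have hsub : (⋃ k ∈ Finset.range N, Metric.ball (z k) (r / 2)) ⊆ P := by
    refine Set.iUnion₂_subset fun k hk x hx => ?_
    have hkN : (k : ℝ) ≤ N := by exact_mod_cast (Finset.mem_range.1 hk).le
    set t := k * r / L with ht
    have ht0 : 0 ≤ t := by positivity
    have ht1 : t ≤ 1 / 2 := by
      rw [ht, div_le_iff₀ hL0]
      nlinarith
    have hs : 0 < 1 - t := by linarith
    set q := a + (1 - t)⁻¹ • (x - z k) with hq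
    have hqP : q ∈ P := by
      refine hballP ?_
      rw [mem_ball_iff_norm, hq, add_sub_cancel_left, norm_smul, Real.norm_eq_abs,
        abs_of_pos (inv_pos.2 hs), inv_mul_lt_iff₀ hs]
      rw [mem_ball_iff_norm] at hx
      nlinarith
    have hx' : x = (1 - t) • q + t • y := by
      rw [hq, smul_add, smul_smul, mul_inv_cancel₀ hs.ne', hz]
      module
    rw [hx']
    exact hP hqP hy hs.le ht0 (by ring)
  have := measure_mono (μ := μ) hsub
  rw [measure_biUnion_finset hdisj fun _ _ => measurableSet_ball] at this
  simp only [Measure.addHaar_ball_center, Finset.sum_const, Finset.card_range, nsmul_eq_mul]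
    at this
  exact absurd this (not_le.2 hN)

/-- A compact intersection of closed convex sets is approximated by a finite one, up to a
homothety. -/
theorem exists_finite_iInter_subset_homothety {E I : Type*} [NormedAddCommGroup E]
    [NormedSpace ℝ E] {A : I → Set E} (hclosed : ∀ i, IsClosed (A i))
    (hconv : ∀ i, Convex ℝ (A i)) (hcomp : IsCompact (⋂ i, A i)) {a : E}
    (ha : a ∈ interior (⋂ i, A i)) {t : ℝ} (ht : 1 < t) :
    ∃ F : Finset I, ⋂ i ∈ F, A i ⊆ AffineMap.homothety a t '' ⋂ i, A i := by
  set P := ⋂ i, A i with hP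
  set T := AffineMap.homothety a t '' P with hT
  have hPT : P ⊆ interior T :=
    (convex_iInter hconv).subset_interior_image_homothety_of_one_lt ha t ht
  have hTc : IsCompact T := hcomp.image (AffineMap.homothety_continuous a t)
  have hfr : IsCompact (frontier T) :=
    hTc.of_isClosed_subset isClosed_frontier hTc.isClosed.frontier_subset
  obtain ⟨F, hF⟩ := hfr.elim_finite_subfamily_closed A hclosed (by
    rw [← hP, Set.eq_empty_iff_forall_notMem]
    rintro x ⟨hx, hx'⟩
    exact hx.2 (hPT hx'))
  refine ⟨F, Set.Subset.trans ?_ interior_subset⟩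
  refine (convex_iInter₂ fun i _ => hconv i).isPreconnected.subset_of_closure_inter_subset
    isOpen_interior ⟨a, ?_, hPT (interior_subset ha)⟩ ?_
  · exact Set.iInter_subset_iInter₂ _ _ (interior_subset ha)
  · rintro x ⟨hx, hxF⟩
    by_contra hxT
    have hxfr : x ∈ frontier T := ⟨closure_mono interior_subset hx, hxT⟩
    exact (Set.eq_empty_iff_forall_notMem.1 hF x) ⟨hxfr, hxF⟩

/-- The matrix whose columns are the homogeneous coordinates of `n + 1` points of `ℝⁿ`. -/
def simplexMatrix {n : ℕ} (p : Fin (n + 1) → Fin n → ℝ) : Matrix (Fin (n + 1)) (Fin (n + 1)) ℝ :=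
  (of fun j => vecCons 1 (p j))ᵀ

theorem simplexMatrix_mulVec {n : ℕ} (p : Fin (n + 1) → Fin n → ℝ) (l : Fin (n + 1) → ℝ) :
    simplexMatrix p *ᵥ l = vecCons (∑ j, l j) (∑ j, l j • p j) := by
  ext k
  refine Fin.cases ?_ (fun k => ?_) k
  · simp [simplexMatrix, mulVec, dotProduct]
  · simp [simplexMatrix, mulVec, dotProduct, mul_comm]

theorem continuous_det_simplexMatrix {n : ℕ} :
    Continuous fun p : Fin (n + 1) → Fin n → ℝ => (simplexMatrix p).det := by
  refine Continuous.matrix_det ?_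
  refine continuous_matrix fun k j => ?_
  refine Fin.cases ?_ (fun k => ?_) k
  · simp [simplexMatrix, continuous_const]
  · simp only [simplexMatrix, transpose_apply, of_apply, cons_val_succ]
    fun_prop

theorem exists_det_simplexMatrix_ne_zero {n : ℕ} {P : Set (Fin n → ℝ)}
    (hint : (interior P).Nonempty) :
    ∃ p : Fin (n + 1) → Fin n → ℝ, (∀ j, p j ∈ P) ∧ (simplexMatrix p).det ≠ 0 := by
  obtain ⟨a, ha⟩ := hint
  obtain ⟨r, hr, hball⟩ := Metric.isOpen_iff.1 isOpen_interior a ha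
  refine ⟨Fin.cons a fun j => a + Pi.single j (r / 2), ?_, ?_⟩
  · refine Fin.cases ?_ fun j => ?_
    · exact interior_subset ha
    · refine interior_subset (hball ?_)
      rw [Fin.cons_succ, mem_ball_iff_norm, add_sub_cancel_left, Pi.norm_single,
        Real.norm_eq_abs, abs_of_pos (by positivity)]
      linarith
  · intro h
    obtain ⟨l, hl, hl0⟩ := exists_mulVec_eq_zero_iff.2 h
    rw [simplexMatrix_mulVec] at hl0
    have h0 : ∑ j, l j = 0 := by simpa using congrFun hl0 0
    have hs (k : Fin n) : l k.succ = 0 := by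
      have h1 := congrFun hl0 k.succ
      simp only [cons_val_succ, Fin.sum_univ_succ, Fin.cons_zero, Fin.cons_succ, smul_add,
        Finset.sum_add_distrib, ← Finset.sum_smul, ← add_assoc, ← add_smul, Pi.add_apply,
        Finset.sum_apply, Pi.smul_apply, Pi.zero_apply] at h1
      rw [← Fin.sum_univ_succ, h0] at h1
      simpa [Pi.single_apply, hr.ne'] using h1
    refine hl (funext (Fin.cases ?_ hs))
    simpa [Fin.sum_univ_succ, hs] using h0

/-- A convex body contains a point about which its asymmetry is at most `n`: the centroid of an
inscribed simplex of maximal volume. -/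
theorem exists_center {n : ℕ} (hn : 1 ≤ n) {P : Set (Fin n → ℝ)} (hconv : Convex ℝ P)
    (hcomp : IsCompact P) (hint : (interior P).Nonempty) :
    ∃ z ∈ interior P, ∀ x ∈ P, z - (n : ℝ)⁻¹ • (x - z) ∈ P := by
  obtain ⟨p₀, hp₀, hdet₀⟩ := exists_det_simplexMatrix_ne_zero hint
  obtain ⟨p, hp, hmax⟩ := (isCompact_univ_pi fun _ : Fin (n + 1) => hcomp).exists_isMaxOn
    ⟨p₀, fun j _ => hp₀ j⟩ continuous_det_simplexMatrix.abs.continuousOn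
  have hdet : 0 < |(simplexMatrix p).det| :=
    (abs_pos.2 hdet₀).trans_le (hmax fun j _ => hp₀ j)
  have hdet' : (simplexMatrix p).det ≠ 0 := abs_pos.1 hdet
  have hn0 : (0 : ℝ) < n := by exact_mod_cast hn
  set z : Fin n → ℝ := ((n : ℝ) + 1)⁻¹ • ∑ j, p j with hz
  have hrefl : ∀ x ∈ P, z - (n : ℝ)⁻¹ • (x - z) ∈ P := by
    intro x hx
    set l : Fin (n + 1) → ℝ :=
      (simplexMatrix p).det⁻¹ • cramer (simplexMatrix p) (vecCons 1 x) with hl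
    have hlx : simplexMatrix p *ᵥ l = vecCons 1 x := by
      rw [hl, mulVec_smul, mulVec_cramer, smul_smul, inv_mul_cancel₀ hdet', one_smul]
    rw [simplexMatrix_mulVec] at hlx
    have hl1 : ∑ j, l j = 1 := by simpa using congrFun hlx 0
    have hlp : ∑ j, l j • p j = x := funext fun k => by simpa using congrFun hlx k.succ
    have hle (j) : l j ≤ 1 := by
      have hupd : (simplexMatrix p).updateCol j (vecCons 1 x) =
          simplexMatrix (Function.update p j x) := by
        ext k i
        by_cases h : i = j
        · subst h; simp [simplexMatrix]
        · simp [simplexMatrix, h]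
      have := hmax (show Function.update p j x ∈ Set.univ.pi fun _ => P from fun i _ => by
        by_cases h : i = j
        · subst h; simpa using hx
        · simpa [h] using hp i trivial)
      simp only [Set.mem_ofPred_eq] at this
      rw [hl, Pi.smul_apply, cramer_apply, hupd, smul_eq_mul]
      refine (le_abs_self _).trans ?_
      rwa [abs_mul, abs_inv, inv_mul_le_iff₀ hdet, mul_one]
    have hcomb : z - (n : ℝ)⁻¹ • (x - z) = ∑ j, ((n : ℝ)⁻¹ * (1 - l j)) • p j := by
      simp only [mul_smul, ← Finset.smul_sum, sub_smul, one_smul, Finset.sum_sub_distrib, hlp]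
      have : ∑ j, p j = ((n : ℝ) + 1) • z := by
        rw [hz, smul_smul, mul_inv_cancel₀ (by positivity), one_smul]
      rw [this]
      match_scalars
      · field_simp
        ring
      · ring
    rw [hcomb]
    refine hconv.sum_mem (fun j _ => mul_nonneg (by positivity) (sub_nonneg.2 (hle j))) ?_
      fun j _ => hp j trivial
    rw [← Finset.mul_sum, Finset.sum_sub_distrib, hl1]
    simp [hn0.ne']
  refine ⟨z, ?_, hrefl⟩
  obtain ⟨a, ha⟩ := hint
  have := hconv.combo_interior_closure_mem_interior ha
    (subset_closure (hrefl a (interior_subset ha))) (a := ((n : ℝ) + 1)⁻¹)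
    (b := n * ((n : ℝ) + 1)⁻¹) (by positivity) (by positivity) (by field_simp; ring)
  convert this using 1
  match_scalars
  · field_simp
    ring
  · field_simp
    ring

theorem factorial_ratio_le {n : ℕ} (hn : 1 ≤ n) :
    2 ^ n * ((n : ℝ) ^ 2 * (n + 1)) ^ n / (n ! * √(n ! : ℝ)) ≤
      (12 * (n : ℝ)) ^ ((3 * (n : ℝ)) / 2) := by
  have hn1 : (1 : ℝ) ≤ n := by exact_mod_cast hn
  have hfac : (n : ℝ) ^ n ≤ 3 ^ n * n ! := by
    have h1 := Real.pow_div_factorial_le_exp (x := n) n.cast_nonneg n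
    rw [div_le_iff₀ (by positivity)] at h1
    refine h1.trans (mul_le_mul_of_nonneg_right ?_ (by positivity))
    rw [← mul_one (n : ℝ), Real.exp_nat_mul]
    exact pow_le_pow_left₀ (Real.exp_pos _).le (Real.exp_one_lt_d9.le.trans (by norm_num)) n
  have hrhs : ((12 * (n : ℝ)) ^ ((3 * (n : ℝ)) / 2)) ^ 2 = (12 * (n : ℝ)) ^ (3 * n) := by
    rw [← Real.rpow_natCast, ← Real.rpow_mul (by positivity), ← Real.rpow_natCast]
    congr 1
    push_cast
    ring
  refine le_of_sq_le_sq ?_ (by positivity)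
  rw [hrhs, div_pow, div_le_iff₀ (by positivity), mul_pow (n ! : ℝ), Real.sq_sqrt (by positivity)]
  calc (2 ^ n * ((n : ℝ) ^ 2 * (n + 1)) ^ n) ^ 2
      ≤ (2 ^ n * ((n : ℝ) ^ 2 * (n + n)) ^ n) ^ 2 := by gcongr
    _ = 16 ^ n * (n : ℝ) ^ (3 * n) * ((n : ℝ) ^ n) ^ 3 := by
        have : (16 : ℝ) ^ n = (2 ^ n) ^ 4 := by rw [pow_right_comm]; norm_num
        rw [this]
        ring
    _ ≤ 16 ^ n * (n : ℝ) ^ (3 * n) * (3 ^ n * n !) ^ 3 := by gcongr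
    _ = 432 ^ n * (n : ℝ) ^ (3 * n) * ((n ! : ℝ) ^ 2 * n !) := by
        have : (432 : ℝ) ^ n = 16 ^ n * (3 ^ n) ^ 3 := by
          rw [pow_right_comm, ← mul_pow]; norm_num
        rw [this]
        ring
    _ ≤ 1728 ^ n * (n : ℝ) ^ (3 * n) * ((n ! : ℝ) ^ 2 * n !) := by gcongr; norm_num
    _ = (12 * (n : ℝ)) ^ (3 * n) * ((n ! : ℝ) ^ 2 * n !) := by
        rw [mul_pow, pow_mul 12]
        norm_num

/-- The quantitative Helly theorem for a polytope in polar form whose asymmetry about the origin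
is at most `n`. -/
theorem exists_subfamily_of_centered {ι : Type*} [Fintype ι] {n : ℕ} (hn : 1 ≤ n)
    {u : ι → Fin n → ℝ} (hu : ∀ x, (∀ i, x ⬝ᵥ u i = 0) → x = 0)
    (hcen : ∀ x, (∀ i, x ⬝ᵥ u i ≤ 1) → ∀ i, -(n : ℝ) ≤ x ⬝ᵥ u i) :
    ∃ s : Finset ι, #s ≤ 2 * n ∧ volume {x : Fin n → ℝ | ∀ i ∈ s, x ⬝ᵥ u i ≤ 1} ≤
      ENNReal.ofReal (((n : ℝ) ^ 2 * (n + 1)) ^ n / (n ! * √(n ! : ℝ))) *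
        volume {x : Fin n → ℝ | ∀ i, x ⬝ᵥ u i ≤ 1} := by
  classical
  have hn0 : (0 : ℝ) < n := by exact_mod_cast hn
  obtain ⟨c, hc, hdet, hopt⟩ := exists_optimal_design hn hu
  have : Nonempty (Fin n → ι) := by
    by_contra h
    rw [not_nonempty_iff] at h
    have := factorial_mul_det_momentMatrix c u
    rw [Finset.univ_eq_empty, Finset.sum_empty] at this
    exact (mul_pos (by positivity) hdet).ne' this
  obtain ⟨f, -, hf⟩ := Finset.exists_max_image (univ : Finset (Fin n → ι))
    (fun f => |(of fun j => u (f j)).det|) Finset.univ_nonempty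
  set D := |(of fun j => u (f j)).det| with hD
  have hbound := factorial_mul_det_momentMatrix_le hc u (D := D) fun g => hf g (Finset.mem_univ g)
  have hD0 : 0 < D := by
    refine (abs_nonneg _).lt_of_ne fun h => ?_
    rw [← hD] at h
    rw [← h] at hbound
    have : 0 < (n ! : ℝ) * (momentMatrix c u).det := by positivity
    norm_num at hbound
    linarith
  -- the point opposite to the average of the chosen vectors
  obtain ⟨e, he0, he1, hey⟩ := exists_sum_smul_of_polar (u := u)
      (y := -((n : ℝ) ^ 2)⁻¹ • ∑ j, u (f j)) fun x hx => by
    have hsum : -((n : ℝ) * n) ≤ ∑ j, x ⬝ᵥ u (f j) := by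
      have := Finset.sum_le_sum fun j (_ : j ∈ (univ : Finset (Fin n))) => hcen x hx (f j)
      simpa using this
    rw [dotProduct_smul, dotProduct_sum, smul_eq_mul, neg_mul, ← mul_neg,
      inv_mul_le_iff₀ (by positivity)]
    nlinarith
  obtain ⟨d, hd0, hd1, hdy, hdn⟩ := exists_sum_smul_card_le (u := u) he0
  refine ⟨univ.image f ∪ ({i | d i ≠ 0} : Finset ι), ?_, ?_⟩
  · have h1 : #(univ.image f) ≤ n := Finset.card_image_le.trans_eq (Finset.card_fin n)
    have := Finset.card_union_le (univ.image f) ({i | d i ≠ 0} : Finset ι)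
    omega
  have hQ : {x : Fin n → ℝ | ∀ i ∈ univ.image f ∪ ({i | d i ≠ 0} : Finset ι), x ⬝ᵥ u i ≤ 1} ⊆
      {x : Fin n → ℝ | (∀ j, x ⬝ᵥ u (f j) ≤ 1) ∧ -((n : ℝ) ^ 2) ≤ ∑ j, x ⬝ᵥ u (f j)} := by
    intro x hx
    refine ⟨fun j => hx _ (by simp), ?_⟩
    have h1 : x ⬝ᵥ ∑ i, d i • u i ≤ 1 := by
      rw [dotProduct_sum]
      refine (Finset.sum_le_sum fun i _ => ?_).trans (hd1.trans he1)
      rw [dotProduct_smul, smul_eq_mul]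
      by_cases h : d i = 0
      · simp [h]
      · exact mul_le_of_le_one_right (hd0 i) (hx i (by simp [h]))
    rw [hdy, hey, dotProduct_smul, dotProduct_sum, smul_eq_mul, neg_mul, ← mul_neg,
      inv_mul_le_iff₀ (by positivity)] at h1
    linarith
  have hP := le_volume_polar hn (posSemidef_momentMatrix hc.1 u) hdet hopt
  refine (measure_mono hQ).trans ((volume_simplex_le hn (a := fun j => u (f j))
    (abs_pos.1 hD0) (by positivity)).trans (le_trans ?_ (mul_le_mul_right hP _)))
  rw [← ENNReal.ofReal_mul (by positivity)]
  refine ENNReal.ofReal_le_ofReal ?_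
  rw [← hD]
  have hsq : √(n ! : ℝ) * √(momentMatrix c u).det ≤ D := by
    rw [← Real.sqrt_mul (by positivity)]
    exact Real.sqrt_le_iff.2 ⟨hD0.le, hbound⟩
  have hs : 0 < √(momentMatrix c u).det := Real.sqrt_pos.2 hdet
  have hnum : (2 * ((n : ℝ) + n ^ 2)) ^ n = ((n : ℝ) ^ 2 * (n + 1)) ^ n * (2 / n) ^ n := by
    rw [← mul_pow]
    congr 1
    field_simp
    ring
  calc (2 * ((n : ℝ) + n ^ 2)) ^ n / n ! / D
      ≤ (2 * ((n : ℝ) + n ^ 2)) ^ n / n ! / (√(n ! : ℝ) * √(momentMatrix c u).det) := by gcongr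
    _ = _ := by
      rw [hnum]
      field_simp

theorem volume_iInter_halfSpace_eq {ι : Type*} {n : ℕ} {w : ι → Fin n → ℝ} {b : ι → ℝ}
    {z : Fin n → ℝ} (hz : ∀ i, z ⬝ᵥ w i < b i) (s : Set ι) :
    volume {x : Fin n → ℝ | ∀ i ∈ s, x ⬝ᵥ ((b i - z ⬝ᵥ w i)⁻¹ • w i) ≤ 1} =
      volume {x : Fin n → ℝ | ∀ i ∈ s, x ⬝ᵥ w i ≤ b i} := by
  rw [← measure_preimage_add_right volume z {x : Fin n → ℝ | ∀ i ∈ s, x ⬝ᵥ w i ≤ b i}]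
  congr 1
  ext x
  refine forall₂_congr fun i _ => ?_
  rw [dotProduct_smul, smul_eq_mul, inv_mul_le_iff₀ (sub_pos.2 (hz i)), mul_one, add_dotProduct,
    le_sub_iff_add_le]

theorem lt_of_mem_interior_halfSpace {n : ℕ} {w : Fin n → ℝ} (hw : w ≠ 0) {b : ℝ}
    {P : Set (Fin n → ℝ)} (hP : ∀ x ∈ P, x ⬝ᵥ w ≤ b) {z : Fin n → ℝ} (hz : z ∈ interior P) :
    z ⬝ᵥ w < b := by
  have hlim : Filter.Tendsto (fun t : ℝ => z + t • w) (nhdsWithin 0 (Set.Ioi 0)) (nhds z) := by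
    have : Continuous fun t : ℝ => z + t • w := by fun_prop
    simpa using (this.tendsto 0).mono_left nhdsWithin_le_nhds
  obtain ⟨t, ht, ht0⟩ := ((hlim.eventually (mem_interior_iff_mem_nhds.1 hz)).and
    self_mem_nhdsWithin).exists
  have h1 := hP _ ht
  rw [add_dotProduct, smul_dotProduct, smul_eq_mul] at h1
  have h2 : 0 < w ⬝ᵥ w := by simpa using dotProduct_star_self_pos_iff.2 hw
  have h3 : 0 < t * (w ⬝ᵥ w) := mul_pos ht0 h2
  linarith

theorem exists_subfamily_of_finite {ι : Type*} [Fintype ι] {n : ℕ} (hn : 1 ≤ n)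
    {w : ι → Fin n → ℝ} {b : ι → ℝ} (hw : ∀ i, w i ≠ 0)
    (hbdd : Bornology.IsBounded {x : Fin n → ℝ | ∀ i, x ⬝ᵥ w i ≤ b i})
    (hint : (interior {x : Fin n → ℝ | ∀ i, x ⬝ᵥ w i ≤ b i}).Nonempty) :
    ∃ s : Finset ι, #s ≤ 2 * n ∧ volume {x : Fin n → ℝ | ∀ i ∈ s, x ⬝ᵥ w i ≤ b i} ≤
      ENNReal.ofReal (((n : ℝ) ^ 2 * (n + 1)) ^ n / (n ! * √(n ! : ℝ))) *
        volume {x : Fin n → ℝ | ∀ i, x ⬝ᵥ w i ≤ b i} := by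
  have hn0 : (0 : ℝ) < n := by exact_mod_cast hn
  set P := {x : Fin n → ℝ | ∀ i, x ⬝ᵥ w i ≤ b i} with hP
  have hPconv : Convex ℝ P := by
    intro x hx y hy s t hs ht hst i
    rw [add_dotProduct, smul_dotProduct, smul_dotProduct, smul_eq_mul, smul_eq_mul]
    have h1 := mul_le_mul_of_nonneg_left (hx i) hs
    have h2 := mul_le_mul_of_nonneg_left (hy i) ht
    calc _ ≤ s * b i + t * b i := add_le_add h1 h2
      _ = b i := by rw [← add_mul, hst, one_mul]
  have hPclosed : IsClosed P := by
    rw [hP, Set.ofPred_forall]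
    exact isClosed_iInter fun i =>
      isClosed_le (continuous_id.dotProduct continuous_const) continuous_const
  obtain ⟨z, hz, hrefl⟩ := exists_center hn hPconv
    (Metric.isCompact_of_isClosed_isBounded hPclosed hbdd) hint
  have hzb (i) : z ⬝ᵥ w i < b i :=
    lt_of_mem_interior_halfSpace (hw i) (P := P) (fun x hx => hx i) hz
  set u : ι → Fin n → ℝ := fun i => (b i - z ⬝ᵥ w i)⁻¹ • w i with hu
  have hxu (x : Fin n → ℝ) (i) (r : ℝ) : x ⬝ᵥ u i ≤ r ↔ x ⬝ᵥ w i ≤ (b i - z ⬝ᵥ w i) * r := by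
    rw [hu, dotProduct_smul, smul_eq_mul, inv_mul_le_iff₀ (sub_pos.2 (hzb i))]
  have hmem {x : Fin n → ℝ} (hx : ∀ i, x ⬝ᵥ u i ≤ 1) : x + z ∈ P := fun i => by
    have := (hxu x i 1).1 (hx i)
    rw [add_dotProduct]
    linarith
  have hspan : ∀ x, (∀ i, x ⬝ᵥ u i = 0) → x = 0 := by
    intro x hx
    by_contra hx0
    obtain ⟨R, hR⟩ := hbdd.exists_norm_le
    have hR0 : 0 ≤ R := (norm_nonneg _).trans (hR z (interior_subset hz))
    have hxn : 0 < ‖x‖ := norm_pos_iff.2 hx0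
    set t := (R + ‖z‖ + 1) / ‖x‖ with ht
    have := hR _ (hmem (x := t • x) fun i => by rw [smul_dotProduct, hx i]; simp)
    have h1 : ‖t • x‖ = R + ‖z‖ + 1 := by
      rw [norm_smul, Real.norm_eq_abs, abs_of_nonneg (by positivity), ht, div_mul_cancel₀ _ hxn.ne']
    have h2 := norm_sub_le (t • x + z) z
    rw [add_sub_cancel_right, h1] at h2
    linarith
  have hcen : ∀ x, (∀ i, x ⬝ᵥ u i ≤ 1) → ∀ i, -(n : ℝ) ≤ x ⬝ᵥ u i := by
    intro x hx i
    have h1 := hrefl _ (hmem hx) i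
    rw [add_sub_cancel_right, sub_dotProduct, smul_dotProduct, smul_eq_mul] at h1
    have h2 : (-(n : ℝ)⁻¹ • x) ⬝ᵥ u i ≤ 1 := by
      rw [hxu, smul_dotProduct, smul_eq_mul]
      linarith
    rw [smul_dotProduct, smul_eq_mul, neg_mul, ← mul_neg, inv_mul_le_iff₀ hn0] at h2
    linarith
  obtain ⟨s, hs, hvol⟩ := exists_subfamily_of_centered hn hspan hcen
  refine ⟨s, hs, ?_⟩
  have h1 := volume_iInter_halfSpace_eq hzb (s : Set ι)
  have h2 := volume_iInter_halfSpace_eq hzb (Set.univ : Set ι)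
  simp only [Finset.mem_coe] at h1
  simp only [Set.mem_univ, forall_const] at h2
  rw [← h1, hP, ← h2]
  exact hvol

theorem exists_subfamily_of_volume_pos {I : Type*} {n : ℕ} (hn : 1 ≤ n)
    {w : I → Fin n → ℝ} {b : I → ℝ} (hw : ∀ i, w i ≠ 0)
    (hpos : 0 < volume {x : Fin n → ℝ | ∀ i, x ⬝ᵥ w i ≤ b i}) :
    ∃ s : Finset I, #s ≤ 2 * n ∧ volume {x : Fin n → ℝ | ∀ i ∈ s, x ⬝ᵥ w i ≤ b i} ≤
      ENNReal.ofReal ((12 * (n : ℝ)) ^ ((3 * (n : ℝ)) / 2)) *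
        volume {x : Fin n → ℝ | ∀ i, x ⬝ᵥ w i ≤ b i} := by
  classical
  have hn0 : (0 : ℝ) < n := by exact_mod_cast hn
  set A : I → Set (Fin n → ℝ) := fun i => {x | x ⬝ᵥ w i ≤ b i} with hA
  have hAconv (i) : Convex ℝ (A i) := by
    refine convex_halfSpace_le (f := fun x => x ⬝ᵥ w i) ⟨fun x y => ?_, fun r x => ?_⟩ (b i)
    · exact add_dotProduct x y (w i)
    · exact smul_dotProduct r x (w i)
  have hAclosed (i) : IsClosed (A i) :=
    isClosed_le (continuous_id.dotProduct continuous_const) continuous_const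
  have hPA : {x : Fin n → ℝ | ∀ i, x ⬝ᵥ w i ≤ b i} = ⋂ i, A i := Set.ofPred_forall _
  rw [hPA] at hpos ⊢
  rcases eq_or_ne (volume (⋂ i, A i)) ⊤ with htop | htop
  · refine ⟨∅, by simp, ?_⟩
    rw [htop, ENNReal.mul_top (by simp only [ne_eq, ENNReal.ofReal_eq_zero, not_le]; positivity)]
    exact le_top
  have hconv : Convex ℝ (⋂ i, A i) := convex_iInter hAconv
  have hint : (interior (⋂ i, A i)).Nonempty := by
    by_contra h
    rw [Set.not_nonempty_iff_eq_empty] at h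
    have h1 := hconv.addHaar_frontier volume
    rw [frontier, h, Set.sdiff_empty] at h1
    exact hpos.ne' (measure_mono_null subset_closure h1)
  have hcomp : IsCompact (⋂ i, A i) := Metric.isCompact_of_isClosed_isBounded
    (isClosed_iInter hAclosed) (isBounded_of_volume_lt_top hconv hint htop.lt_top)
  obtain ⟨a, ha⟩ := hint
  obtain ⟨F, hF⟩ := exists_finite_iInter_subset_homothety hAclosed hAconv hcomp ha one_lt_two
  have hPF : {x : Fin n → ℝ | ∀ i : F, x ⬝ᵥ w i ≤ b i} = ⋂ i ∈ F, A i := by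
    ext x
    simp [hA]
  obtain ⟨s, hs, hvol⟩ := exists_subfamily_of_finite hn (w := fun i : F => w i)
    (b := fun i : F => b i) (fun i => hw i)
    (hPF ▸ (hcomp.image (AffineMap.homothety_continuous a 2)).isBounded.subset hF)
    (hPF ▸ ⟨a, interior_mono (Set.iInter_subset_iInter₂ _ _) ha⟩)
  refine ⟨s.image Subtype.val, Finset.card_image_le.trans hs, ?_⟩
  have hsF : {x : Fin n → ℝ | ∀ i ∈ s.image Subtype.val, x ⬝ᵥ w i ≤ b i} =
      {x : Fin n → ℝ | ∀ i ∈ s, x ⬝ᵥ w i ≤ b i} := by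
    ext x
    simp
  rw [hsF]
  refine hvol.trans ?_
  rw [hPF]
  have h2 : volume (⋂ i ∈ F, A i) ≤ ENNReal.ofReal (2 ^ n) * volume (⋂ i, A i) := by
    refine (measure_mono hF).trans_eq ?_
    rw [Measure.addHaar_image_homothety, finrank_fin_fun, abs_of_pos (by positivity)]
  refine (mul_le_mul_right h2 _).trans ?_
  rw [← mul_assoc, ← ENNReal.ofReal_mul (by positivity)]
  refine mul_le_mul_left (ENNReal.ofReal_le_ofReal (le_of_eq_of_le ?_ (factorial_ratio_le hn))) _
  ring

/-- Quantitative Helly: there is an absolute constant `C > 0` such that for every `n ≥ 1`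
and every family of closed half-spaces `{x : ⟪x, w i⟫ ≤ b i}` (with `w i ≠ 0`) in `ℝⁿ`
whose intersection has positive volume, some `s ≤ 2n` of them have intersection of volume
at most `(C n)^{3n/2}` times the volume of the whole intersection. -/
theorem quantitative_helly_two_n :
    ∃ C : ℝ, 0 < C ∧
      ∀ (n : ℕ), 1 ≤ n →
      ∀ (I : Type) (w : I → EuclideanSpace ℝ (Fin n)) (b : I → ℝ),
        (∀ i, w i ≠ 0) →
        0 < volume (⋂ i, {x : EuclideanSpace ℝ (Fin n) | ⟪x, w i⟫ ≤ b i}) →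
        ∃ (s : ℕ) (idx : Fin s → I), s ≤ 2 * n ∧
          volume (⋂ j, {x : EuclideanSpace ℝ (Fin n) | ⟪x, w (idx j)⟫ ≤ b (idx j)}) ≤
            ENNReal.ofReal ((C * n) ^ ((3 * (n : ℝ)) / 2)) *
              volume (⋂ i, {x : EuclideanSpace ℝ (Fin n) | ⟪x, w i⟫ ≤ b i}) := by
  refine ⟨12, by norm_num, fun n hn I w b hw hpos => ?_⟩
  have hvol {J : Type} (g : J → I) :
      volume (⋂ j, {x : EuclideanSpace ℝ (Fin n) | ⟪x, w (g j)⟫ ≤ b (g j)}) =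
        volume {x : Fin n → ℝ | ∀ j, x ⬝ᵥ (w (g j)).ofLp ≤ b (g j)} := by
    rw [← (PiLp.volume_preserving_ofLp (Fin n)).measure_preimage_equiv
      (f := (MeasurableEquiv.toLp 2 (Fin n → ℝ)).symm)]
    congr 1
    ext x
    simp [EuclideanSpace.inner_eq_star_dotProduct, dotProduct_comm]
  have hI := hvol (id : I → I)
  simp only [id] at hI
  rw [hI] at hpos ⊢
  obtain ⟨s, hs, hsvol⟩ := exists_subfamily_of_volume_pos hn
    (fun i => by simpa using hw i) hpos
  refine ⟨#s, fun j => s.equivFin.symm j, hs, ?_⟩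
  rw [hvol]
  convert hsvol using 3
  ext x
  refine (s.equivFin.symm.forall_congr_right
    (q := fun i : s => x ⬝ᵥ (w i).ofLp ≤ b i)).trans ?_
  simp
end

section
/- Let {P_i : i ∈ I} be a family of symmetric strips P_i = {x ∈ ℝⁿ : |⟨x,w_i⟩| ≤ 1} in ℝⁿ such that P = ⋂_{i∈I} P_i has positive volume. Then for every d > 1 there exist s ≤ dn and indices i_1, …, i_s ∈ I such that |P_{i_1} ∩ ⋯ ∩ P_{i_s}| ≤ (4γ_d/π)^{n/2} Γ(n/2 + 1) |P|, where γ_d := ((√d + 1)/(√d − 1))². -/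
open MeasureTheory
open scoped RealInnerProductSpace

open Matrix in
/-- If the rows `vₖ` of `V` satisfy `∑ vₖ vₖᵀ = 1`, then
`∏ tₖ ^ |vₖ|² ≤ det (∑ tₖ vₖ vₖᵀ)` for all nonnegative `tₖ`. -/
lemma prod_rpow_le_det_of_transpose_mul_self_eq_one {m n : ℕ} (V : Matrix (Fin m) (Fin n) ℝ)
    (hV : Vᵀ * V = 1) (t : Fin m → ℝ) (ht : ∀ k, 0 ≤ t k) :
    ∏ k, t k ^ (V k ⬝ᵥ V k) ≤ (Vᵀ * diagonal t * V).det := by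
  have hM : (Vᵀ * diagonal t * V).IsHermitian := by
    simp [IsHermitian, Matrix.mul_assoc]
  set M := Vᵀ * diagonal t * V with hMdef
  set U : Matrix (Fin n) (Fin n) ℝ := hM.eigenvectorUnitary.1 with hU
  have hUU : Uᵀ * U = 1 := by
    have := (Unitary.mem_iff.1 hM.eigenvectorUnitary.2).1
    simpa [star_eq_conjTranspose] using this
  have hUU' : U * Uᵀ = 1 := by
    have := (Unitary.mem_iff.1 hM.eigenvectorUnitary.2).2
    simpa [star_eq_conjTranspose] using this
  set W := V * U with hW
  have hWW : Wᵀ * W = 1 := by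
    rw [hW, transpose_mul, Matrix.mul_assoc, ← Matrix.mul_assoc Vᵀ, hV, Matrix.one_mul, hUU]
  have hWW' : W * Wᵀ = V * Vᵀ := by
    rw [hW, transpose_mul, Matrix.mul_assoc, ← Matrix.mul_assoc U, hUU', Matrix.one_mul]
  have hdiag : Wᵀ * diagonal t * W = diagonal hM.eigenvalues := by
    have h := hM.spectral_theorem
    have h2 : M = U * diagonal hM.eigenvalues * Uᵀ := by
      conv_lhs => rw [h]
      simp [Unitary.conjStarAlgAut_apply, star_eq_conjTranspose, hU]
    calc Wᵀ * diagonal t * W = Uᵀ * M * U := by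
          rw [hW, hMdef, transpose_mul]; simp only [Matrix.mul_assoc]
      _ = Uᵀ * (U * diagonal hM.eigenvalues * Uᵀ) * U := congrArg (Uᵀ * · * U) h2
      _ = (Uᵀ * U) * diagonal hM.eigenvalues * (Uᵀ * U) := by simp only [Matrix.mul_assoc]
      _ = _ := by rw [hUU]; simp
  have hev : ∀ l, hM.eigenvalues l = ∑ k, W k l ^ 2 * t k := by
    intro l
    have := congrFun (congrFun hdiag l) l
    rw [diagonal_apply_eq] at this
    rw [← this, mul_apply]
    refine Finset.sum_congr rfl fun k _ => ?_
    rw [mul_diagonal, transpose_apply]; ring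
  have hsum : ∀ l, ∑ k, W k l ^ 2 = 1 := by
    intro l
    have := congrFun (congrFun hWW l) l
    rw [mul_apply, one_apply_eq] at this
    rw [← this]
    exact Finset.sum_congr rfl fun k _ => by rw [transpose_apply]; ring
  have hrow : ∀ k, V k ⬝ᵥ V k = ∑ l, W k l ^ 2 := by
    intro k
    have := congrFun (congrFun hWW' k) k
    simp only [mul_apply, transpose_apply] at this
    rw [dotProduct, ← this]
    exact Finset.sum_congr rfl fun l _ => by ring
  have hdet : M.det = ∏ l, hM.eigenvalues l := by
    simpa using hM.det_eq_prod_eigenvalues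
  rw [hdet]
  calc ∏ k, t k ^ (V k ⬝ᵥ V k) = ∏ k, ∏ l, t k ^ (W k l ^ 2) := by
        refine Finset.prod_congr rfl fun k _ => ?_
        rw [hrow, Real.rpow_sum_of_nonneg (ht k) fun l _ => sq_nonneg _]
    _ = ∏ l, ∏ k, t k ^ (W k l ^ 2) := Finset.prod_comm
    _ ≤ ∏ l, hM.eigenvalues l := by
        refine Finset.prod_le_prod
          (fun l _ => Finset.prod_nonneg fun k _ => Real.rpow_nonneg (ht k) _) fun l _ => ?_
        rw [hev]
        exact Real.geom_mean_le_arith_mean_weighted _ _ _ (fun k _ => sq_nonneg _) (hsum l)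
          fun k _ => ht k

open Matrix in
lemma dotProduct_transpose_mulVec_self_le {m n : ℕ} (V : Matrix (Fin m) (Fin n) ℝ)
    (hV : Vᵀ * V = 1) (c : Fin m → ℝ) : (Vᵀ *ᵥ c) ⬝ᵥ (Vᵀ *ᵥ c) ≤ c ⬝ᵥ c := by
  set z := Vᵀ *ᵥ c with hz
  have h1 : c ⬝ᵥ (V *ᵥ z) = z ⬝ᵥ z := by
    rw [dotProduct_mulVec, ← mulVec_transpose]
  have h2 : (V *ᵥ z) ⬝ᵥ (V *ᵥ z) = z ⬝ᵥ z := by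
    rw [dotProduct_mulVec, ← mulVec_transpose, mulVec_mulVec, hV, one_mulVec]
  have h3 : 0 ≤ (c - V *ᵥ z) ⬝ᵥ (c - V *ᵥ z) :=
    Finset.sum_nonneg fun i _ => mul_self_nonneg _
  rw [sub_dotProduct, dotProduct_sub, dotProduct_sub, dotProduct_comm (V *ᵥ z) c, h1, h2] at h3
  linarith

lemma rpow_le_prod_sqrt_rpow_self {m n : ℕ} (hn : 0 < n) (hm : 0 < m) (τ : Fin m → ℝ)
    (hτ : ∀ k, 0 ≤ τ k) (hsum : ∑ k, τ k = n) :
    ((n : ℝ) / m) ^ ((n : ℝ) / 2) ≤ ∏ k, √(τ k) ^ τ k := by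
  have hn' : (0 : ℝ) < n := by exact_mod_cast hn
  have hm' : (0 : ℝ) < m := by exact_mod_cast hm
  have key : ∏ k, (τ k)⁻¹ ^ (τ k / n) ≤ (m : ℝ) / n := by
    refine (Real.geom_mean_le_arith_mean_weighted Finset.univ (fun k => τ k / n)
      (fun k => (τ k)⁻¹) (fun k _ => div_nonneg (hτ k) hn'.le)
      (by rw [← Finset.sum_div, hsum, div_self hn'.ne']) (fun k _ => inv_nonneg.2 (hτ k))).trans ?_
    calc ∑ k, τ k / n * (τ k)⁻¹ ≤ ∑ k : Fin m, 1 / (n : ℝ) := by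
          refine Finset.sum_le_sum fun k _ => ?_
          rcases eq_or_ne (τ k) 0 with h | h
          · simp [h]
          · field_simp; exact le_rfl
      _ = (m : ℝ) / n := by simp [div_eq_mul_inv]
  have hprod : ∏ k, √(τ k) ^ τ k = ((∏ k, (τ k)⁻¹ ^ (τ k / n))⁻¹) ^ ((n : ℝ) / 2) := by
    rw [← Finset.prod_inv_distrib, ← Real.finsetProd_rpow]
    · refine Finset.prod_congr rfl fun k _ => ?_
      rw [Real.inv_rpow (hτ k), inv_inv, ← Real.rpow_mul (hτ k), Real.sqrt_eq_rpow,
        ← Real.rpow_mul (hτ k)]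
      congr 1; field_simp
    · intro k _
      exact inv_nonneg.2 (Real.rpow_nonneg (inv_nonneg.2 (hτ k)) _)
  have hpos : 0 < ∏ k, (τ k)⁻¹ ^ (τ k / n) := by
    refine Finset.prod_pos fun k _ => ?_
    rcases (hτ k).eq_or_lt with h | h
    · simp [← h]
    · positivity
  rw [hprod]
  refine Real.rpow_le_rpow (by positivity) ?_ (by positivity)
  rw [← inv_div]
  exact inv_anti₀ hpos key

/-- The monotone transport of the uniform measure on `(-1, 1)` to the Gaussian measure. -/
lemma exists_hasDerivAt_exp_pi_mul_sq_div_two :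
    ∃ T : ℝ → ℝ, ∀ s ∈ Set.Ioo (-1 : ℝ) 1,
      HasDerivAt T (Real.exp (Real.pi * T s ^ 2) / 2) s := by
  set f : ℝ → ℝ := fun x => 2 * Real.exp (-Real.pi * x ^ 2) with hf
  have hfc : Continuous f := by fun_prop
  have hfi : Integrable f := (integrable_exp_neg_mul_sq Real.pi_pos).const_mul 2
  set F : ℝ → ℝ := fun t => ∫ x in (0 : ℝ)..t, f x with hF
  have hFd : ∀ t, HasDerivAt F (f t) t := fun t => by
    exact intervalIntegral.integral_hasDerivAt_right (hfc.intervalIntegrable _ _)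
      hfc.stronglyMeasurable.stronglyMeasurableAtFilter hfc.continuousAt
  have hFc : Continuous F := continuous_iff_continuousAt.2 fun t => (hFd t).continuousAt
  have hFm : StrictMono F := strictMono_of_hasDerivAt_pos hFd fun t => by simp only [hf]; positivity
  have hint : ∫ x in Set.Ioi (0 : ℝ), f x = 1 := by
    simp only [hf]
    rw [integral_const_mul, integral_gaussian_Ioi, div_self Real.pi_pos.ne']
    simp
  have htop : Filter.Tendsto F Filter.atTop (nhds 1) := by
    rw [← hint]
    exact intervalIntegral_tendsto_integral_Ioi 0 hfi.integrableOn Filter.tendsto_id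
  have hodd : ∀ t, F (-t) = -F t := by
    intro t
    have h := intervalIntegral.integral_comp_neg (a := 0) (b := t) f
    have h' : (fun x => f (-x)) = f := by funext x; simp [hf]
    rw [h', neg_zero] at h
    simp only [hF]
    rw [h, intervalIntegral.integral_symm]
  have hsurj : ∀ s ∈ Set.Ioo (-1 : ℝ) 1, ∃ t, F t = s := by
    rintro s ⟨h1, h2⟩
    obtain ⟨b, hb⟩ := (htop.eventually (lt_mem_nhds h2)).exists
    obtain ⟨a, ha⟩ := (htop.eventually (lt_mem_nhds (show -s < 1 by linarith))).exists
    exact mem_range_of_exists_le_of_exists_ge hFc ⟨-a, by rw [hodd]; linarith⟩ ⟨b, hb.le⟩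
  choose! T hT using hsurj
  refine ⟨T, fun s hs => ?_⟩
  have hev : ∀ᶠ y in nhds s, F (T y) = y :=
    Filter.eventually_of_mem (Ioo_mem_nhds hs.1 hs.2) hT
  have hcont : ContinuousAt T s := by
    refine tendsto_order.2 ⟨fun a ha => ?_, fun a ha => ?_⟩
    · have : F a < s := by rw [← hT s hs]; exact hFm ha
      filter_upwards [hev, lt_mem_nhds this] with y hy hy'
      rw [← hy] at hy'
      exact hFm.lt_iff_lt.1 hy'
    · have : s < F a := by rw [← hT s hs]; exact hFm ha
      filter_upwards [hev, gt_mem_nhds this] with y hy hy'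
      rw [← hy] at hy'
      exact hFm.lt_iff_lt.1 hy'
  have h := (hFd (T s)).of_local_left_inverse hcont (by simp [hf]) hev
  have hval : (f (T s))⁻¹ = Real.exp (Real.pi * T s ^ 2) / 2 := by
    simp only [hf]
    rw [mul_inv, ← Real.exp_neg]
    ring_nf
  rwa [hval] at h

open Matrix in
lemma lintegral_exp_neg_pi_mul_dotProduct_self (n : ℕ) :
    ∫⁻ x : Fin n → ℝ, ENNReal.ofReal (Real.exp (-Real.pi * (x ⬝ᵥ x))) = 1 := by
  have hexp : ∀ x : Fin n → ℝ,
      Real.exp (-Real.pi * (x ⬝ᵥ x)) = ∏ i, Real.exp (-Real.pi * x i ^ 2) := by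
    intro x
    rw [← Real.exp_sum, dotProduct, Finset.mul_sum]
    exact congrArg _ (Finset.sum_congr rfl fun i _ => by ring)
  have hint : Integrable fun x : Fin n → ℝ => ∏ i, Real.exp (-Real.pi * x i ^ 2) :=
    Integrable.fintype_prod fun _ => integrable_exp_neg_mul_sq Real.pi_pos
  simp only [hexp]
  rw [← ofReal_integral_eq_lintegral_ofReal hint
    (Filter.Eventually.of_forall fun x => Finset.prod_nonneg fun i _ => (Real.exp_pos _).le),
    integral_fintype_prod_volume_eq_pow (fun x : ℝ => Real.exp (-Real.pi * x ^ 2)),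
    integral_gaussian, div_self Real.pi_pos.ne']
  simp

open Matrix in
lemma sum_dotProduct_self_eq {m n : ℕ} {V : Matrix (Fin m) (Fin n) ℝ} (hV : Vᵀ * V = 1) :
    ∑ k, V k ⬝ᵥ V k = n := by
  have h : (V * Vᵀ).trace = n := by rw [trace_mul_comm, hV]; simp
  rw [← h]
  rfl

open Matrix in
/-- A case of the geometric Brascamp–Lieb inequality, by transport to the Gaussian measure. -/
lemma volume_open_strips_le {m n : ℕ} (hn : 0 < n) (hm : 0 < m)
    (V : Matrix (Fin m) (Fin n) ℝ) (hV : Vᵀ * V = 1) :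
    volume {x : Fin n → ℝ | ∀ k, |(V *ᵥ x) k| < 1} ≤
      ENNReal.ofReal (2 ^ n * ((m : ℝ) / n) ^ ((n : ℝ) / 2)) := by
  have hn' : (0 : ℝ) < n := by exact_mod_cast hn
  have hm' : (0 : ℝ) < m := by exact_mod_cast hm
  obtain ⟨T, hT⟩ := exists_hasDerivAt_exp_pi_mul_sq_div_two
  set K : Set (Fin n → ℝ) := {x | ∀ k, |(V *ᵥ x) k| < 1} with hK
  have hcont : ∀ k, Continuous fun x : Fin n → ℝ => (V *ᵥ x) k := fun k => by
    simp only [mulVec]; fun_prop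
  have hKm : MeasurableSet K := by
    have : IsOpen K := by
      simp only [hK, Set.ofPred_forall]
      exact isOpen_iInter_of_finite fun k => isOpen_lt (hcont k).abs continuous_const
    exact this.measurableSet
  set τ : Fin m → ℝ := fun k => V k ⬝ᵥ V k with hτdef
  have hτ : ∀ k, 0 ≤ τ k := fun k => Finset.sum_nonneg fun i _ => mul_self_nonneg _
  have hτsum : ∑ k, τ k = n := sum_dotProduct_self_eq hV
  have hTmono : StrictMonoOn T (Set.Ioo (-1) 1) := by
    refine strictMonoOn_of_deriv_pos (convex_Ioo _ _)
      (fun s hs => (hT s hs).continuousAt.continuousWithinAt) fun s hs => ?_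
    rw [interior_Ioo] at hs
    rw [(hT s hs).deriv]
    positivity
  have hmem : ∀ x ∈ K, ∀ k, (V *ᵥ x) k ∈ Set.Ioo (-1 : ℝ) 1 := fun x hx k => abs_lt.1 (hx k)
  set c : (Fin n → ℝ) → Fin m → ℝ := fun x k => √(τ k) * T ((V *ᵥ x) k) with hc
  set Θ : (Fin n → ℝ) → Fin n → ℝ := fun x => Vᵀ *ᵥ c x with hΘ
  set t : (Fin n → ℝ) → Fin m → ℝ :=
    fun x k => √(τ k) * (Real.exp (Real.pi * T ((V *ᵥ x) k) ^ 2) / 2) with ht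
  set D : (Fin n → ℝ) → (Fin n → ℝ) →L[ℝ] (Fin n → ℝ) := fun x =>
    LinearMap.toContinuousLinearMap (toLin' (Vᵀ * diagonal (t x) * V)) with hD
  have hderiv : ∀ x ∈ K, HasFDerivWithinAt Θ (D x) K x := by
    intro x hx
    have h1 : HasFDerivAt c (ContinuousLinearMap.pi fun k =>
        t x k • ((ContinuousLinearMap.proj k).comp (LinearMap.toContinuousLinearMap (toLin' V)))) x := by
      refine hasFDerivAt_pi.2 fun k => ?_
      have h2 : HasFDerivAt (fun y : Fin n → ℝ => (V *ᵥ y) k)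
          ((ContinuousLinearMap.proj k : (Fin m → ℝ) →L[ℝ] ℝ).comp
            (LinearMap.toContinuousLinearMap (toLin' V))) x :=
        ((ContinuousLinearMap.proj k : (Fin m → ℝ) →L[ℝ] ℝ).comp
            (LinearMap.toContinuousLinearMap (toLin' V))).hasFDerivAt
      have h3 : HasDerivAt (fun s => √(τ k) * T s) (t x k) ((V *ᵥ x) k) :=
        (hT _ (hmem x hx k)).const_mul (√(τ k))
      exact h3.comp_hasFDerivAt (f := fun y : Fin n → ℝ => (V *ᵥ y) k) x h2
    have h3 := (LinearMap.toContinuousLinearMap (toLin' Vᵀ)).hasFDerivAt.comp x h1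
    refine HasFDerivAt.hasFDerivWithinAt (h3.congr_fderiv ?_)
    ext1 y
    simp only [hD, LinearMap.coe_toContinuousLinearMap', toLin'_apply, ← mulVec_mulVec,
      ContinuousLinearMap.comp_apply]
    congr 1
    ext k
    simp [mulVec_diagonal]
  have hinj : Set.InjOn Θ K := by
    intro x hx y hy hxy
    have h0 : ∑ k, √(τ k) *
        ((T ((V *ᵥ x) k) - T ((V *ᵥ y) k)) * ((V *ᵥ x) k - (V *ᵥ y) k)) = 0 := by
      have h1 : (Θ x - Θ y) ⬝ᵥ (x - y) = 0 := by rw [hxy]; simp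
      have h2 : Θ x - Θ y = Vᵀ *ᵥ (c x - c y) := (mulVec_sub _ _ _).symm
      rw [h2, mulVec_transpose, ← dotProduct_mulVec, mulVec_sub] at h1
      rw [← h1]
      refine Finset.sum_congr rfl fun k _ => ?_
      simp only [hc, Pi.sub_apply]; ring
    have hnn : ∀ a ∈ Set.Ioo (-1 : ℝ) 1, ∀ b ∈ Set.Ioo (-1 : ℝ) 1, a ≠ b →
        0 < (T a - T b) * (a - b) := by
      intro a ha b hb hab
      rcases lt_or_gt_of_ne hab with h | h
      · exact mul_pos_of_neg_of_neg (sub_neg.2 (hTmono ha hb h)) (sub_neg.2 h)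
      · exact mul_pos (sub_pos.2 (hTmono hb ha h)) (sub_pos.2 h)
    have hnn' : ∀ k, 0 ≤ √(τ k) *
        ((T ((V *ᵥ x) k) - T ((V *ᵥ y) k)) * ((V *ᵥ x) k - (V *ᵥ y) k)) := by
      intro k
      refine mul_nonneg (Real.sqrt_nonneg _) ?_
      by_cases h : (V *ᵥ x) k = (V *ᵥ y) k
      · simp [h]
      · exact (hnn _ (hmem x hx k) _ (hmem y hy k) h).le
    have hVxy : V *ᵥ x = V *ᵥ y := by
      ext k
      have hk := (Finset.sum_eq_zero_iff_of_nonneg fun k _ => hnn' k).1 h0 k (Finset.mem_univ k)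
      by_contra hne
      have hpos := hnn _ (hmem x hx k) _ (hmem y hy k) hne
      have hs : √(τ k) = 0 := (mul_eq_zero.1 hk).resolve_right hpos.ne'
      have hz : V k = 0 := dotProduct_self_eq_zero.1 (le_antisymm (Real.sqrt_eq_zero'.1 hs) (hτ k))
      exact hne (by simp [mulVec, hz])
    calc x = (Vᵀ * V) *ᵥ x := by rw [hV, one_mulVec]
      _ = (Vᵀ * V) *ᵥ y := by rw [← mulVec_mulVec, hVxy, mulVec_mulVec]
      _ = y := by rw [hV, one_mulVec]
  set C : ℝ := ∏ k, (√(τ k) / 2) ^ τ k with hC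
  have hbound : ∀ x ∈ K, ENNReal.ofReal C ≤
      ENNReal.ofReal |(D x).det| * ENNReal.ofReal (Real.exp (-Real.pi * (Θ x ⬝ᵥ Θ x))) := by
    intro x hx
    rw [← ENNReal.ofReal_mul (abs_nonneg _)]
    refine ENNReal.ofReal_le_ofReal ?_
    have hdet : (D x).det = (Vᵀ * diagonal (t x) * V).det := by
      simp only [hD, ContinuousLinearMap.det, LinearMap.coe_toContinuousLinearMap,
        LinearMap.det_toLin']
    have h1 := prod_rpow_le_det_of_transpose_mul_self_eq_one V hV (t x) fun k => by
      simp only [ht]; positivity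
    have h2 := dotProduct_transpose_mulVec_self_le V hV (c x)
    have h3 : C = (∏ k, t x k ^ (V k ⬝ᵥ V k)) * Real.exp (-Real.pi * (c x ⬝ᵥ c x)) := by
      rw [hC, dotProduct, Finset.mul_sum, Real.exp_sum, ← Finset.prod_mul_distrib]
      refine Finset.prod_congr rfl fun k _ => ?_
      have e1 : t x k = √(τ k) / 2 * Real.exp (Real.pi * T ((V *ᵥ x) k) ^ 2) := by
        simp only [ht]; ring
      have e2 : -Real.pi * (c x k * c x k) = -(Real.pi * T ((V *ᵥ x) k) ^ 2 * τ k) := by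
        simp only [hc]
        linear_combination (-Real.pi * T ((V *ᵥ x) k) ^ 2) * Real.mul_self_sqrt (hτ k)
      rw [e1, e2, Real.mul_rpow (by positivity) (Real.exp_pos _).le, ← Real.exp_mul,
        mul_assoc, ← Real.exp_add, add_neg_cancel, Real.exp_zero, mul_one]
    rw [h3, hdet]
    refine mul_le_mul (h1.trans (le_abs_self _)) (Real.exp_le_exp.2 ?_) (Real.exp_pos _).le
      (abs_nonneg _)
    exact mul_le_mul_of_nonpos_left h2 (neg_nonpos.2 Real.pi_pos.le)
  have hmain : ENNReal.ofReal C * volume K ≤ 1 := by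
    calc ENNReal.ofReal C * volume K = ∫⁻ _ in K, ENNReal.ofReal C := by simp
      _ ≤ ∫⁻ x in K, ENNReal.ofReal |(D x).det| *
            ENNReal.ofReal (Real.exp (-Real.pi * (Θ x ⬝ᵥ Θ x))) := setLIntegral_mono' hKm hbound
      _ = ∫⁻ z in Θ '' K, ENNReal.ofReal (Real.exp (-Real.pi * (z ⬝ᵥ z))) :=
          (lintegral_image_eq_lintegral_abs_det_fderiv_mul volume hKm hderiv hinj
            fun z => ENNReal.ofReal (Real.exp (-Real.pi * (z ⬝ᵥ z)))).symm
      _ ≤ ∫⁻ z, ENNReal.ofReal (Real.exp (-Real.pi * (z ⬝ᵥ z))) := setLIntegral_le_lintegral _ _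
      _ = 1 := lintegral_exp_neg_pi_mul_dotProduct_self n
  have hCle : (2 ^ n * ((m : ℝ) / n) ^ ((n : ℝ) / 2))⁻¹ ≤ C := by
    have h1 := rpow_le_prod_sqrt_rpow_self hn hm τ hτ hτsum
    have h2 : C = (∏ k, √(τ k) ^ τ k) / 2 ^ n := by
      rw [hC, ← Real.rpow_natCast 2 n, ← hτsum, Real.rpow_sum_of_pos (by norm_num),
        ← Finset.prod_div_distrib]
      exact Finset.prod_congr rfl fun k _ => Real.div_rpow (Real.sqrt_nonneg _) (by norm_num) _
    rw [h2, mul_inv, ← Real.inv_rpow (by positivity), inv_div, mul_comm, ← div_eq_mul_inv]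
    gcongr
  have hpos : 0 < 2 ^ n * ((m : ℝ) / n) ^ ((n : ℝ) / 2) := by positivity
  have h := (mul_le_mul_left (ENNReal.ofReal_le_ofReal hCle) (volume K)).trans hmain
  rw [ENNReal.ofReal_inv_of_pos hpos, mul_comm, ← div_eq_mul_inv] at h
  have h4 := (ENNReal.div_le_iff (by simpa using hpos) ENNReal.ofReal_ne_top).1 h
  simpa using h4

open Matrix in
lemma volume_strips_le {m n : ℕ} (hn : 0 < n) (hm : 0 < m)
    (V : Matrix (Fin m) (Fin n) ℝ) (hV : Vᵀ * V = 1) :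
    volume {x : Fin n → ℝ | ∀ k, |(V *ᵥ x) k| ≤ 1} ≤
      ENNReal.ofReal (2 ^ n * ((m : ℝ) / n) ^ ((n : ℝ) / 2)) := by
  set C := ENNReal.ofReal (2 ^ n * ((m : ℝ) / n) ^ ((n : ℝ) / 2))
  have hR : ∀ R : ℝ, 1 < R →
      volume {x : Fin n → ℝ | ∀ k, |(V *ᵥ x) k| ≤ 1} ≤ ENNReal.ofReal (R ^ n) * C := by
    intro R hR
    have hR0 : 0 < R := by linarith
    refine le_trans (measure_mono ?_) (le_trans (le_of_eq
      (Measure.addHaar_smul volume R {x : Fin n → ℝ | ∀ k, |(V *ᵥ x) k| < 1})) ?_)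
    · intro x hx
      refine ⟨R⁻¹ • x, fun k => ?_, by simp [smul_smul, hR0.ne']⟩
      rw [mulVec_smul, Pi.smul_apply, smul_eq_mul, abs_mul, abs_of_pos (inv_pos.2 hR0)]
      calc R⁻¹ * |(V *ᵥ x) k| ≤ R⁻¹ * 1 := by gcongr; exact hx k
        _ < 1 := by rw [mul_one]; exact inv_lt_one_of_one_lt₀ hR
    · rw [Module.finrank_fin_fun, abs_of_pos (by positivity)]
      gcongr
      exact volume_open_strips_le hn hm V hV
  have hlim : Filter.Tendsto (fun R : ℝ => ENNReal.ofReal (R ^ n) * C) (nhdsWithin 1 (Set.Ioi 1))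
      (nhds (1 * C)) := by
    refine ENNReal.Tendsto.mul_const ?_ (Or.inl one_ne_zero)
    have : Filter.Tendsto (fun R : ℝ => R ^ n) (nhdsWithin 1 (Set.Ioi 1)) (nhds 1) := by
      have := ((continuous_pow n).tendsto (1 : ℝ)).mono_left (nhdsWithin_le_nhds (s := Set.Ioi 1))
      simpa using this
    simpa using ENNReal.tendsto_ofReal this
  rw [one_mul] at hlim
  exact ge_of_tendsto hlim (Filter.eventually_of_mem self_mem_nhdsWithin fun R h => hR R h)

open Matrix in
lemma det_updateRow_transpose_mul_self {m n : ℕ} (V : Matrix (Fin m) (Fin n) ℝ)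
    (hV : Vᵀ * V = 1) (k : Fin m) (z : Fin n → ℝ) :
    ((V.updateRow k z)ᵀ * V.updateRow k z).det =
      (1 - V k ⬝ᵥ V k) * (1 + z ⬝ᵥ z) + (V k ⬝ᵥ z) ^ 2 := by
  have h1 : (V.updateRow k z)ᵀ * V.updateRow k z =
      1 + (Matrix.of ![-V k, z])ᵀ * Matrix.of ![V k, z] := by
    rw [← hV]
    ext i j
    simp only [Matrix.add_apply, mul_apply, transpose_apply, Fin.sum_univ_two]
    rw [← Finset.add_sum_erase _ _ (Finset.mem_univ k),
      ← Finset.add_sum_erase Finset.univ (fun l => V l i * V l j) (Finset.mem_univ k)]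
    have h2 : ∑ l ∈ Finset.univ.erase k, V.updateRow k z l i * V.updateRow k z l j =
        ∑ l ∈ Finset.univ.erase k, V l i * V l j :=
      Finset.sum_congr rfl fun l hl => by
        rw [updateRow_ne (Finset.ne_of_mem_erase hl)]
    rw [h2]
    simp
    ring
  rw [h1, det_one_add_mul_comm, det_fin_two]
  simp only [Matrix.add_apply, mul_apply, transpose_apply]
  simp [dotProduct, Finset.sum_neg_distrib, mul_comm]
  ring

open Matrix in
/-- If replacing any one row of `V` by `z` increases `det (Vᵀ V) = 1` at most to `1 + ε`,
then `z` is short. -/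
lemma dotProduct_self_mul_le_of_det_updateRow_le {m n : ℕ} (V : Matrix (Fin m) (Fin n) ℝ)
    (hV : Vᵀ * V = 1) (z : Fin n → ℝ) (ε : ℝ)
    (h : ∀ k, ((V.updateRow k z)ᵀ * V.updateRow k z).det ≤ 1 + ε) :
    (z ⬝ᵥ z) * (m - n + 1) ≤ n + m * ε := by
  have hsum : ∑ k, V k ⬝ᵥ V k = n := sum_dotProduct_self_eq hV
  have hsq : ∑ k, (V k ⬝ᵥ z) ^ 2 = z ⬝ᵥ z := by
    calc ∑ k, (V k ⬝ᵥ z) ^ 2 = (V *ᵥ z) ⬝ᵥ (V *ᵥ z) :=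
          Finset.sum_congr rfl fun k _ => by rw [sq]; rfl
      _ = z ⬝ᵥ z := by
          rw [dotProduct_mulVec, ← mulVec_transpose, mulVec_mulVec, hV, one_mulVec]
  have h1 : ∑ k : Fin m, ((1 - V k ⬝ᵥ V k) * (1 + z ⬝ᵥ z) + (V k ⬝ᵥ z) ^ 2) ≤
      ∑ k : Fin m, (1 + ε) :=
    Finset.sum_le_sum fun k _ => by
      rw [← det_updateRow_transpose_mul_self V hV k z]; exact h k
  rw [Finset.sum_add_distrib, ← Finset.sum_mul, Finset.sum_sub_distrib, hsum, hsq] at h1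
  simp at h1
  nlinarith

open Matrix in
lemma exists_transpose_mul_self_eq_one {m n : ℕ} (W : Matrix (Fin m) (Fin n) ℝ)
    (hW : 0 < (Wᵀ * W).det) :
    ∃ (B : Matrix (Fin n) (Fin n) ℝ) (V : Matrix (Fin m) (Fin n) ℝ),
      B.det ≠ 0 ∧ V * B = W ∧ Vᵀ * V = 1 ∧ (Wᵀ * W).det = B.det ^ 2 := by
  have hps : (Wᵀ * W).PosSemidef := by
    simpa using posSemidef_conjTranspose_mul_self W
  obtain ⟨B, hB⟩ : ∃ B : Matrix (Fin n) (Fin n) ℝ, Wᵀ * W = Bᵀ * B := by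
    open scoped MatrixOrder in
    obtain ⟨B, hB⟩ := CStarAlgebra.nonneg_iff_eq_star_mul_self.mp hps.nonneg
    exact ⟨B, by simpa [star_eq_conjTranspose] using hB⟩
  have hdet : (Wᵀ * W).det = B.det ^ 2 := by rw [hB, det_mul, det_transpose, sq]
  have hB0 : B.det ≠ 0 := by
    intro h
    rw [hdet, h] at hW
    norm_num at hW
  have hu : IsUnit B.det := hB0.isUnit
  refine ⟨B, W * B⁻¹, hB0, ?_, ?_, hdet⟩
  · rw [Matrix.mul_assoc, nonsing_inv_mul B hu, Matrix.mul_one]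
  · rw [transpose_mul, Matrix.mul_assoc, ← Matrix.mul_assoc Wᵀ, hB, Matrix.mul_assoc Bᵀ,
      mul_nonsing_inv B hu, Matrix.mul_one, ← transpose_mul, mul_nonsing_inv B hu, transpose_one]

open Matrix in
lemma volume_strips_eq_of_mul_eq {m n : ℕ} {W V : Matrix (Fin m) (Fin n) ℝ}
    {B : Matrix (Fin n) (Fin n) ℝ} (hB : B.det ≠ 0) (hVB : V * B = W) :
    volume {x : Fin n → ℝ | ∀ k, |W k ⬝ᵥ x| ≤ 1} =
      ENNReal.ofReal |B.det|⁻¹ * volume {x : Fin n → ℝ | ∀ k, |(V *ᵥ x) k| ≤ 1} := by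
  have h := Measure.addHaar_preimage_linearMap (volume : Measure (Fin n → ℝ)) (f := toLin' B)
    (by rwa [LinearMap.det_toLin']) {x : Fin n → ℝ | ∀ k, |(V *ᵥ x) k| ≤ 1}
  rw [LinearMap.det_toLin', abs_inv] at h
  rw [← h]
  congr 1
  ext x
  simp only [Set.preimage, Set.mem_ofPred_eq, toLin'_apply, mulVec_mulVec, hVB]
  rfl

open Matrix in
lemma exists_forall_dotProduct_eq_zero_or_exists_det_pos {m n : ℕ} (hn : 0 < n) (hnm : n ≤ m)
    {I : Type} (w : I → Fin n → ℝ) :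
    (∃ y : Fin n → ℝ, y ≠ 0 ∧ ∀ i, w i ⬝ᵥ y = 0) ∨
      ∃ idx : Fin m → I, 0 < ((Matrix.of (w ∘ idx))ᵀ * Matrix.of (w ∘ idx)).det := by
  by_cases hspan : Submodule.span ℝ (Set.range w) = ⊤
  · right
    obtain ⟨κ, a, -, ha, hli⟩ := exists_linearIndependent' ℝ w
    have : Finite κ := hli.finite
    have := Fintype.ofFinite κ
    have hcard : Fintype.card κ ≤ Fintype.card (Fin m) := by
      have := hli.fintype_card_le_finrank
      rw [Module.finrank_fin_fun] at this
      simpa using this.trans hnm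
    have hne : Nonempty κ := by
      by_contra hemp
      rw [not_nonempty_iff] at hemp
      rw [hspan, Set.range_eq_empty, Submodule.span_empty] at ha
      have := congrArg (fun S : Submodule ℝ (Fin n → ℝ) => Module.finrank ℝ S) ha
      simp at this
      omega
    obtain ⟨e⟩ := Function.Embedding.nonempty_of_card_le hcard
    have hsurj := Function.invFun_surjective e.injective
    refine ⟨a ∘ Function.invFun e, ?_⟩
    have hinj : Function.Injective (Matrix.of (w ∘ a ∘ Function.invFun e)).mulVec := by
      refine (injective_iff_map_eq_zero (mulVecLin (Matrix.of (w ∘ a ∘ Function.invFun e)))).2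
        fun x hx => ?_
      have hle : Submodule.span ℝ (Set.range (w ∘ a)) ≤
          LinearMap.ker (dotProductBilin ℝ ℝ x) := by
        rw [Submodule.span_le]
        rintro _ ⟨j, rfl⟩
        obtain ⟨k, rfl⟩ := hsurj j
        have := congrFun hx k
        simp only [SetLike.mem_coe, LinearMap.mem_ker]
        change x ⬝ᵥ _ = 0
        rw [dotProduct_comm]
        exact this
      rw [ha, hspan] at hle
      exact dotProduct_self_eq_zero.1 (hle (Submodule.mem_top : x ∈ ⊤))
    have := PosDef.conjTranspose_mul_self _ hinj
    simpa using this.det_pos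
  · left
    obtain ⟨f, hf0, hf⟩ := Submodule.exists_le_ker_of_lt_top _ (lt_top_iff_ne_top.2 hspan)
    have hfd : ∀ x, f x = x ⬝ᵥ (fun i => f (Pi.single i 1)) := by
      intro x
      conv_lhs => rw [pi_eq_sum_univ' x]
      simp [dotProduct, map_sum]
    refine ⟨fun i => f (Pi.single i 1), fun h => hf0 ?_, fun i => ?_⟩
    · refine LinearMap.ext fun x => ?_
      rw [hfd x, h, dotProduct_zero, LinearMap.zero_apply]
    · rw [← hfd]
      exact hf (Submodule.subset_span ⟨i, rfl⟩)

open Matrix in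
lemma volume_eq_zero_or_top_of_forall_dotProduct_eq_zero {n : ℕ} {I : Type} (w : I → Fin n → ℝ)
    {y : Fin n → ℝ} (hy : y ≠ 0) (hwy : ∀ i, w i ⬝ᵥ y = 0) :
    volume {x : Fin n → ℝ | ∀ i, |w i ⬝ᵥ x| ≤ 1} = 0 ∨
      volume {x : Fin n → ℝ | ∀ i, |w i ⬝ᵥ x| ≤ 1} = ⊤ := by
  have hyy : y ⬝ᵥ y ≠ 0 := fun h => hy (dotProduct_self_eq_zero.1 h)
  set B : Matrix (Fin n) (Fin n) ℝ :=
    1 + replicateCol Unit y * replicateRow Unit ((y ⬝ᵥ y)⁻¹ • y) with hB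
  have hdet : B.det = 2 := by
    rw [hB, det_one_add_replicateCol_mul_replicateRow, smul_dotProduct, smul_eq_mul,
      inv_mul_cancel₀ hyy]
    norm_num
  set P := {x : Fin n → ℝ | ∀ i, |w i ⬝ᵥ x| ≤ 1} with hP
  have hBw : ∀ i x, w i ⬝ᵥ (B *ᵥ x) = w i ⬝ᵥ x := by
    intro i x
    have hz : w i ᵥ* replicateCol Unit y = 0 := by
      ext u
      exact hwy i
    rw [dotProduct_mulVec, hB, vecMul_add, vecMul_one, ← vecMul_vecMul, hz, zero_vecMul, add_zero]
  have hpre : toLin' B ⁻¹' P = P := by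
    ext x
    simp only [hP, Set.preimage, Set.mem_ofPred_eq, toLin'_apply, hBw]
  have h := Measure.addHaar_preimage_linearMap (volume : Measure (Fin n → ℝ)) (f := toLin' B)
    (by rw [LinearMap.det_toLin', hdet]; norm_num) P
  rw [hpre, LinearMap.det_toLin', hdet] at h
  by_contra hcon
  push Not at hcon
  have h2 : (ENNReal.ofReal |(2 : ℝ)⁻¹|) * volume P < 1 * volume P := by
    refine (ENNReal.mul_lt_mul_iff_left hcon.1 hcon.2).2 ?_
    rw [← ENNReal.ofReal_one]
    exact (ENNReal.ofReal_lt_ofReal_iff one_pos).2 (by norm_num [abs_of_pos])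
  rw [← h, one_mul] at h2
  exact lt_irrefl _ h2

open Matrix in
lemma volume_dotProduct_self_lt {n : ℕ} (hn : 0 < n) {r : ℝ} (hr : 0 < r) :
    volume {x : Fin n → ℝ | x ⬝ᵥ x < r ^ 2} =
      ENNReal.ofReal (r ^ n * (√Real.pi ^ n / Real.Gamma ((n : ℝ) / 2 + 1))) := by
  have : Nonempty (Fin n) := ⟨⟨0, hn⟩⟩
  have h := EuclideanSpace.volume_ball (Fin n) 0 r
  rw [Fintype.card_fin, ← ENNReal.ofReal_pow hr.le, ← ENNReal.ofReal_mul (by positivity),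
    ← (PiLp.volume_preserving_toLp (Fin n)).measure_preimage
      measurableSet_ball.nullMeasurableSet] at h
  rw [← h]
  congr 1
  ext x
  simp only [Set.mem_ofPred_eq, Set.mem_preimage, mem_ball_zero_iff]
  rw [EuclideanSpace.norm_eq, Real.sqrt_lt' hr]
  simp [dotProduct, sq]

open Matrix in
/-- A family of strips of positive finite volume has an `m`-tuple of normal vectors nearly
maximizing the Gram-type determinant `det (∑ wₖ wₖᵀ)`. -/
lemma exists_nearly_maximal_det {m n : ℕ} (hn : 0 < n) (hnm : n ≤ m) {I : Type}
    (w : I → Fin n → ℝ) (hP : volume {x : Fin n → ℝ | ∀ i, |w i ⬝ᵥ x| ≤ 1} ≠ 0)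
    (hP' : volume {x : Fin n → ℝ | ∀ i, |w i ⬝ᵥ x| ≤ 1} ≠ ⊤) {ε : ℝ} (hε : 0 < ε) :
    ∃ idx : Fin m → I, 0 < ((Matrix.of (w ∘ idx))ᵀ * Matrix.of (w ∘ idx)).det ∧
      ∀ idx' : Fin m → I, ((Matrix.of (w ∘ idx'))ᵀ * Matrix.of (w ∘ idx')).det ≤
        (1 + ε) * ((Matrix.of (w ∘ idx))ᵀ * Matrix.of (w ∘ idx)).det := by
  have hm : 0 < m := hn.trans_le hnm
  have hn' : (0 : ℝ) < n := by exact_mod_cast hn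
  have hm' : (0 : ℝ) < m := by exact_mod_cast hm
  set g : (Fin m → I) → ℝ :=
    fun idx => ((Matrix.of (w ∘ idx))ᵀ * Matrix.of (w ∘ idx)).det with hg
  set P := {x : Fin n → ℝ | ∀ i, |w i ⬝ᵥ x| ≤ 1} with hPdef
  obtain ⟨idx₀, h₀⟩ : ∃ idx, 0 < g idx := by
    rcases exists_forall_dotProduct_eq_zero_or_exists_det_pos hn hnm w with ⟨y, hy, hwy⟩ | h
    · exact ((volume_eq_zero_or_top_of_forall_dotProduct_eq_zero w hy hwy).elim hP hP').elim
    · exact h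
  set C : ℝ := 2 ^ n * ((m : ℝ) / n) ^ ((n : ℝ) / 2) with hC
  have hCpos : 0 < C := by positivity
  set p := (volume P).toReal with hp
  have hppos : 0 < p := ENNReal.toReal_pos hP hP'
  have hbdd : ∀ idx, g idx ≤ (C / p) ^ 2 := by
    intro idx
    rcases le_or_gt (g idx) 0 with h | h
    · exact h.trans (sq_nonneg _)
    obtain ⟨B, V, hB, hVB, hV, hdet⟩ := exists_transpose_mul_self_eq_one _ h
    have h1 : volume P ≤ ENNReal.ofReal (|B.det|⁻¹ * C) := by
      calc volume P ≤ volume {x : Fin n → ℝ | ∀ k, |Matrix.of (w ∘ idx) k ⬝ᵥ x| ≤ 1} :=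
            measure_mono fun x hx k => hx (idx k)
        _ = _ := volume_strips_eq_of_mul_eq hB hVB
        _ ≤ ENNReal.ofReal |B.det|⁻¹ * ENNReal.ofReal C := by
            gcongr
            exact volume_strips_le hn hm V hV
        _ = _ := (ENNReal.ofReal_mul (by positivity)).symm
    have h2 : p ≤ |B.det|⁻¹ * C := ENNReal.toReal_le_of_le_ofReal (by positivity) h1
    have hBpos : 0 < |B.det| := abs_pos.2 hB
    have h3 : |B.det| ≤ C / p := by
      rw [le_div_iff₀ hppos]
      rw [inv_mul_eq_div, le_div_iff₀ hBpos] at h2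
      linarith
    rw [show g idx = B.det ^ 2 from hdet, ← sq_abs]
    gcongr
  have hB : BddAbove (Set.range g) := ⟨_, by rintro _ ⟨idx, rfl⟩; exact hbdd idx⟩
  have hspos : 0 < sSup (Set.range g) :=
    h₀.trans_le (le_csSup hB (Set.mem_range_self idx₀))
  obtain ⟨_, ⟨idx, rfl⟩, hidx⟩ := exists_lt_of_lt_csSup (Set.range_nonempty_iff_nonempty.2 ⟨idx₀⟩)
    (show sSup (Set.range g) / (1 + ε) < sSup (Set.range g) from
      div_lt_self hspos (by linarith))
  refine ⟨idx, (div_pos hspos (by linarith)).trans hidx, fun idx' => ?_⟩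
  rw [div_lt_iff₀ (by linarith)] at hidx
  calc g idx' ≤ sSup (Set.range g) := le_csSup hB ⟨idx', rfl⟩
    _ ≤ (1 + ε) * g idx := by linarith

open Matrix in
lemma exists_volume_strips_le {m n : ℕ} (hn : 0 < n) (hnm : n ≤ m) {I : Type}
    (w : I → Fin n → ℝ) (hP : volume {x : Fin n → ℝ | ∀ i, |w i ⬝ᵥ x| ≤ 1} ≠ 0)
    (hP' : volume {x : Fin n → ℝ | ∀ i, |w i ⬝ᵥ x| ≤ 1} ≠ ⊤) {β : ℝ}
    (hβ : (m : ℝ) / (m - n + 1) < β) :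
    ∃ idx : Fin m → I, volume {x : Fin n → ℝ | ∀ k, |w (idx k) ⬝ᵥ x| ≤ 1} ≤
      ENNReal.ofReal ((4 * β / Real.pi) ^ ((n : ℝ) / 2) * Real.Gamma ((n : ℝ) / 2 + 1)) *
        volume {x : Fin n → ℝ | ∀ i, |w i ⬝ᵥ x| ≤ 1} := by
  have hm : 0 < m := hn.trans_le hnm
  have hn' : (0 : ℝ) < n := by exact_mod_cast hn
  have hm' : (0 : ℝ) < m := by exact_mod_cast hm
  have hnm' : (n : ℝ) ≤ m := by exact_mod_cast hnm
  have hq : (0 : ℝ) < m - n + 1 := by linarith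
  have hβ0 : 0 < β := (by positivity : (0 : ℝ) < m / (m - n + 1)).trans hβ
  set ρ : ℝ := β * n / m with hρ
  have hρ0 : 0 < ρ := by positivity
  set ε : ℝ := (ρ * (m - n + 1) - n) / m with hεdef
  have hε : 0 < ε := by
    rw [div_lt_iff₀ hq] at hβ
    have : (n : ℝ) < ρ * (m - n + 1) := by
      rw [hρ, div_mul_eq_mul_div, lt_div_iff₀ hm']
      nlinarith
    exact div_pos (by linarith) hm'
  obtain ⟨idx, hpos, hmax⟩ := exists_nearly_maximal_det hn hnm w hP hP' hε
  obtain ⟨B, V, hB, hVB, hV, hdet⟩ := exists_transpose_mul_self_eq_one _ hpos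
  have hBpos : 0 < |B.det| := abs_pos.2 hB
  have hu : IsUnit B.det := hB.isUnit
  have hsmall : ∀ i, (w i ᵥ* B⁻¹) ⬝ᵥ (w i ᵥ* B⁻¹) ≤ ρ := by
    intro i
    have h1 := dotProduct_self_mul_le_of_det_updateRow_le V hV (w i ᵥ* B⁻¹) ε fun k => by
      have h2 := hmax (Function.update idx k i)
      have h3 : Matrix.of (w ∘ Function.update idx k i) = V.updateRow k (w i ᵥ* B⁻¹) * B := by
        rw [updateRow_mul, hVB, vecMul_vecMul, nonsing_inv_mul B hu, vecMul_one,
          Function.comp_update]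
        rfl
      rw [h3, hdet, transpose_mul, Matrix.mul_assoc, ← Matrix.mul_assoc _ _ B, det_mul, det_mul,
        det_transpose] at h2
      have hB2 : 0 < B.det ^ 2 := by positivity
      refine le_of_mul_le_mul_right ?_ hB2
      linarith
    have h4 : (n : ℝ) + m * ε = ρ * (m - n + 1) := by
      rw [hεdef]; field_simp; ring
    rw [h4] at h1
    exact le_of_mul_le_mul_right h1 hq
  set P := {x : Fin n → ℝ | ∀ i, |w i ⬝ᵥ x| ≤ 1} with hPdef
  set r : ℝ := (√ρ)⁻¹ with hr
  have hr0 : 0 < r := by positivity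
  have hr2 : r ^ 2 * ρ = 1 := by
    rw [hr, inv_pow, Real.sq_sqrt hρ0.le, inv_mul_cancel₀ hρ0.ne']
  set b : ℝ := r ^ n * (√Real.pi ^ n / Real.Gamma ((n : ℝ) / 2 + 1)) with hb
  have hΓ : 0 < Real.Gamma ((n : ℝ) / 2 + 1) := Real.Gamma_pos_of_pos (by positivity)
  have hlower : ENNReal.ofReal (|B.det|⁻¹ * b) ≤ volume P := by
    have h := Measure.addHaar_preimage_linearMap (volume : Measure (Fin n → ℝ)) (f := toLin' B)
      (by rwa [LinearMap.det_toLin']) {x : Fin n → ℝ | x ⬝ᵥ x < r ^ 2}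
    rw [LinearMap.det_toLin', abs_inv, volume_dotProduct_self_lt hn hr0,
      ← ENNReal.ofReal_mul (by positivity)] at h
    rw [← h]
    refine measure_mono fun x hx i => ?_
    simp only [Set.mem_preimage, Set.mem_ofPred_eq, toLin'_apply] at hx
    have h1 : w i ⬝ᵥ x = (w i ᵥ* B⁻¹) ⬝ᵥ (B *ᵥ x) := by
      rw [dotProduct_mulVec, vecMul_vecMul, nonsing_inv_mul B hu, vecMul_one]
    have h2 : ((w i ᵥ* B⁻¹) ⬝ᵥ (B *ᵥ x)) ^ 2 ≤
        ((w i ᵥ* B⁻¹) ⬝ᵥ (w i ᵥ* B⁻¹)) * ((B *ᵥ x) ⬝ᵥ (B *ᵥ x)) := by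
      simpa only [dotProduct, sq] using Finset.sum_mul_sq_le_sq_mul_sq Finset.univ
        (w i ᵥ* B⁻¹) (B *ᵥ x)
    rw [h1, ← sq_le_one_iff_abs_le_one]
    calc _ ≤ _ := h2
      _ ≤ ρ * r ^ 2 := mul_le_mul (hsmall i) hx.le
          (Finset.sum_nonneg fun _ _ => mul_self_nonneg _) hρ0.le
      _ = 1 := by rw [mul_comm, hr2]
  refine ⟨idx, ?_⟩
  have hupper : volume {x : Fin n → ℝ | ∀ k, |w (idx k) ⬝ᵥ x| ≤ 1} ≤
      ENNReal.ofReal (|B.det|⁻¹ * (2 ^ n * ((m : ℝ) / n) ^ ((n : ℝ) / 2))) := by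
    calc _ = _ := volume_strips_eq_of_mul_eq hB hVB
      _ ≤ ENNReal.ofReal |B.det|⁻¹ * ENNReal.ofReal (2 ^ n * ((m : ℝ) / n) ^ ((n : ℝ) / 2)) := by
          gcongr
          exact volume_strips_le hn hm V hV
      _ = _ := (ENNReal.ofReal_mul (by positivity)).symm
  have hconst : (4 * β / Real.pi) ^ ((n : ℝ) / 2) * Real.Gamma ((n : ℝ) / 2 + 1) * b =
      2 ^ n * ((m : ℝ) / n) ^ ((n : ℝ) / 2) := by
    have hpow : ∀ x : ℝ, 0 ≤ x → √x ^ n = x ^ ((n : ℝ) / 2) := fun x hx => by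
      rw [Real.sqrt_eq_rpow, ← Real.rpow_natCast, ← Real.rpow_mul hx]
      congr 1; ring
    have hrn : r ^ n = (ρ⁻¹) ^ ((n : ℝ) / 2) := by
      rw [hr, ← Real.sqrt_inv, hpow _ (by positivity)]
    have h2n : (2 : ℝ) ^ n = 4 ^ ((n : ℝ) / 2) := by
      rw [← hpow 4 (by norm_num)]
      congr 1
      rw [show (4 : ℝ) = 2 ^ 2 by norm_num, Real.sqrt_sq (by norm_num)]
    calc _ = (4 * β / Real.pi) ^ ((n : ℝ) / 2) * (ρ⁻¹) ^ ((n : ℝ) / 2) *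
          Real.pi ^ ((n : ℝ) / 2) := by
          rw [hb, hrn, hpow _ Real.pi_pos.le]; field_simp
      _ = (4 * (m / n)) ^ ((n : ℝ) / 2) := by
          rw [← Real.mul_rpow (by positivity) (by positivity),
            ← Real.mul_rpow (by positivity) (by positivity), hρ]
          congr 1
          field_simp
      _ = _ := by rw [Real.mul_rpow (by positivity) (by positivity), h2n]
  calc _ ≤ _ := hupper
    _ = ENNReal.ofReal ((4 * β / Real.pi) ^ ((n : ℝ) / 2) * Real.Gamma ((n : ℝ) / 2 + 1)) *
        ENNReal.ofReal (|B.det|⁻¹ * b) := by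
        rw [← ENNReal.ofReal_mul (by positivity), ← hconst]
        congr 1; ring
    _ ≤ _ := by gcongr

lemma div_sub_one_le_sqrt_add_one_div_sq {d : ℝ} (hd : 1 < d) :
    d / (d - 1) ≤ ((√d + 1) / (√d - 1)) ^ 2 := by
  obtain ⟨s, hs, hs1⟩ : ∃ s : ℝ, √d = s ∧ d = s ^ 2 :=
    ⟨√d, rfl, (Real.sq_sqrt (by linarith)).symm⟩
  have h1 : 1 < s := by rw [← hs]; exact Real.lt_sqrt_of_sq_lt (by linarith)
  rw [hs, hs1, div_pow, div_le_div_iff₀ (by nlinarith) (by nlinarith)]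
  have : 0 ≤ (s - 1) * ((s + 1) ^ 3 - s ^ 2 * (s - 1)) :=
    mul_nonneg (by linarith) (by nlinarith [sq_nonneg s])
  nlinarith

open Matrix in
lemma volume_iInter_abs_inner_le {n : ℕ} {ι : Type} (w : ι → EuclideanSpace ℝ (Fin n)) :
    volume (⋂ i, {x : EuclideanSpace ℝ (Fin n) | |⟪x, w i⟫| ≤ 1}) =
      volume {x : Fin n → ℝ | ∀ i, |(w i).ofLp ⬝ᵥ x| ≤ 1} := by
  have hclosed : IsClosed (⋂ i, {x : EuclideanSpace ℝ (Fin n) | |⟪x, w i⟫| ≤ 1}) :=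
    isClosed_iInter fun i => isClosed_le (by fun_prop) continuous_const
  rw [← (PiLp.volume_preserving_toLp (Fin n)).measure_preimage
      hclosed.measurableSet.nullMeasurableSet]
  congr 1
  ext x
  simp [PiLp.inner_apply, dotProduct, mul_comm]

/-- Quantitative Helly for symmetric strips: if `P = ⋂ᵢ {x : |⟪x, wᵢ⟫| ≤ 1}` has positive
volume, then for every `d > 1` there are `s ≤ dn` of the strips whose intersection has volume
at most `(4 γ_d / π)^{n/2} Γ(n/2 + 1) |P|`, where `γ_d = ((√d + 1)/(√d − 1))²`. -/
theorem quantitative_helly_symmetric_strips (n : ℕ) (I : Type)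
    (w : I → EuclideanSpace ℝ (Fin n))
    (hP : 0 < volume (⋂ i, {x : EuclideanSpace ℝ (Fin n) | |⟪x, w i⟫| ≤ 1}))
    (d : ℝ) (hd : 1 < d) :
    ∃ (s : ℕ) (idx : Fin s → I), (s : ℝ) ≤ d * n ∧
      volume (⋂ j, {x : EuclideanSpace ℝ (Fin n) | |⟪x, w (idx j)⟫| ≤ 1}) ≤
        ENNReal.ofReal
            ((4 * ((Real.sqrt d + 1) / (Real.sqrt d - 1)) ^ 2 / Real.pi) ^ ((n : ℝ) / 2) *
              Real.Gamma ((n : ℝ) / 2 + 1)) *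
          volume (⋂ i, {x : EuclideanSpace ℝ (Fin n) | |⟪x, w i⟫| ≤ 1}) := by
  have hγ := div_sub_one_le_sqrt_add_one_div_sq hd
  have hd0 : 0 < d - 1 := by linarith
  have hγ0 : 0 < ((√d + 1) / (√d - 1)) ^ 2 :=
    (div_pos (by linarith) hd0).trans_le hγ
  have hΓ : 0 < Real.Gamma ((n : ℝ) / 2 + 1) := Real.Gamma_pos_of_pos (by positivity)
  rcases Nat.eq_zero_or_pos n with rfl | hn
  · refine ⟨0, Fin.elim0, by simp, ?_⟩
    have hall : (⋂ i, {x : EuclideanSpace ℝ (Fin 0) | |⟪x, w i⟫| ≤ 1}) = Set.univ := by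
      ext x
      simp [PiLp.inner_apply]
    rw [hall]
    simp
  by_cases htop : volume (⋂ i, {x : EuclideanSpace ℝ (Fin n) | |⟪x, w i⟫| ≤ 1}) = ⊤
  · refine ⟨0, Fin.elim0, by simp; positivity, ?_⟩
    rw [htop, ENNReal.mul_top]
    · exact le_top
    · rw [Ne, ENNReal.ofReal_eq_zero, not_le]
      positivity
  have hn' : (0 : ℝ) < n := by exact_mod_cast hn
  have hm1 : ((⌊d * n⌋₊ : ℕ) : ℝ) ≤ d * n := Nat.floor_le (by positivity)
  have hm2 : d * n < (⌊d * n⌋₊ : ℕ) + 1 := Nat.lt_floor_add_one _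
  have hnm : n ≤ ⌊d * n⌋₊ := Nat.le_floor (by nlinarith)
  have hnm' : (n : ℝ) ≤ (⌊d * n⌋₊ : ℕ) := by exact_mod_cast hnm
  have hβ : ((⌊d * n⌋₊ : ℕ) : ℝ) / ((⌊d * n⌋₊ : ℕ) - n + 1) < ((√d + 1) / (√d - 1)) ^ 2 := by
    refine lt_of_lt_of_le ?_ hγ
    rw [div_lt_div_iff₀ (by linarith) hd0]
    nlinarith
  simp only [volume_iInter_abs_inner_le] at hP htop ⊢
  obtain ⟨idx, hidx⟩ := exists_volume_strips_le hn hnm (fun i => (w i).ofLp) hP.ne' htop hβ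
  exact ⟨_, idx, hm1, hidx⟩
end

section
/- Let {P_i : i ∈ I} be a family of closed half-spaces P_i = {x ∈ ℝⁿ : ⟨x,v_i⟩ ≤ 1} in ℝⁿ such that P = ⋂_{i∈I} P_i has positive volume. Then for every d > 1 there exist s ≤ (d+1)(n+1) and indices i_1, …, i_s ∈ I such that |P_{i_1} ∩ ⋯ ∩ P_{i_s}| ≤ γ_d^{(n+1)/2} · (n^{n/2} (n+1)^{3(n+1)/2} / (π^{n/2} n!)) · Γ(n/2 + 1) · |P|, where γ_d := ((√d + 1)/(√d − 1))². -/
open MeasureTheory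
open scoped RealInnerProductSpace

section

open Topology

/-- For an isotropic weight, the squared determinant of independent samples has moment
`N! * ∑ p g` against any function of one coordinate. -/
theorem sum_prod_mul_det_sq_mul {ι κ : Type*} [Fintype ι] [Fintype κ] [DecidableEq κ]
    (p : ι → ℝ) (V : ι → κ → ℝ)
    (hiso : ∀ a b, ∑ i, p i * (V i a * V i b) = if a = b then 1 else 0)
    (hnorm : ∀ i, ∑ a, V i a ^ 2 = Fintype.card κ) (j₀ : κ) (g : ι → ℝ) :
    ∑ σ : κ → ι, (∏ j, p (σ j)) * (Matrix.of fun j => V (σ j)).det ^ 2 * g (σ j₀) =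
      (Fintype.card κ).factorial * ∑ i, p i * g i := by
  classical
  let M : κ → κ → κ → ℝ := fun j a b =>
    ∑ i, p i * (if j = j₀ then g i else 1) * (V i a * V i b)
  have hM : ∀ j, j ≠ j₀ → ∀ a b, M j a b = if a = b then 1 else 0 := by
    intro j hj a b
    simp [M, hj, hiso]
  have hg : ∀ σ : κ → ι, g (σ j₀) = ∏ j, if j = j₀ then g (σ j) else 1 := by
    intro σ; simp
  have key : ∀ σ : κ → ι, (∏ j, p (σ j)) * (Matrix.of fun j => V (σ j)).det ^ 2 * g (σ j₀) =
      ∑ π : Equiv.Perm κ, ∑ ρ : Equiv.Perm κ,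
        ((Equiv.Perm.sign π : ℤ) : ℝ) * ((Equiv.Perm.sign ρ : ℤ) : ℝ) *
        ∏ j, (p (σ j) * (if j = j₀ then g (σ j) else 1) * (V (σ j) (π j) * V (σ j) (ρ j))) := by
    intro σ
    rw [← Matrix.det_transpose, sq, Matrix.det_apply', Finset.sum_mul_sum, hg, Finset.mul_sum,
      Finset.sum_mul]
    refine Finset.sum_congr rfl fun π _ => ?_
    rw [Finset.mul_sum, Finset.sum_mul]
    refine Finset.sum_congr rfl fun ρ _ => ?_
    simp only [Matrix.transpose_apply, Matrix.of_apply, Finset.prod_mul_distrib]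
    ring
  have hdiag : ∀ π ρ : Equiv.Perm κ, π ≠ ρ → ∏ j, M j (π j) (ρ j) = 0 := by
    intro π ρ h
    obtain ⟨j, hj, hj'⟩ : ∃ j, j ≠ j₀ ∧ π j ≠ ρ j := by
      by_contra! hcon
      apply h
      have h2 : ∀ j, j ≠ j₀ → (ρ⁻¹ * π) j = j := fun j hj => by
        simp [hcon j hj]
      have h3 : (ρ⁻¹ * π) j₀ = j₀ := by
        by_contra hne
        have := h2 _ hne
        exact hne ((ρ⁻¹ * π).injective this)
      have : ρ⁻¹ * π = 1 := by
        ext j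
        by_cases hj : j = j₀
        · subst hj; simpa using h3
        · simpa using h2 j hj
      exact (inv_mul_eq_one.1 this).symm
    exact Finset.prod_eq_zero (Finset.mem_univ j) (by rw [hM j hj, if_neg hj'])
  have hdiag' : ∀ π : Equiv.Perm κ, ∏ j, M j (π j) (π j) = ∑ i, p i * g i * V i (π j₀) ^ 2 := by
    intro π
    rw [Finset.prod_eq_single j₀]
    · simp [M, sq]
    · intro j _ hj; rw [hM j hj, if_pos rfl]
    · simp
  have hperm : ∀ a, ∑ π : Equiv.Perm κ, ∑ i, p i * g i * V i (π j₀) ^ 2 =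
      ∑ π : Equiv.Perm κ, ∑ i, p i * g i * V i (π a) ^ 2 := by
    intro a
    rw [← Equiv.sum_comp (Equiv.mulRight (Equiv.swap a j₀))]
    simp
  have hcard : (0 : ℝ) < Fintype.card κ := by
    have : Nonempty κ := ⟨j₀⟩
    exact_mod_cast Fintype.card_pos
  calc _ = ∑ π : Equiv.Perm κ, ∑ ρ : Equiv.Perm κ,
        ((Equiv.Perm.sign π : ℤ) : ℝ) * ((Equiv.Perm.sign ρ : ℤ) : ℝ) *
          ∏ j, M j (π j) (ρ j) := by
        simp_rw [key]
        rw [Finset.sum_comm]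
        refine Finset.sum_congr rfl fun π _ => ?_
        rw [Finset.sum_comm]
        refine Finset.sum_congr rfl fun ρ _ => ?_
        rw [← Finset.mul_sum, Finset.prod_univ_sum, Fintype.piFinset_univ]
    _ = ∑ π : Equiv.Perm κ, ∑ i, p i * g i * V i (π j₀) ^ 2 := by
        refine Finset.sum_congr rfl fun π _ => ?_
        rw [Finset.sum_eq_single π]
        · rw [hdiag', ← Int.cast_mul, Int.units_coe_mul_self]; simp
        · intro ρ _ h; rw [hdiag π ρ h.symm, mul_zero]
        · simp
    _ = (Fintype.card κ : ℝ)⁻¹ * ∑ a : κ, ∑ π : Equiv.Perm κ, ∑ i, p i * g i * V i (π a) ^ 2 := by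
        simp_rw [← hperm]
        simp only [Finset.sum_const, Finset.card_univ, nsmul_eq_mul]
        field_simp
    _ = (Fintype.card κ : ℝ)⁻¹ * ∑ π : Equiv.Perm κ, ∑ i, p i * g i * Fintype.card κ := by
        rw [Finset.sum_comm]
        congr 1
        refine Finset.sum_congr rfl fun π _ => ?_
        rw [Finset.sum_comm]
        refine Finset.sum_congr rfl fun i _ => ?_
        rw [← Finset.mul_sum, Equiv.sum_comp π (fun a => V i a ^ 2), hnorm]
    _ = _ := by
        simp only [Finset.sum_const, Finset.card_univ, nsmul_eq_mul, Fintype.card_perm,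
          ← Finset.sum_mul]
        field_simp

theorem sum_prod_mul_norm_sum_sq_le {Ω E : Type*} [Fintype Ω] [NormedAddCommGroup E]
    [InnerProductSpace ℝ E] (m : Ω → ℝ) (hm : ∀ o, 0 ≤ m o) (hm1 : ∑ o, m o = 1) (z : Ω → E)
    (hz : ∑ o, m o • z o = 0) {C : ℝ} (hC : ∀ o, ‖z o‖ ^ 2 ≤ C) (k : ℕ) :
    ∑ τ : Fin k → Ω, (∏ a, m (τ a)) * ‖∑ a, z (τ a)‖ ^ 2 ≤ k * C := by
  suffices h : ∀ (k : ℕ) (y : E), ∑ τ : Fin k → Ω, (∏ a, m (τ a)) * ‖y + ∑ a, z (τ a)‖ ^ 2 ≤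
      ‖y‖ ^ 2 + k * C by
    simpa using h k 0
  clear k
  intro k
  induction k with
  | zero => intro y; simp
  | succ k ih =>
    intro y
    rw [← (Fin.consEquiv fun _ => Ω).sum_comp, Fintype.sum_prod_type]
    simp only [Fin.consEquiv_apply, Fin.prod_univ_succ, Fin.sum_univ_succ, Fin.cons_zero,
      Fin.cons_succ, mul_assoc, ← Finset.mul_sum, ← add_assoc]
    calc _ ≤ ∑ o, m o * (‖y + z o‖ ^ 2 + k * C) :=
          Finset.sum_le_sum fun o _ => mul_le_mul_of_nonneg_left (ih _) (hm o)
      _ ≤ ∑ o, (m o * (‖y‖ ^ 2 + C + k * C) + 2 * ⟪y, m o • z o⟫) := by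
          refine Finset.sum_le_sum fun o _ => ?_
          rw [norm_add_sq_real, inner_smul_right]
          nlinarith [mul_le_mul_of_nonneg_left (hC o) (hm o)]
      _ = _ := by
          rw [Finset.sum_add_distrib, ← Finset.sum_mul, hm1, ← Finset.mul_sum, ← inner_sum, hz,
            inner_zero_right]
          push_cast
          ring

theorem exists_le_of_le_weighted_sum {Ω : Type*} [Fintype Ω] {ρ X : Ω → ℝ} (hρ : ∀ o, 0 ≤ ρ o)
    (hρ1 : ∑ o, ρ o = 1) {c : ℝ} (h : c ≤ ∑ o, ρ o * X o) : ∃ o, c ≤ X o := by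
  by_contra! hlt
  have h0 : ∑ o, ρ o * (c - X o) ≤ 0 := by
    simp only [mul_sub, Finset.sum_sub_distrib, ← Finset.sum_mul, hρ1]
    linarith
  have hnn : ∀ o ∈ Finset.univ, 0 ≤ ρ o * (c - X o) := fun o _ =>
    mul_nonneg (hρ o) (by linarith [hlt o])
  have hz := (Finset.sum_eq_zero_iff_of_nonneg hnn).1 (le_antisymm h0 (Finset.sum_nonneg hnn))
  have : ∑ o, ρ o = 0 := Finset.sum_eq_zero fun o ho =>
    (mul_eq_zero.1 (hz o ho)).resolve_right (by linarith [hlt o])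
  linarith

theorem exists_prod_ge_and_norm_sum_sq_le {Ω E : Type*} [Fintype Ω] [NormedAddCommGroup E]
    [InnerProductSpace ℝ E] {ρ D : Ω → ℝ} (hρ : ∀ o, 0 ≤ ρ o) (hρ1 : ∑ o, ρ o = 1)
    (hD : ∀ o, 0 ≤ D o) {M : ℝ} (hM : 0 < M) (hDM : ∑ o, ρ o * D o = M) (z : Ω → E)
    (hz : ∑ o, (ρ o * D o) • z o = 0) {C : ℝ} (hC0 : 0 < C) (hC : ∀ o, ‖z o‖ ^ 2 ≤ C)
    {k : ℕ} (hk : 0 < k) {r : ℝ} (hr : 1 < r) :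
    ∃ τ : Fin k → Ω, (1 - 1 / r) * M ^ k ≤ ∏ a, D (τ a) ∧ ‖∑ a, z (τ a)‖ ^ 2 ≤ r * k * C := by
  classical
  have hk' : (0 : ℝ) < k := by exact_mod_cast hk
  have hr0 : 0 < r := by linarith
  let m : Ω → ℝ := fun o => ρ o * D o / M
  have hm : ∀ o, 0 ≤ m o := fun o => div_nonneg (mul_nonneg (hρ o) (hD o)) hM.le
  have hm1 : ∑ o, m o = 1 := by
    simp only [m, ← Finset.sum_div, hDM]; exact div_self hM.ne'
  have hmz : ∑ o, m o • z o = 0 := by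
    have : ∀ o, m o • z o = M⁻¹ • ((ρ o * D o) • z o) := fun o => by
      rw [smul_smul]; congr 1; simp only [m]; field_simp
    simp_rw [this, ← Finset.smul_sum, hz, smul_zero]
  have hsq := sum_prod_mul_norm_sum_sq_le m hm hm1 z hmz hC k
  have hprod : ∀ w : Ω → ℝ, ∑ τ : Fin k → Ω, ∏ a, w (τ a) = (∑ o, w o) ^ k := fun w =>
    (Fintype.sum_pow w k).symm
  obtain ⟨τ, hτ⟩ := exists_le_of_le_weighted_sum (ρ := fun τ : Fin k → Ω => ∏ a, ρ (τ a))
    (X := fun τ => (∏ a, D (τ a)) / M ^ k * (1 - ‖∑ a, z (τ a)‖ ^ 2 / (r * k * C)))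
    (c := 1 - 1 / r) (fun τ => Finset.prod_nonneg fun a _ => hρ _) (by simp [hprod, hρ1]) (by
      have : ∀ τ : Fin k → Ω, (∏ a, ρ (τ a)) *
          ((∏ a, D (τ a)) / M ^ k * (1 - ‖∑ a, z (τ a)‖ ^ 2 / (r * k * C))) =
          (∏ a, m (τ a)) - (∏ a, m (τ a)) * ‖∑ a, z (τ a)‖ ^ 2 / (r * k * C) := by
        intro τ
        simp only [m, Finset.prod_div_distrib, Finset.prod_mul_distrib, Finset.prod_const,
          Finset.card_univ, Fintype.card_fin]
        ring
      simp_rw [this, Finset.sum_sub_distrib, ← Finset.sum_div, hprod, hm1, one_pow]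
      have : 1 / r = k * C / (r * k * C) := by field_simp
      rw [this]
      gcongr)
  have hX : 0 < 1 - 1 / r := by
    rw [sub_pos, div_lt_one hr0]; exact hr
  have hP : 0 ≤ (∏ a, D (τ a)) / M ^ k :=
    div_nonneg (Finset.prod_nonneg fun a _ => hD _) (by positivity)
  have hpos : 0 < 1 - ‖∑ a, z (τ a)‖ ^ 2 / (r * k * C) := by
    by_contra! hcon
    have := mul_nonpos_of_nonneg_of_nonpos hP hcon
    linarith
  have hq : 0 ≤ ‖∑ a, z (τ a)‖ ^ 2 / (r * k * C) := by positivity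
  refine ⟨τ, ?_, ?_⟩
  · rw [← le_div_iff₀ (by positivity)]
    exact hτ.trans (mul_le_of_le_one_right hP (by linarith))
  · rw [sub_pos, div_lt_one (by positivity)] at hpos
    exact hpos.le

/-- The square matrix with rows `(1, -u (σ j))`. -/
def liftMatrix {n : ℕ} {ι : Type*} (u : ι → EuclideanSpace ℝ (Fin n)) (σ : Fin (n + 1) → ι) :
    Matrix (Fin (n + 1)) (Fin (n + 1)) ℝ :=
  Matrix.of fun j => Fin.cons 1 fun b => -(u (σ j) b)

/-- A finite weight on unit vectors which is centered and isotropic (a John decomposition of the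
identity). -/
structure IsJohnDecomposition {n : ℕ} {ι : Type*} [Fintype ι] (p : ι → ℝ)
    (u : ι → EuclideanSpace ℝ (Fin n)) : Prop where
  nonneg : ∀ i, 0 ≤ p i
  sum_eq_one : ∑ i, p i = 1
  norm_eq_one : ∀ i, ‖u i‖ = 1
  centered : ∀ a, ∑ i, p i * u i a = 0
  isotropic : ∀ a b, ∑ i, p i * (u i a * u i b) = if a = b then 1 / (n : ℝ) else 0

namespace IsJohnDecomposition

variable {n : ℕ} {ι : Type*} [Fintype ι] {p : ι → ℝ} {u : ι → EuclideanSpace ℝ (Fin n)}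

theorem sum_prod_mul_det_sq_mul (h : IsJohnDecomposition p u) (hn : n ≠ 0) (j₀ : Fin (n + 1))
    (g : ι → ℝ) :
    ∑ σ : Fin (n + 1) → ι, (∏ j, p (σ j)) * (liftMatrix u σ).det ^ 2 * g (σ j₀) =
      ((n + 1).factorial / (n : ℝ) ^ n) * ∑ i, p i * g i := by
  have hn0 : (0 : ℝ) < n := by exact_mod_cast Nat.pos_of_ne_zero hn
  have hs : √(n : ℝ) * √(n : ℝ) = n := Real.mul_self_sqrt hn0.le
  let V : ι → Fin (n + 1) → ℝ := fun i => Fin.cons 1 fun b => -(√(n : ℝ) * u i b)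
  have hiso : ∀ a b, ∑ i, p i * (V i a * V i b) = if a = b then 1 else 0 := by
    intro a b
    refine Fin.cases ?_ (fun a => ?_) a <;> refine Fin.cases ?_ (fun b => ?_) b
    · simp [V, h.sum_eq_one]
    · have : ∀ i, p i * -(√(n : ℝ) * u i b) = -√(n : ℝ) * (p i * u i b) := fun i => by ring
      simp [V, this, ← Finset.mul_sum, h.centered, (Fin.succ_ne_zero b).symm,
        -neg_mul, -mul_neg]
    · have : ∀ i, p i * -(√(n : ℝ) * u i a) = -√(n : ℝ) * (p i * u i a) := fun i => by ring
      simp [V, this, ← Finset.mul_sum, h.centered, -neg_mul, -mul_neg]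
    · have : ∀ i, p i * (-(√(n : ℝ) * u i a) * -(√(n : ℝ) * u i b)) =
          n * (p i * (u i a * u i b)) := fun i => by
        linear_combination (p i * (u i a * u i b)) * hs
      simp only [V, Fin.cons_succ, this, ← Finset.mul_sum, h.isotropic, Fin.succ_inj]
      split_ifs
      · field_simp
      · simp
  have hnorm : ∀ i, ∑ a, V i a ^ 2 = Fintype.card (Fin (n + 1)) := by
    intro i
    have h1 : ∑ b, u i b ^ 2 = 1 := by
      have := EuclideanSpace.real_norm_sq_eq (u i)
      rw [h.norm_eq_one] at this
      linarith
    rw [Fin.sum_univ_succ]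
    simp only [V, Fin.cons_zero, Fin.cons_succ, neg_sq, mul_pow, ← Finset.mul_sum, h1,
      Real.sq_sqrt hn0.le, Fintype.card_fin]
    push_cast; ring
  have hdet : ∀ σ : Fin (n + 1) → ι, (Matrix.of fun j => V (σ j)).det ^ 2 =
      (n : ℝ) ^ n * (liftMatrix u σ).det ^ 2 := by
    intro σ
    have : (Matrix.of fun j => V (σ j)) =
        liftMatrix u σ * Matrix.diagonal (Fin.cons 1 fun _ => √(n : ℝ)) := by
      ext j a
      rw [Matrix.mul_diagonal]
      refine Fin.cases ?_ (fun a => ?_) a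
      · simp [V, liftMatrix]
      · simp [V, liftMatrix, mul_comm]
    rw [this, Matrix.det_mul, Matrix.det_diagonal, Fin.prod_univ_succ, mul_pow]
    simp only [Fin.cons_zero, Fin.cons_succ, Finset.prod_const, Finset.card_univ,
      Fintype.card_fin, one_mul]
    rw [← pow_mul, mul_comm n 2, pow_mul, Real.sq_sqrt hn0.le, mul_comm]
  have key := _root_.sum_prod_mul_det_sq_mul p V hiso hnorm j₀ g
  simp only [hdet, Fintype.card_fin] at key
  have hpn : (n : ℝ) ^ n ≠ 0 := by positivity
  rw [div_mul_eq_mul_div, ← key, eq_div_iff hpn, Finset.sum_mul]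
  exact Finset.sum_congr rfl fun σ _ => by ring

theorem sum_prod_mul_det_sq (h : IsJohnDecomposition p u) (hn : n ≠ 0) :
    ∑ σ : Fin (n + 1) → ι, (∏ j, p (σ j)) * (liftMatrix u σ).det ^ 2 =
      (n + 1).factorial / (n : ℝ) ^ n := by
  simpa [h.sum_eq_one] using h.sum_prod_mul_det_sq_mul hn 0 fun _ => 1

theorem sum_prod (h : IsJohnDecomposition p u) :
    ∑ σ : Fin (n + 1) → ι, ∏ j, p (σ j) = 1 := by
  classical
  rw [← Fintype.sum_pow, h.sum_eq_one, one_pow]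

theorem norm_sum_le (h : IsJohnDecomposition p u) (σ : Fin (n + 1) → ι) :
    ‖∑ j, u (σ j)‖ ≤ n + 1 := by
  refine (_root_.norm_sum_le _ _).trans ?_
  simp [h.norm_eq_one]

theorem exists_det_sq_ge (h : IsJohnDecomposition p u) (hn : n ≠ 0) :
    ∃ σ : Fin (n + 1) → ι, (n + 1).factorial / (n : ℝ) ^ n ≤ (liftMatrix u σ).det ^ 2 :=
  exists_le_of_le_weighted_sum (fun _ => Finset.prod_nonneg fun _ _ => h.nonneg _) h.sum_prod
    (h.sum_prod_mul_det_sq hn).ge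

theorem exists_prod_det_sq_ge (h : IsJohnDecomposition p u) (hn : n ≠ 0) {k : ℕ} (hk : 0 < k)
    {r : ℝ} (hr : 1 < r) :
    ∃ τ : Fin k → Fin (n + 1) → ι,
      (1 - 1 / r) * ((n + 1).factorial / (n : ℝ) ^ n) ^ k ≤ ∏ a, (liftMatrix u (τ a)).det ^ 2 ∧
      ‖∑ a, ∑ j, u (τ a j)‖ ^ 2 ≤ r * k * ((n : ℝ) + 1) ^ 2 := by
  have hn0 : (0 : ℝ) < n := by exact_mod_cast Nat.pos_of_ne_zero hn
  refine exists_prod_ge_and_norm_sum_sq_le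
    (ρ := fun σ : Fin (n + 1) → ι => ∏ j, p (σ j)) (D := fun σ => (liftMatrix u σ).det ^ 2)
    (z := fun σ => ∑ j, u (σ j)) (fun _ => Finset.prod_nonneg fun _ _ => h.nonneg _) h.sum_prod
    (fun _ => sq_nonneg _) (by positivity) (h.sum_prod_mul_det_sq hn) ?_ (by positivity)
    (fun σ => by gcongr; exact h.norm_sum_le σ) hk hr
  simp_rw [Finset.smul_sum]
  rw [Finset.sum_comm]
  refine Finset.sum_eq_zero fun j _ => ?_
  ext a
  have := h.sum_prod_mul_det_sq_mul hn j fun i => u i a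
  rw [h.centered, mul_zero] at this
  simpa using this

end IsJohnDecomposition

theorem eventually_one_lt_det_one_add_smul {κ : Type*} [Fintype κ] [DecidableEq κ]
    (X : Matrix κ κ ℝ) (hX : 0 < X.trace) : ∀ᶠ t in 𝓝[>] (0 : ℝ), 1 < (1 + t • X).det := by
  set q : Polynomial ℝ :=
    (1 + (Polynomial.X : Polynomial ℝ) • X.map Polynomial.C).det.divX.divX with hq
  have hc : Continuous fun t : ℝ => X.trace + q.eval t * t := by fun_prop
  have h0 : ∀ᶠ t in 𝓝[>] (0 : ℝ), 0 < X.trace + q.eval t * t :=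
    nhdsWithin_le_nhds (hc.continuousAt.eventually_const_lt (by simpa using hX))
  filter_upwards [h0, self_mem_nhdsWithin] with t ht htpos
  have htpos : 0 < t := htpos
  rw [Matrix.det_one_add_smul, ← hq]
  nlinarith [mul_pos ht htpos]

theorem eventually_norm_add_smul_le {E : Type*} [NormedAddCommGroup E] [InnerProductSpace ℝ E]
    {w v : E} {h b : ℝ} (hh : 0 < h) (hw : ‖w‖ ≤ h) (hcontact : ‖w‖ = h → ⟪w, v⟫ + h * b < 0) :
    ∀ᶠ t in 𝓝[>] (0 : ℝ), ‖w + t • v‖ ≤ h - t * b := by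
  have hnn : ∀ᶠ t in 𝓝[>] (0 : ℝ), 0 < h - t * b := by
    have hc : Continuous fun t : ℝ => h - t * b := by fun_prop
    exact nhdsWithin_le_nhds (hc.continuousAt.eventually_const_lt (by simpa using hh))
  rcases hw.lt_or_eq with hlt | heq
  · have hc : Continuous fun t : ℝ => h - t * b - ‖w + t • v‖ := by fun_prop
    have : ∀ᶠ t in 𝓝[>] (0 : ℝ), 0 < h - t * b - ‖w + t • v‖ :=
      nhdsWithin_le_nhds (hc.continuousAt.eventually_const_lt (by simpa using hlt))
    exact this.mono fun t ht => by linarith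
  · have hneg := hcontact heq
    have hc : Continuous fun t : ℝ => 2 * (⟪w, v⟫ + h * b) + t * (‖v‖ ^ 2 - b ^ 2) := by fun_prop
    have : ∀ᶠ t in 𝓝[>] (0 : ℝ), 2 * (⟪w, v⟫ + h * b) + t * (‖v‖ ^ 2 - b ^ 2) < 0 :=
      nhdsWithin_le_nhds (hc.continuousAt.eventually_lt_const
        (by simp only [zero_mul, add_zero]; linarith))
    filter_upwards [this, hnn, self_mem_nhdsWithin] with t ht htn htpos
    have htpos : 0 < t := htpos
    refine (sq_le_sq₀ (norm_nonneg _) htn.le).1 ?_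
    rw [norm_add_sq_real, heq, norm_smul, inner_smul_right, mul_pow, Real.norm_eq_abs, sq_abs]
    nlinarith [mul_neg_of_pos_of_neg htpos ht]

/-- **John's theorem** for polytopes: if the unit ball has maximal volume among all ellipsoids
contained in the polytope `⋂ i, {x | ⟪x, w i⟫ ≤ h i}`, then the contact points of the ball carry a
decomposition of the identity. -/
theorem exists_isJohnDecomposition {n : ℕ} (hn : n ≠ 0) {J : Type} [Finite J]
    (w : J → EuclideanSpace ℝ (Fin n)) (h : J → ℝ) (hpos : ∀ i, 0 < h i) (hw : ∀ i, ‖w i‖ ≤ h i)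
    (hmax : ∀ (B : EuclideanSpace ℝ (Fin n) →L[ℝ] EuclideanSpace ℝ (Fin n))
      (c : EuclideanSpace ℝ (Fin n)),
      (∀ y, ‖y‖ ≤ 1 → ∀ i, ⟪c + B y, w i⟫ ≤ h i) → |LinearMap.det B.toLinearMap| ≤ 1) :
    ∃ (ι : Type) (_ : Fintype ι) (p : ι → ℝ) (u : ι → EuclideanSpace ℝ (Fin n)) (f : ι → J),
      IsJohnDecomposition p u ∧ ∀ i, w (f i) = h (f i) • u i := by
  have hn0 : (n : ℝ) ≠ 0 := by exact_mod_cast hn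
  let W := EuclideanSpace ℝ ((Fin n × Fin n) ⊕ Fin n)
  let Φ : EuclideanSpace ℝ (Fin n) → W := fun u =>
    WithLp.toLp 2 (Sum.elim (fun q => u q.1 * u q.2) fun a => u a)
  let S : Set W := (fun i => Φ ((h i)⁻¹ • w i)) '' {i | ‖w i‖ = h i}
  let x₀ : W := WithLp.toLp 2 (Sum.elim (fun q => if q.1 = q.2 then 1 / (n : ℝ) else 0) fun _ => 0)
  have hunit : ∀ i, ‖w i‖ = h i → ‖(h i)⁻¹ • w i‖ = 1 := fun i hi => by
    rw [norm_smul, norm_inv, Real.norm_of_nonneg (hpos i).le, hi, inv_mul_cancel₀ (hpos i).ne']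
  have hmem : x₀ ∈ convexHull ℝ S := by
    by_contra hx₀
    obtain ⟨f, s, hS, hs⟩ := geometric_hahn_banach_closed_point (convex_convexHull ℝ S)
      ((S.toFinite).isClosed_convexHull ℝ) hx₀
    set y : W := (InnerProductSpace.toDual ℝ W).symm f with hy
    have hf : ∀ x : W, f x = ∑ a, ∑ b, y (Sum.inl (a, b)) * x (Sum.inl (a, b)) +
        ∑ a, y (Sum.inr a) * x (Sum.inr a) := fun x => by
      rw [← InnerProductSpace.toDual_symm_apply (𝕜 := ℝ), ← hy, PiLp.inner_apply,
        Fintype.sum_sum_type, Fintype.sum_prod_type]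
      simp [mul_comm]
    let X : Matrix (Fin n) (Fin n) ℝ := Matrix.of (fun a b => y (Sum.inl (a, b))) - s • 1
    let c : EuclideanSpace ℝ (Fin n) := WithLp.toLp 2 fun a => y (Sum.inr a)
    let T := Matrix.toEuclideanCLM (n := Fin n) (𝕜 := ℝ) X
    have htr : 0 < X.trace := by
      have hx : f x₀ = (∑ a, y (Sum.inl (a, a))) / n := by
        rw [hf]; simp [x₀, Finset.sum_mul, div_eq_mul_inv]
      have : X.trace = (∑ a, y (Sum.inl (a, a))) - s * n := by
        simp [X, Matrix.trace, Finset.sum_sub_distrib, mul_comm]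
      rw [this]
      rw [hx, lt_div_iff₀ (by positivity)] at hs
      linarith
    have hT : ∀ u : EuclideanSpace ℝ (Fin n), ‖u‖ = 1 → ⟪T u, u⟫ + ⟪c, u⟫ = f (Φ u) - s := by
      intro u hu
      have h1 : ∑ a, u a ^ 2 = 1 := by
        have := EuclideanSpace.real_norm_sq_eq u
        rw [hu] at this
        linarith
      rw [hf]
      have h2 : ⟪c, u⟫ = ∑ a, y (Sum.inr a) * u a := by
        simp [PiLp.inner_apply, c, mul_comm]
      have h3 : ⟪T u, u⟫ = ∑ a, ∑ b, y (Sum.inl (a, b)) * (u a * u b) - s := by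
        have h4 : ∀ a, T u a = ∑ b, y (Sum.inl (a, b)) * u b - s * u a := by
          intro a
          simp [T, X, Matrix.mulVec, dotProduct]
        rw [PiLp.inner_apply]
        simp only [h4, RCLike.inner_apply, conj_trivial, mul_sub, Finset.sum_sub_distrib]
        congr 1
        · refine Finset.sum_congr rfl fun a _ => ?_
          rw [Finset.mul_sum]
          exact Finset.sum_congr rfl fun b _ => by ring
        · trans s * ∑ a, u a ^ 2
          · rw [Finset.mul_sum]
            exact Finset.sum_congr rfl fun b _ => by ring
          · rw [h1, mul_one]
      rw [h2, h3]
      simp only [Φ, Sum.elim_inl, Sum.elim_inr]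
      ring
    have hev : ∀ i, ∀ᶠ t in 𝓝[>] (0 : ℝ),
        ‖w i + t • (ContinuousLinearMap.adjoint T) (w i)‖ ≤ h i - t * ⟪c, w i⟫ := by
      intro i
      refine eventually_norm_add_smul_le (hpos i) (hw i) fun hi => ?_
      have hlt : f (Φ ((h i)⁻¹ • w i)) < s := hS _ (subset_convexHull ℝ S ⟨i, hi, rfl⟩)
      have h5 := hT _ (hunit i hi)
      have hwu : w i = h i • ((h i)⁻¹ • w i) := by
        rw [smul_smul, mul_inv_cancel₀ (hpos i).ne', one_smul]
      rw [ContinuousLinearMap.adjoint_inner_right]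
      generalize (h i)⁻¹ • w i = u at hlt h5 hwu
      rw [hwu, map_smul, inner_smul_left, inner_smul_right, inner_smul_right]
      simp only [conj_trivial]
      have h6 : 0 < h i * h i := mul_pos (hpos i) (hpos i)
      nlinarith
    obtain ⟨t, ht, hdet⟩ :=
      ((Filter.eventually_all.2 hev).and (eventually_one_lt_det_one_add_smul X htr)).exists
    have hB := hmax (Matrix.toEuclideanCLM (n := Fin n) (𝕜 := ℝ) (1 + t • X)) (t • c) (by
      intro z hz i
      have : t • c + Matrix.toEuclideanCLM (n := Fin n) (𝕜 := ℝ) (1 + t • X) z =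
          t • c + (z + t • T z) := by
        simp [T]
      rw [this, inner_add_left, inner_add_left, inner_smul_left, inner_smul_left,
        ← ContinuousLinearMap.adjoint_inner_right]
      simp only [conj_trivial]
      have h7 := real_inner_le_norm z (w i + t • (ContinuousLinearMap.adjoint T) (w i))
      rw [inner_add_right, inner_smul_right] at h7
      have h8 := mul_le_of_le_one_left
        (norm_nonneg (w i + t • (ContinuousLinearMap.adjoint T) (w i))) hz
      linarith [ht i])
    have hdet' : LinearMap.det ((Matrix.toEuclideanCLM (n := Fin n) (𝕜 := ℝ) (1 + t • X) :
        _ →L[ℝ] _) : EuclideanSpace ℝ (Fin n) →ₗ[ℝ] EuclideanSpace ℝ (Fin n)) =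
        (1 + t • X).det := by
      rw [Matrix.coe_toEuclideanCLM_eq_toEuclideanLin]
      change LinearMap.det (Matrix.toLpLin 2 2 (1 + t • X)) = _
      rw [Matrix.toLpLin_eq_toLin, LinearMap.det_toLin]
    rw [hdet'] at hB
    exact absurd ((le_abs_self _).trans hB) (not_le.2 hdet)
  obtain ⟨ι, hι, p, z, hp0, hp1, hz, hsum⟩ := mem_convexHull_iff_exists_fintype.1 hmem
  choose g hg hgz using hz
  refine ⟨ι, hι, p, fun i => (h (g i))⁻¹ • w (g i), g, ⟨hp0, hp1, fun i => hunit _ (hg i), ?_, ?_⟩,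
    fun i => by rw [smul_smul, mul_inv_cancel₀ (hpos _).ne', one_smul]⟩
  · intro a
    have := congrArg (EuclideanSpace.proj (𝕜 := ℝ) (Sum.inr a)) hsum
    simpa [← hgz, Φ, x₀] using this
  · intro a b
    have := congrArg (EuclideanSpace.proj (𝕜 := ℝ) (Sum.inl (a, b))) hsum
    simpa [← hgz, Φ, x₀] using this

theorem lintegral_fin_succ {n : ℕ} (f : (Fin (n + 1) → ℝ) → ENNReal) :
    ∫⁻ y, f y = ∫⁻ q : ℝ × (Fin n → ℝ), f (Fin.cons q.1 q.2) ∂(volume.prod volume) := by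
  rw [← ((volume_preserving_piFinSuccAbove (fun _ : Fin (n + 1) => ℝ) 0).symm).lintegral_comp_emb
    (MeasurableEquiv.measurableEmbedding _), Measure.volume_eq_prod]
  refine lintegral_congr fun q => congrArg f ?_
  ext j
  refine Fin.cases rfl (fun j => rfl) j

theorem lintegral_fin_prod_eq_pow (N : ℕ) {φ : ℝ → ENNReal} (hφ : Measurable φ) :
    ∫⁻ y : Fin N → ℝ, ∏ j, φ (y j) = (∫⁻ s, φ s) ^ N := by
  induction N with
  | zero => simp [lintegral_unique, volume_pi]
  | succ N ih =>
    rw [lintegral_fin_succ]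
    simp only [Fin.prod_univ_succ, Fin.cons_zero, Fin.cons_succ]
    rw [lintegral_prod_mul (g := fun x : Fin N → ℝ => ∏ j, φ (x j)) hφ.aemeasurable, ih, pow_succ']
    exact (Finset.measurable_prod _ fun j _ => hφ.comp (measurable_pi_apply j)).aemeasurable

/-- The exponential density `s ↦ exp (-κ s)` on the nonnegative half-line. -/
noncomputable def halfExp (κ : ℝ) : ℝ → ENNReal :=
  (Set.Ici 0).indicator fun s => ENNReal.ofReal (Real.exp (-(κ * s)))

theorem measurable_halfExp (κ : ℝ) : Measurable (halfExp κ) :=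
  Measurable.indicator (by fun_prop) measurableSet_Ici

theorem lintegral_halfExp {κ : ℝ} (hκ : 0 < κ) : ∫⁻ s, halfExp κ s = ENNReal.ofReal (1 / κ) := by
  rw [halfExp, lintegral_indicator measurableSet_Ici, setLIntegral_congr Ioi_ae_eq_Ici.symm,
    ← ofReal_integral_eq_lintegral_ofReal]
  · have := integral_exp_mul_Ioi (neg_lt_zero.2 hκ) 0
    simp only [neg_mul, mul_zero, Real.exp_zero] at this
    rw [this, neg_div_neg_eq]
  · have := integrableOn_exp_mul_Ioi (neg_lt_zero.2 hκ) 0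
    simpa only [IntegrableOn, neg_mul] using this
  · exact ae_of_all _ fun _ => (Real.exp_pos _).le

theorem lintegral_prod_halfExp_mulVec {N : ℕ} {A : Matrix (Fin N) (Fin N) ℝ} (hA : A.det ≠ 0)
    {κ : ℝ} (hκ : 0 < κ) :
    ∫⁻ y : Fin N → ℝ, ∏ j, halfExp κ (A.mulVec y j) =
      ENNReal.ofReal (1 / (|A.det| * κ ^ N)) := by
  have hmeas : Measurable fun y : Fin N → ℝ => ∏ j, halfExp κ (y j) :=
    Finset.measurable_prod _ fun j _ => (measurable_halfExp κ).comp (measurable_pi_apply j)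
  have hlin : Measurable (Matrix.toLin' A) :=
    (LinearMap.continuous_of_finiteDimensional _).measurable
  have := lintegral_map (μ := volume) hmeas hlin
  simp only [Matrix.toLin'_apply] at this
  rw [← this, Real.map_matrix_volume_pi_eq_smul_volume_pi hA, lintegral_smul_measure,
    lintegral_fin_prod_eq_pow _ (measurable_halfExp κ), lintegral_halfExp hκ,
    ← ENNReal.ofReal_pow (by positivity), smul_eq_mul, ← ENNReal.ofReal_mul (abs_nonneg _)]
  congr 1
  rw [abs_inv, one_div_pow, one_div, one_div, mul_inv]

theorem lintegral_exp_neg_cone {n : ℕ} {S : Set (Fin n → ℝ)} (hS : MeasurableSet S) :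
    ∫⁻ y : Fin (n + 1) → ℝ, {y : Fin (n + 1) → ℝ | 0 < y 0 ∧ (y 0)⁻¹ • Fin.tail y ∈ S}.indicator
      (fun y => ENNReal.ofReal (Real.exp (-y 0))) y = n.factorial * volume S := by
  rw [lintegral_fin_succ]
  have hmeasC : MeasurableSet {q : ℝ × (Fin n → ℝ) | 0 < q.1 ∧ q.1⁻¹ • q.2 ∈ S} :=
    (measurableSet_lt measurable_const measurable_fst).inter
      ((measurable_fst.inv.smul measurable_snd) hS)
  have hF : ∀ q : ℝ × (Fin n → ℝ),
      {y : Fin (n + 1) → ℝ | 0 < y 0 ∧ (y 0)⁻¹ • Fin.tail y ∈ S}.indicator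
      (fun y => ENNReal.ofReal (Real.exp (-y 0)))
        (Fin.cons q.1 q.2) =
      {q : ℝ × (Fin n → ℝ) | 0 < q.1 ∧ q.1⁻¹ • q.2 ∈ S}.indicator
        (fun q => ENNReal.ofReal (Real.exp (-q.1))) q := by
    intro q
    rfl
  simp_rw [hF]
  rw [lintegral_prod _ ((Measurable.indicator (by fun_prop) hmeasC).aemeasurable)]
  have hin : ∀ r : ℝ, ∫⁻ x : Fin n → ℝ, {q : ℝ × (Fin n → ℝ) | 0 < q.1 ∧ q.1⁻¹ • q.2 ∈ S}.indicator
        (fun q => ENNReal.ofReal (Real.exp (-q.1))) (r, x) =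
      (Set.Ioi (0 : ℝ)).indicator (fun r => ENNReal.ofReal (Real.exp (-r) * r ^ n)) r *
        volume S := by
    intro r
    by_cases hr : 0 < r
    · have h1 : ∀ x : Fin n → ℝ, {q : ℝ × (Fin n → ℝ) | 0 < q.1 ∧ q.1⁻¹ • q.2 ∈ S}.indicator
          (fun q => ENNReal.ofReal (Real.exp (-q.1))) (r, x) =
          ((fun x : Fin n → ℝ => r⁻¹ • x) ⁻¹' S).indicator
            (fun _ => ENNReal.ofReal (Real.exp (-r))) x := by
        intro x
        by_cases hx : r⁻¹ • x ∈ S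
        · have h : (r, x) ∈ {q : ℝ × (Fin n → ℝ) | 0 < q.1 ∧ q.1⁻¹ • q.2 ∈ S} := ⟨hr, hx⟩
          have h' : x ∈ (fun x : Fin n → ℝ => r⁻¹ • x) ⁻¹' S := hx
          rw [Set.indicator_of_mem h, Set.indicator_of_mem h']
        · have h : (r, x) ∉ {q : ℝ × (Fin n → ℝ) | 0 < q.1 ∧ q.1⁻¹ • q.2 ∈ S} := fun h => hx h.2
          have h' : x ∉ (fun x : Fin n → ℝ => r⁻¹ • x) ⁻¹' S := hx
          rw [Set.indicator_of_notMem h, Set.indicator_of_notMem h']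
      have hm : MeasurableSet ((fun x : Fin n → ℝ => r⁻¹ • x) ⁻¹' S) :=
        (measurable_const_smul r⁻¹) hS
      simp_rw [h1]
      rw [lintegral_indicator_const hm, Measure.addHaar_preimage_smul volume (inv_ne_zero hr.ne'),
        Set.indicator_of_mem (Set.mem_Ioi.2 hr), ENNReal.ofReal_mul (Real.exp_pos _).le, mul_assoc]
      congr 3
      rw [Module.finrank_fin_fun, inv_pow, inv_inv, abs_of_pos (by positivity)]
    · simp only [Set.indicator, Set.mem_ofPred_eq, hr, false_and, Set.mem_Ioi, if_false,
        lintegral_zero, zero_mul]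
  simp_rw [hin]
  rw [lintegral_mul_const _ (Measurable.indicator (by fun_prop) measurableSet_Ioi),
    lintegral_indicator measurableSet_Ioi]
  congr 1
  have hΓ := Real.Gamma_eq_integral (s := n + 1) (by positivity)
  have hconv := Real.GammaIntegral_convergent (s := n + 1) (by positivity)
  simp only [add_sub_cancel_right, Real.rpow_natCast, Real.Gamma_nat_eq_factorial] at hΓ hconv
  rw [← ofReal_integral_eq_lintegral_ofReal hconv, ← hΓ, ENNReal.ofReal_natCast]
  filter_upwards [ae_restrict_mem measurableSet_Ioi] with r hr
  have : (0 : ℝ) < r := hr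
  positivity

theorem factorial_mul_volume_iInter_halfSpace_le {n k N : ℕ} (hN : N = n + 1) {ι : Type*}
    (u : ι → EuclideanSpace ℝ (Fin n)) (τ : Fin k → Fin (n + 1) → ι) (hk : 0 < k)
    (hdet : ∀ a, (liftMatrix u (τ a)).det ≠ 0) {θ : ℝ} (hθ : 0 < θ)
    (hθ1 : θ * (k * N) ≤ 1) {w : EuclideanSpace ℝ (Fin n)}
    (hw : θ • ∑ a, ∑ j, u (τ a j) + (1 - θ * (k * N)) • w = 0) :
    n.factorial * volume {x : EuclideanSpace ℝ (Fin n) |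
        (∀ a j, ⟪x, u (τ a j)⟫ ≤ 1) ∧ ⟪x, w⟫ ≤ 1} ≤
      ENNReal.ofReal (∏ a, (1 / (|(liftMatrix u (τ a)).det| * (k * θ) ^ N)) ^ (1 / (k : ℝ))) := by
  subst hN
  have hk' : (0 : ℝ) < k := by exact_mod_cast hk
  set Q := {x : EuclideanSpace ℝ (Fin n) | (∀ a j, ⟪x, u (τ a j)⟫ ≤ 1) ∧ ⟪x, w⟫ ≤ 1} with hQ
  have hQm : MeasurableSet Q := by
    have : IsClosed Q := by
      rw [hQ, Set.ofPred_and, Set.ofPred_forall]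
      refine IsClosed.inter (isClosed_iInter fun a => ?_) (isClosed_le (by fun_prop) (by fun_prop))
      rw [Set.ofPred_forall]
      exact isClosed_iInter fun j => isClosed_le (by fun_prop) (by fun_prop)
    exact this.measurableSet
  set S : Set (Fin n → ℝ) := WithLp.toLp 2 ⁻¹' Q with hS
  have hSm : MeasurableSet S := (PiLp.volume_preserving_toLp (Fin n)).measurable hQm
  have hvol : volume S = volume Q :=
    (PiLp.volume_preserving_toLp (Fin n)).measure_preimage hQm.nullMeasurableSet
  rw [← hvol, ← lintegral_exp_neg_cone hSm]
  have hmeas : ∀ a, Measurable fun y : Fin (n + 1) → ℝ =>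
      ∏ j, halfExp (k * θ) ((liftMatrix u (τ a)).mulVec y j) := fun a =>
    Finset.measurable_prod _ fun j _ => (measurable_halfExp _).comp
      ((measurable_pi_apply j).comp
        (LinearMap.continuous_of_finiteDimensional
          (Matrix.toLin' (liftMatrix u (τ a)))).measurable)
  calc _ ≤ ∫⁻ y : Fin (n + 1) → ℝ,
        ∏ a, (∏ j, halfExp (k * θ) ((liftMatrix u (τ a)).mulVec y j)) ^ (1 / (k : ℝ)) := by
        refine lintegral_mono fun y => ?_
        by_cases hy : y ∈ {y : Fin (n + 1) → ℝ | 0 < y 0 ∧ (y 0)⁻¹ • Fin.tail y ∈ S}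
        swap
        · rw [Set.indicator_of_notMem hy]
          exact zero_le
        rw [Set.indicator_of_mem hy]
        obtain ⟨hr, hyS⟩ := hy
        set r := y 0 with hrdef
        set x : EuclideanSpace ℝ (Fin n) := WithLp.toLp 2 (Fin.tail y) with hx
        have hyQ : r⁻¹ • x ∈ Q := hyS
        have hs : ∀ a j, (liftMatrix u (τ a)).mulVec y j = r - ⟪x, u (τ a j)⟫ := by
          intro a j
          simp only [liftMatrix, Matrix.mulVec, dotProduct, Matrix.of_apply, Fin.sum_univ_succ,
            Fin.cons_zero, Fin.cons_succ, PiLp.inner_apply, hx, Fin.tail]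
          simp [sub_eq_add_neg, hrdef]
        have hle : ∀ v : EuclideanSpace ℝ (Fin n), ⟪r⁻¹ • x, v⟫ ≤ 1 → 0 ≤ r - ⟪x, v⟫ := by
          intro v hv
          rw [real_inner_smul_left, inv_mul_le_iff₀ hr, mul_one] at hv
          linarith
        have hs0 : ∀ a j, 0 ≤ r - ⟪x, u (τ a j)⟫ := fun a j => hle _ (hyQ.1 a j)
        have hw0 : 0 ≤ r - ⟪x, w⟫ := hle _ hyQ.2
        have hval : ∀ a, (∏ j, halfExp (k * θ) ((liftMatrix u (τ a)).mulVec y j)) ^ (1 / (k : ℝ)) =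
            ENNReal.ofReal (Real.exp (-(θ * ∑ j, (r - ⟪x, u (τ a j)⟫)))) := by
          intro a
          have : ∀ j, halfExp (k * θ) ((liftMatrix u (τ a)).mulVec y j) =
              ENNReal.ofReal (Real.exp (-(k * θ * (r - ⟪x, u (τ a j)⟫)))) := fun j => by
            rw [hs, halfExp, Set.indicator_of_mem (Set.mem_Ici.2 (hs0 a j))]
          simp_rw [this]
          rw [← ENNReal.ofReal_prod_of_nonneg (fun _ _ => (Real.exp_pos _).le), ← Real.exp_sum,
            ENNReal.ofReal_rpow_of_pos (Real.exp_pos _), ← Real.exp_mul]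
          congr 2
          rw [Finset.sum_neg_distrib, ← Finset.mul_sum]
          field_simp
        simp_rw [hval]
        rw [← ENNReal.ofReal_prod_of_nonneg (fun _ _ => (Real.exp_pos _).le), ← Real.exp_sum]
        refine ENNReal.ofReal_le_ofReal (Real.exp_le_exp.2 ?_)
        rw [Finset.sum_neg_distrib, ← Finset.mul_sum, neg_le_neg_iff]
        have hin : θ * ∑ a, ∑ j, ⟪x, u (τ a j)⟫ + (1 - θ * (k * (n + 1 : ℕ))) * ⟪x, w⟫ = 0 := by
          have := congrArg (fun v => ⟪x, v⟫) hw
          simpa [inner_add_right, inner_smul_right, inner_sum] using this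
        simp only [Finset.sum_sub_distrib, Finset.sum_const, Finset.card_univ, Fintype.card_fin,
          nsmul_eq_mul]
        have := mul_nonneg (sub_nonneg.2 hθ1) hw0
        nlinarith
    _ ≤ ∏ a, (∫⁻ y : Fin (n + 1) → ℝ,
          ∏ j, halfExp (k * θ) ((liftMatrix u (τ a)).mulVec y j)) ^ (1 / (k : ℝ)) :=
        ENNReal.lintegral_prod_norm_pow_le _ (fun a _ => (hmeas a).aemeasurable)
          (by simp [hk'.ne']) (fun _ _ => by positivity)
    _ = _ := by
        rw [ENNReal.ofReal_prod_of_nonneg (fun _ _ => by positivity)]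
        refine Finset.prod_congr rfl fun a _ => ?_
        have := abs_pos.2 (hdet a)
        rw [lintegral_prod_halfExp_mulVec (hdet a) (by positivity),
          ENNReal.ofReal_rpow_of_pos (by positivity)]

theorem Convex.isBounded_of_measure_ne_top {E : Type*} [NormedAddCommGroup E] [NormedSpace ℝ E]
    [MeasurableSpace E] [BorelSpace E] [FiniteDimensional ℝ E] (μ : Measure E)
    [μ.IsAddHaarMeasure] {s : Set E} (hs : Convex ℝ s) (hinterior : (interior s).Nonempty)
    (hfin : μ s ≠ ⊤) : Bornology.IsBounded s := by
  obtain ⟨x₀, hx₀⟩ := hinterior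
  obtain ⟨r, hr, hball⟩ := Metric.isOpen_iff.1 isOpen_interior x₀ hx₀
  replace hball : Metric.ball x₀ r ⊆ s := hball.trans interior_subset
  set β := μ (Metric.ball (0 : E) (r / 2)) with hβ
  have hβ0 : β ≠ 0 := (Metric.measure_ball_pos μ 0 (half_pos hr)).ne'
  obtain ⟨m, hm⟩ := ENNReal.exists_nat_mul_gt hβ0 hfin
  refine (Metric.isBounded_iff_subset_closedBall x₀).2 ⟨2 * m * r, fun x hx => ?_⟩
  rw [Metric.mem_closedBall, dist_eq_norm]
  by_contra! hL
  set L := ‖x - x₀‖ with hLdef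
  have hLpos : 0 < L := lt_of_le_of_lt (by positivity) hL
  let c : ℕ → E := fun k => x₀ + (k * r / L) • (x - x₀)
  have hsub : ∀ k < m, Metric.ball (c k) (r / 2) ⊆ s := by
    intro k hk y hy
    have hkm : (k : ℝ) ≤ m := by exact_mod_cast hk.le
    set t : ℝ := k * r / L with ht
    have ht0 : 0 ≤ t := by positivity
    have ht1 : t ≤ 1 / 2 := by
      rw [ht, div_le_iff₀ hLpos]
      nlinarith
    have h1t : 0 < 1 - t := by linarith
    have hz : ‖y - c k‖ < r / 2 := by simpa [dist_eq_norm] using hy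
    have hmem : x₀ + (1 - t)⁻¹ • (y - c k) ∈ s := by
      apply hball
      rw [Metric.mem_ball, dist_eq_norm, add_sub_cancel_left, norm_smul, norm_inv,
        Real.norm_of_nonneg h1t.le, inv_mul_lt_iff₀ h1t]
      nlinarith
    have := hs hmem hx h1t.le ht0 (by ring)
    convert this using 1
    rw [smul_add, smul_smul, mul_inv_cancel₀ h1t.ne', one_smul]
    simp only [c, ← ht]
    module
  have hdisj : Pairwise (Function.onFun Disjoint fun k : Fin m => Metric.ball (c k) (r / 2)) := by
    intro k l hkl
    apply Metric.ball_disjoint_ball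
    have : dist (c k) (c l) = |(k : ℝ) - l| * r := by
      rw [dist_eq_norm]
      have : c k - c l = (((k : ℝ) - l) * r / L) • (x - x₀) := by
        simp only [c]; module
      rw [this, norm_smul, Real.norm_eq_abs, abs_div, abs_mul, abs_of_pos hr, abs_of_pos hLpos,
        ← hLdef]
      field_simp
    rw [this]
    have h1 : (1 : ℝ) ≤ |(k : ℝ) - l| := by
      have h2 : (k : ℤ) - l ≠ 0 := by
        intro h; apply hkl; ext; omega
      have := Int.one_le_abs h2
      exact_mod_cast this
    nlinarith
  have hle : (m : ENNReal) * β ≤ μ s := by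
    calc (m : ENNReal) * β = ∑ k : Fin m, μ (Metric.ball (c k) (r / 2)) := by
          simp [hβ, Measure.addHaar_ball_center μ (c _)]
      _ = μ (⋃ k : Fin m, Metric.ball (c k) (r / 2)) := by
          rw [measure_iUnion hdisj (fun _ => measurableSet_ball), tsum_fintype]
      _ ≤ μ s := measure_mono (Set.iUnion_subset fun k => hsub k k.2)
  exact absurd hm (not_lt.2 hle)

theorem exists_finset_biInter_bounded_measure_lt {E : Type*} [NormedAddCommGroup E]
    [NormedSpace ℝ E] [MeasurableSpace E] [BorelSpace E] [FiniteDimensional ℝ E] (μ : Measure E)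
    [μ.OuterRegular] {I : Type*} (H : I → Set E) (hc : ∀ i, IsClosed (H i))
    (hconv : ∀ i, Convex ℝ (H i)) (h0 : ∀ i, (0 : E) ∈ H i)
    (hb : Bornology.IsBounded (⋂ i, H i)) {b : ENNReal} (hlt : μ (⋂ i, H i) < b) :
    ∃ F : Finset I, Bornology.IsBounded (⋂ i ∈ F, H i) ∧ μ (⋂ i ∈ F, H i) < b := by
  classical
  obtain ⟨R, hRpos, hR⟩ := hb.subset_ball_lt 0 0
  obtain ⟨U, hPU, hU, hUb⟩ := Set.exists_isOpen_lt_of_lt _ _ hlt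
  obtain ⟨F₁, hF₁⟩ := (isCompact_sphere (0 : E) R).elim_finite_subfamily_closed H hc (by
    ext x
    simp only [Set.mem_inter_iff, Set.mem_empty_iff_false, iff_false, not_and]
    intro hx hx'
    have := hR hx'
    rw [Metric.mem_ball] at this
    rw [Metric.mem_sphere] at hx
    linarith)
  obtain ⟨F₂, hF₂⟩ := ((isCompact_closedBall (0 : E) R).inter_right
    hU.isClosed_compl).elim_finite_subfamily_closed H hc (by
    ext x
    simp only [Set.mem_inter_iff, Set.mem_empty_iff_false, iff_false, not_and]
    intro hx hx'
    exact hx.2 (hPU hx'))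
  have hball : (⋂ i ∈ F₁, H i) ⊆ Metric.closedBall (0 : E) R := by
    intro x hx
    rw [mem_closedBall_zero_iff]
    by_contra! h
    have hx0 : 0 < ‖x‖ := hRpos.trans h
    have hmem : (R / ‖x‖) • x ∈ Metric.sphere (0 : E) R ∩ ⋂ i ∈ F₁, H i := by
      constructor
      · rw [mem_sphere_zero_iff_norm, norm_smul, Real.norm_of_nonneg (by positivity)]
        field_simp
      · simp only [Set.mem_iInter] at hx ⊢
        intro i hi
        exact (hconv i).smul_mem_of_zero_mem (h0 i) (hx i hi)
          ⟨by positivity, (div_le_one hx0).2 h.le⟩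
    rw [hF₁] at hmem
    exact hmem
  have hsub₁ : (⋂ i ∈ F₁ ∪ F₂, H i) ⊆ ⋂ i ∈ F₁, H i :=
    Set.biInter_subset_biInter_left fun i hi => by simp at hi ⊢; exact Or.inl hi
  have hsub₂ : (⋂ i ∈ F₁ ∪ F₂, H i) ⊆ ⋂ i ∈ F₂, H i :=
    Set.biInter_subset_biInter_left fun i hi => by simp at hi ⊢; exact Or.inr hi
  refine ⟨F₁ ∪ F₂, Metric.isBounded_closedBall.subset (hsub₁.trans hball), ?_⟩
  refine (measure_mono fun x hx => ?_).trans_lt hUb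
  by_contra hxU
  have : x ∈ Metric.closedBall (0 : E) R ∩ Uᶜ ∩ ⋂ i ∈ F₂, H i :=
    ⟨⟨hball (hsub₁ hx), hxU⟩, hsub₂ hx⟩
  rw [hF₂] at this
  exact this

/-- **John position**: a bounded polytope `⋂ i, {x | ⟪x, v i⟫ ≤ 1}` contains an ellipsoid
`{c + A y | ‖y‖ ≤ 1}` such that, in the coordinates `y`, some of the facets carry a decomposition
of the identity. -/
theorem exists_ellipsoid_isJohnDecomposition {n : ℕ} (hn : n ≠ 0) {J : Type} [Finite J]
    (v : J → EuclideanSpace ℝ (Fin n))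
    (hb : Bornology.IsBounded (⋂ i, {x : EuclideanSpace ℝ (Fin n) | ⟪x, v i⟫ ≤ 1})) :
    ∃ (A : EuclideanSpace ℝ (Fin n) →L[ℝ] EuclideanSpace ℝ (Fin n))
      (c : EuclideanSpace ℝ (Fin n)) (ι : Type) (_ : Fintype ι) (p : ι → ℝ)
      (u : ι → EuclideanSpace ℝ (Fin n)) (f : ι → J), LinearMap.det A.toLinearMap ≠ 0 ∧
      (∀ y, ‖y‖ ≤ 1 → ∀ i, ⟪c + A y, v i⟫ ≤ 1) ∧ IsJohnDecomposition p u ∧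
      ∀ i y, ⟪c + A y, v (f i)⟫ ≤ 1 ↔ ⟪y, u i⟫ ≤ 1 := by
  have := Fintype.ofFinite J
  let E := EuclideanSpace ℝ (Fin n)
  let S : Set ((E →L[ℝ] E) × E) := {q | ∀ y, ‖y‖ ≤ 1 → ∀ i, ⟪q.2 + q.1 y, v i⟫ ≤ 1}
  have hSc : IsClosed S := by
    simp only [S, Set.ofPred_forall]
    refine isClosed_iInter fun y => isClosed_iInter fun _ => isClosed_iInter fun i => ?_
    exact isClosed_le (by fun_prop) continuous_const
  obtain ⟨R, hR⟩ := hb.subset_closedBall 0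
  have hSb : Bornology.IsBounded S := by
    refine (Metric.isBounded_closedBall (x := (0 : (E →L[ℝ] E) × E)) (r := 2 * R)).subset ?_
    rintro ⟨A, c⟩ hq
    have h1 : ∀ y, ‖y‖ ≤ 1 → ‖c + A y‖ ≤ R := fun y hy => by
      simpa using hR (Set.mem_iInter.2 fun i => hq y hy i)
    have h2 : ‖c‖ ≤ R := by simpa using h1 0 (by simp)
    have hR0 : 0 ≤ R := (norm_nonneg _).trans h2
    rw [mem_closedBall_zero_iff, Prod.norm_def]
    refine max_le ?_ (by dsimp only; linarith)
    refine ContinuousLinearMap.opNorm_le_of_unit_norm (by positivity) fun y hy => ?_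
    calc ‖A y‖ = ‖(c + A y) - c‖ := by simp
      _ ≤ ‖c + A y‖ + ‖c‖ := norm_sub_le _ _
      _ ≤ 2 * R := by linarith [h1 y hy.le]
  have : ProperSpace ((E →L[ℝ] E) × E) := FiniteDimensional.proper_real _
  have hcompact : IsCompact S := Metric.isCompact_of_isClosed_isBounded hSc hSb
  let r : ℝ := (1 + ∑ i, ‖v i‖)⁻¹
  have hs0 : 0 < 1 + ∑ i, ‖v i‖ :=
    add_pos_of_pos_of_nonneg one_pos (Finset.sum_nonneg fun i _ => norm_nonneg _)
  have hr : 0 < r := inv_pos.2 hs0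
  have hrS : ((r • ContinuousLinearMap.id ℝ E, 0) : (E →L[ℝ] E) × E) ∈ S := by
    intro y hy i
    have h1 : ‖v i‖ ≤ 1 + ∑ i, ‖v i‖ := by
      have := Finset.single_le_sum (f := fun i => ‖v i‖) (fun i _ => norm_nonneg _)
        (Finset.mem_univ i)
      linarith
    have h2 : r * ‖v i‖ ≤ 1 := by
      rw [inv_mul_le_iff₀ hs0, mul_one]; exact h1
    have h3 := (real_inner_le_norm y (v i)).trans
      (mul_le_of_le_one_left (norm_nonneg _) hy)
    simp only [smul_apply, ContinuousLinearMap.id_apply, zero_add,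
      inner_smul_left, conj_trivial]
    nlinarith
  have hcont : Continuous fun q : (E →L[ℝ] E) × E => |LinearMap.det q.1.toLinearMap| :=
    (ContinuousLinearMap.continuous_det.comp continuous_fst).abs
  obtain ⟨⟨A, c⟩, hAc, hmax⟩ := hcompact.exists_isMaxOn ⟨_, hrS⟩ hcont.continuousOn
  have hdet : 0 < |LinearMap.det A.toLinearMap| := by
    refine lt_of_lt_of_le ?_ (hmax hrS)
    simp only [ContinuousLinearMap.toLinearMap_smul, ContinuousLinearMap.coe_id, LinearMap.det_smul,
      LinearMap.det_id, mul_one]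
    positivity
  have hA0 : LinearMap.det A.toLinearMap ≠ 0 := abs_pos.1 hdet
  let w : J → E := fun i => ContinuousLinearMap.adjoint A (v i)
  let h : J → ℝ := fun i => 1 - ⟪c, v i⟫
  have hin : ∀ i (y : E), ⟪c + A y, v i⟫ = 1 - h i + ⟪y, w i⟫ := fun i y => by
    simp only [w, h, inner_add_left, ContinuousLinearMap.adjoint_inner_right]; ring
  have hw : ∀ i, ‖w i‖ ≤ h i := by
    intro i
    by_cases h0 : w i = 0
    · have := hAc 0 (by simp) i
      simp only [hin, inner_zero_left] at this
      rw [h0, norm_zero]; linarith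
    · have hpos : 0 < ‖w i‖ := norm_pos_iff.2 h0
      have := hAc (‖w i‖⁻¹ • w i) (by
        rw [norm_smul, norm_inv, norm_norm, inv_mul_cancel₀ hpos.ne']) i
      simp only [hin, inner_smul_left, conj_trivial, real_inner_self_eq_norm_sq] at this
      rw [pow_two, ← mul_assoc, inv_mul_cancel₀ hpos.ne', one_mul] at this
      linarith
  have hpos : ∀ i, 0 < h i := by
    intro i
    refine lt_of_le_of_ne ((norm_nonneg _).trans (hw i)) fun h0 => ?_
    have hw0 : w i = 0 := norm_le_zero_iff.1 ((hw i).trans h0.ge)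
    obtain ⟨z, hz⟩ : ∃ z, A z = v i :=
      (LinearMap.equivOfDetNeZero A.toLinearMap hA0).surjective (v i)
    have h1 : ⟪A z, v i⟫ = 0 := by
      rw [← ContinuousLinearMap.adjoint_inner_right]
      change ⟪z, w i⟫ = 0
      rw [hw0, inner_zero_right]
    rw [hz, inner_self_eq_zero] at h1
    simp [h, h1] at h0
  obtain ⟨ι, hι, p, u, f, hJ, hf⟩ := exists_isJohnDecomposition hn w h hpos hw fun B c' hB => by
    have hmem : (A.comp B, c + A c') ∈ S := by
      intro y hy i
      have h1 := hin i (c' + B y)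
      have h2 := hB y hy i
      rw [map_add, ← add_assoc] at h1
      change ⟪c + A c' + A (B y), v i⟫ ≤ 1
      rw [h1]; linarith
    have h3 : |LinearMap.det (A.toLinearMap ∘ₗ B.toLinearMap)| ≤ |LinearMap.det A.toLinearMap| :=
      hmax hmem
    rw [LinearMap.det_comp, abs_mul] at h3
    exact (mul_le_iff_le_one_right hdet).1 h3
  refine ⟨A, c, ι, hι, p, u, f, hA0, hAc, hJ, fun i y => ?_⟩
  rw [hin, hf, inner_smul_right]
  constructor
  · intro h1
    have : h (f i) * ⟪y, u i⟫ ≤ h (f i) * 1 := by linarith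
    exact le_of_mul_le_mul_left this (hpos _)
  · intro h1
    nlinarith [hpos (f i)]

namespace IsJohnDecomposition

variable {n : ℕ} {ι : Type*} [Fintype ι] {p : ι → ℝ} {u : ι → EuclideanSpace ℝ (Fin n)}

theorem mem_convexHull (h : IsJohnDecomposition p u) (hn : n ≠ 0)
    {w : EuclideanSpace ℝ (Fin n)} (hw : n * ‖w‖ ≤ 1) : w ∈ convexHull ℝ (Set.range u) := by
  have hn0 : (n : ℝ) ≠ 0 := by exact_mod_cast hn
  have hq : ∀ i, 0 ≤ p i * (1 + n * ⟪u i, w⟫) := fun i => by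
    have h1 := neg_le_of_abs_le (abs_real_inner_le_norm (u i) w)
    rw [h.norm_eq_one, one_mul] at h1
    have h2 : (0 : ℝ) ≤ n := by positivity
    exact mul_nonneg (h.nonneg i) (by nlinarith)
  have hinner : ∀ i, ⟪u i, w⟫ = ∑ b, w b * u i b := fun i => by
    simp [PiLp.inner_apply]
  have hsum : ∑ i, p i * (1 + n * ⟪u i, w⟫) = 1 := by
    have h1 : ∑ i, p i * (n * ⟪u i, w⟫) = 0 := by
      simp_rw [hinner, Finset.mul_sum]
      rw [Finset.sum_comm]
      refine Finset.sum_eq_zero fun b _ => ?_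
      rw [← mul_zero (n * w b : ℝ), ← h.centered b, Finset.mul_sum]
      exact Finset.sum_congr rfl fun i _ => by ring
    simp only [mul_add, mul_one, Finset.sum_add_distrib, h.sum_eq_one, h1, add_zero]
  have hcomb : ∑ i, (p i * (1 + n * ⟪u i, w⟫)) • u i = w := by
    ext a
    have h1 : ∑ i, p i * (n * ⟪u i, w⟫) * u i a = w a := by
      have h2 : ∀ i, p i * (n * ⟪u i, w⟫) * u i a = ∑ b, n * w b * (p i * (u i a * u i b)) := by
        intro i
        rw [hinner, Finset.mul_sum, Finset.mul_sum, Finset.sum_mul]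
        exact Finset.sum_congr rfl fun b _ => by ring
      simp_rw [h2]
      rw [Finset.sum_comm]
      simp_rw [← Finset.mul_sum, h.isotropic]
      simp [hn0, mul_right_comm]
    simp only [WithLp.ofLp_sum, WithLp.ofLp_smul, Finset.sum_apply, Pi.smul_apply, smul_eq_mul]
    simp only [mul_add, add_mul, mul_one, Finset.sum_add_distrib, h.centered, h1, zero_add]
  rw [← hcomb]
  exact (convex_convexHull ℝ _).sum_mem (fun i _ => hq i) hsum
    fun i _ => subset_convexHull ℝ _ ⟨i, rfl⟩

theorem exists_finset_inner_le_one (h : IsJohnDecomposition p u) (hn : n ≠ 0)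
    {w : EuclideanSpace ℝ (Fin n)} (hw : n * ‖w‖ ≤ 1) :
    ∃ T : Finset ι, T.card ≤ n + 1 ∧ ∀ y, (∀ i ∈ T, ⟪y, u i⟫ ≤ 1) → ⟪y, w⟫ ≤ 1 := by
  classical
  obtain ⟨κ, hκ, z, q, hz, hind, hq, hq1, rfl⟩ :=
    eq_pos_convex_span_of_mem_convexHull (h.mem_convexHull hn hw)
  choose g hg using fun i => hz (Set.mem_range_self i)
  refine ⟨Finset.univ.image g, ?_, fun y hy => ?_⟩
  · calc (Finset.univ.image g).card ≤ Fintype.card κ := Finset.card_image_le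
      _ ≤ Module.finrank ℝ (vectorSpan ℝ (Set.range z)) + 1 := hind.card_le_finrank_succ
      _ ≤ Module.finrank ℝ (EuclideanSpace ℝ (Fin n)) + 1 :=
        Nat.add_le_add_right (Submodule.finrank_le _) 1
      _ = n + 1 := by simp
  · rw [inner_sum, ← hq1]
    refine Finset.sum_le_sum fun i _ => ?_
    rw [inner_smul_right, ← hg i]
    exact mul_le_of_le_one_right (hq i).le (hy _ (Finset.mem_image_of_mem _ (Finset.mem_univ i)))

theorem exists_finset_factorial_mul_volume_le (h : IsJohnDecomposition p u) (hn : n ≠ 0) {k : ℕ}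
    (hk : 0 < k) (τ : Fin k → Fin (n + 1) → ι) {η s M : ℝ} (hη : 0 < η) (hs : 0 < s) (hM : 0 ≤ M)
    (hdet : η * ((n + 1).factorial / (n : ℝ) ^ n) ^ k ≤ ∏ a, (liftMatrix u (τ a)).det ^ 2)
    (hnorm : ‖∑ a, ∑ j, u (τ a j)‖ ≤ k * (n + 1) * s)
    (hbound : ((((n : ℝ) + 1) * (n * s + 1)) ^ (n + 1)) ^ (2 * k) ≤
      M ^ (2 * k) * (η * ((n + 1).factorial / (n : ℝ) ^ n) ^ k)) :
    ∃ T : Finset ι, T.card ≤ (k + 1) * (n + 1) ∧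
      n.factorial * volume {y : EuclideanSpace ℝ (Fin n) | ∀ i ∈ T, ⟪y, u i⟫ ≤ 1} ≤
        ENNReal.ofReal M := by
  classical
  have hn0 : (0 : ℝ) < n := by exact_mod_cast Nat.pos_of_ne_zero hn
  have hk0 : (0 : ℝ) < k := by exact_mod_cast hk
  set Z := ∑ a, ∑ j, u (τ a j) with hZ
  set θ : ℝ := 1 / (k * (n + 1) * (n * s + 1)) with hθ
  have hθ0 : 0 < θ := by positivity
  have hθ1 : θ * (k * ((n + 1 : ℕ) : ℝ)) = 1 / (n * s + 1) := by
    rw [hθ]; push_cast; field_simp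
  have hθ2 : 1 - θ * (k * ((n + 1 : ℕ) : ℝ)) = n * s / (n * s + 1) := by
    rw [hθ1]; field_simp; ring
  have hθ3 : 0 < 1 - θ * (k * ((n + 1 : ℕ) : ℝ)) := by rw [hθ2]; positivity
  set w := -((1 / (k * (n + 1) * (n * s))) • Z) with hw
  have hwsum : θ • Z + (1 - θ * (k * ((n + 1 : ℕ) : ℝ))) • w = 0 := by
    rw [hw, smul_neg, smul_smul, hθ2, ← sub_eq_add_neg, ← sub_smul]
    convert zero_smul ℝ Z
    rw [hθ]; field_simp; ring
  have hwn : n * ‖w‖ ≤ 1 := by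
    rw [hw, norm_neg, norm_smul, Real.norm_of_nonneg (by positivity)]
    calc n * (1 / (k * (n + 1) * (n * s)) * ‖Z‖)
        ≤ n * (1 / (k * (n + 1) * (n * s)) * (k * (n + 1) * s)) := by gcongr
      _ = 1 := by field_simp
  obtain ⟨T, hT, hTw⟩ := h.exists_finset_inner_le_one hn hwn
  have hprod : 0 < ∏ a, (liftMatrix u (τ a)).det ^ 2 := lt_of_lt_of_le (by positivity) hdet
  have hdet0 : ∀ a, (liftMatrix u (τ a)).det ≠ 0 := fun a ha =>
    hprod.ne' (Finset.prod_eq_zero (Finset.mem_univ a) (by rw [ha]; norm_num))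
  have hvol := factorial_mul_volume_iInter_halfSpace_le rfl u τ hk hdet0 hθ0
    (by linarith) hwsum
  refine ⟨Finset.univ.image (fun q : Fin k × Fin (n + 1) => τ q.1 q.2) ∪ T, ?_, ?_⟩
  · refine (Finset.card_union_le _ _).trans ?_
    have : (Finset.univ.image (fun q : Fin k × Fin (n + 1) => τ q.1 q.2)).card ≤ k * (n + 1) := by
      refine Finset.card_image_le.trans ?_
      simp
    rw [add_mul, one_mul]
    exact Nat.add_le_add this hT
  · refine le_trans ?_ (hvol.trans (ENNReal.ofReal_le_ofReal ?_))
    · gcongr with y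
      intro hy
      refine ⟨fun a j => hy _ (Finset.mem_union_left _ (Finset.mem_image_of_mem _
        (Finset.mem_univ (a, j)))), hTw y fun i hi => hy i (Finset.mem_union_right _ hi)⟩
    · set D := (((n : ℝ) + 1) * (n * s + 1)) ^ (n + 1) with hD
      have hkθ : ((k : ℝ) * θ) ^ (n + 1) = D⁻¹ := by
        rw [hD, ← inv_pow, hθ]
        congr 1
        field_simp
      have hD0 : 0 < D := by positivity
      refine le_of_pow_le_pow_left₀ (n := 2 * k) (by omega) hM ?_
      have hterm : ∀ a, ((1 / (|(liftMatrix u (τ a)).det| * (k * θ) ^ (n + 1))) ^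
          (1 / (k : ℝ))) ^ (2 * k) = D ^ 2 / (liftMatrix u (τ a)).det ^ 2 := by
        intro a
        have hpos : 0 < |(liftMatrix u (τ a)).det| := abs_pos.2 (hdet0 a)
        rw [hkθ, mul_comm 2 k, pow_mul, ← Real.rpow_natCast _ k, ← Real.rpow_mul (by positivity),
          one_div_mul_cancel hk0.ne', Real.rpow_one, div_pow, mul_pow, sq_abs]
        field_simp
      rw [← Finset.prod_pow]
      simp_rw [hterm]
      rw [Finset.prod_div_distrib, div_le_iff₀ hprod, Finset.prod_const, Finset.card_univ,
        Fintype.card_fin, ← pow_mul]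
      exact hbound.trans (by gcongr)

end IsJohnDecomposition

theorem add_one_pow_le_mul_factorial (n : ℕ) :
    ((n : ℝ) + 1) ^ (n + 1) ≤ (25 / 9) ^ n * (n + 1).factorial := by
  induction n with
  | zero => simp
  | succ n ih =>
    have h1 : (0 : ℝ) < (n : ℝ) + 1 := by positivity
    have h2 : (1 + 1 / ((n : ℝ) + 1)) ^ (n + 1) ≤ 25 / 9 := by
      have h3 := Real.add_one_le_exp (1 / ((n : ℝ) + 1))
      calc (1 + 1 / ((n : ℝ) + 1)) ^ (n + 1) ≤ Real.exp (1 / ((n : ℝ) + 1)) ^ (n + 1) := by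
            gcongr; linarith
        _ = Real.exp 1 := by
            rw [← Real.exp_nat_mul]; congr 1; push_cast; field_simp
        _ ≤ 25 / 9 := by linarith [Real.exp_one_lt_d9]
    have h4 : (((n + 1 : ℕ) : ℝ) + 1) ^ (n + 1) =
        (1 + 1 / ((n : ℝ) + 1)) ^ (n + 1) * ((n : ℝ) + 1) ^ (n + 1) := by
      rw [← mul_pow]; congr 1; push_cast; field_simp
    rw [pow_succ, h4, Nat.factorial_succ (n + 1)]
    calc (1 + 1 / ((n : ℝ) + 1)) ^ (n + 1) * ((n : ℝ) + 1) ^ (n + 1) * (((n + 1 : ℕ) : ℝ) + 1)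
        ≤ 25 / 9 * ((25 / 9) ^ n * (n + 1).factorial) * (((n + 1 : ℕ) : ℝ) + 1) := by gcongr
      _ = _ := by push_cast; ring

theorem two_mul_add_one_pow_le {n : ℕ} {γ : ℝ} (hγ : 25 / 9 ≤ γ) :
    2 * ((n : ℝ) + 1) ^ (n + 1) ≤ γ ^ (n + 1) * (n + 1).factorial := by
  calc 2 * ((n : ℝ) + 1) ^ (n + 1) ≤ 25 / 9 * ((25 / 9) ^ n * (n + 1).factorial) := by
        gcongr
        · norm_num
        · exact add_one_pow_le_mul_factorial n
    _ = (25 / 9) ^ (n + 1) * (n + 1).factorial := by ring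
    _ ≤ _ := by gcongr

theorem div_three_add_one_pow_le {n : ℕ} (hn : n ≠ 0) :
    53 / 25 * ((n : ℝ) / 3 + 1) ^ (2 * (n + 1)) ≤ ((n : ℝ) + 1) ^ (n + 1) * (n + 1).factorial := by
  obtain rfl | hn2 : n = 1 ∨ 2 ≤ n := by omega
  · norm_num [Nat.factorial]
  have hn2' : (2 : ℝ) ≤ n := by exact_mod_cast hn2
  calc 53 / 25 * ((n : ℝ) / 3 + 1) ^ (2 * (n + 1))
      ≤ 53 / 25 * (5 / 9 * ((n : ℝ) + 1)) ^ (2 * (n + 1)) := by gcongr; linarith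
    _ = 53 / 25 * (25 / 81) ^ (n + 1) * ((n : ℝ) + 1) ^ (n + 1) * ((n : ℝ) + 1) ^ (n + 1) := by
        rw [mul_pow, pow_mul, mul_comm 2 (n + 1), pow_mul]; norm_num; ring
    _ ≤ 53 / 25 * (25 / 81) ^ (n + 1) * ((n : ℝ) + 1) ^ (n + 1) *
        ((25 / 9) ^ n * (n + 1).factorial) := by
        gcongr; exact add_one_pow_le_mul_factorial n
    _ = (53 / 25 * (25 / 81) * (25 / 81 * (25 / 9)) ^ n) *
        (((n : ℝ) + 1) ^ (n + 1) * (n + 1).factorial) := by rw [mul_pow]; ring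
    _ ≤ 1 * (((n : ℝ) + 1) ^ (n + 1) * (n + 1).factorial) := by
        gcongr
        have : ((25 : ℝ) / 81 * (25 / 9)) ^ n ≤ 1 := pow_le_one₀ (by norm_num) (by norm_num)
        nlinarith
    _ = _ := one_mul _

theorem one_le_sqrt_ratio_sq {d : ℝ} (hd : 1 < d) : 1 ≤ ((√d + 1) / (√d - 1)) ^ 2 := by
  have h1 : 1 < √d := by rw [Real.lt_sqrt (by norm_num)]; linarith
  refine one_le_pow₀ ?_
  rw [one_le_div (by linarith)]
  linarith

theorem sqrt_ratio_sq_ge {d : ℝ} (hd : 1 < d) (hd' : d < 16) :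
    25 / 9 ≤ ((√d + 1) / (√d - 1)) ^ 2 := by
  have h1 : 1 < √d := by rw [Real.lt_sqrt (by norm_num)]; linarith
  have h2 : √d < 4 := by rw [Real.sqrt_lt' (by norm_num)]; linarith
  have h3 : 5 / 3 ≤ (√d + 1) / (√d - 1) := by
    rw [le_div_iff₀ (by linarith)]; linarith
  nlinarith

namespace IsJohnDecomposition

variable {n : ℕ} {ι : Type*} [Fintype ι] {p : ι → ℝ} {u : ι → EuclideanSpace ℝ (Fin n)}

theorem exists_finset_card_le_and_factorial_mul_volume_le (h : IsJohnDecomposition p u)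
    (hn : n ≠ 0) {d : ℝ} (hd : 1 < d) :
    ∃ T : Finset ι, (T.card : ℝ) ≤ (d + 1) * (n + 1) ∧
      n.factorial * volume {y : EuclideanSpace ℝ (Fin n) | ∀ i ∈ T, ⟪y, u i⟫ ≤ 1} ≤
        ENNReal.ofReal √((((√d + 1) / (√d - 1)) ^ 2) ^ (n + 1) * (n : ℝ) ^ n *
          ((n : ℝ) + 1) ^ (3 * (n + 1)) / 2) := by
  have hn0 : (0 : ℝ) < n := by exact_mod_cast Nat.pos_of_ne_zero hn
  have hfac : (0 : ℝ) < (n + 1).factorial := by exact_mod_cast Nat.factorial_pos _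
  have hγ1 := one_le_sqrt_ratio_sq hd
  have hγ2 := sqrt_ratio_sq_ge hd
  generalize ((√d + 1) / (√d - 1)) ^ 2 = γ at hγ1 hγ2 ⊢
  have hγ0 : 0 < γ := by linarith
  set M := √(γ ^ (n + 1) * (n : ℝ) ^ n * ((n : ℝ) + 1) ^ (3 * (n + 1)) / 2) with hM
  have hM2 : M ^ 2 * ((n + 1).factorial / (n : ℝ) ^ n) =
      ((n : ℝ) + 1) ^ (2 * (n + 1)) *
        (γ ^ (n + 1) * (((n : ℝ) + 1) ^ (n + 1) * (n + 1).factorial) / 2) := by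
    rw [hM, Real.sq_sqrt (by positivity)]
    field_simp
    ring
  have hcard : ∀ (k : ℕ) (T : Finset ι), (k : ℝ) ≤ d → T.card ≤ (k + 1) * (n + 1) →
      (T.card : ℝ) ≤ (d + 1) * (n + 1) := by
    intro k T hk hT
    calc (T.card : ℝ) ≤ (k + 1) * (n + 1) := by exact_mod_cast hT
      _ ≤ (d + 1) * (n + 1) := by gcongr
  rcases lt_or_ge d 16 with hd' | hd'
  · obtain ⟨σ, hσ⟩ := h.exists_det_sq_ge hn
    obtain ⟨T, hT, hTv⟩ := h.exists_finset_factorial_mul_volume_le hn (k := 1) one_pos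
      (fun _ => σ) (η := 1) (s := 1) (M := M) one_pos one_pos (Real.sqrt_nonneg _)
      (by simpa using hσ) (by simpa using h.norm_sum_le σ) (by
        have h1 := two_mul_add_one_pow_le (n := n) (hγ2 hd')
        have h2 : (((n : ℝ) + 1) * (n * 1 + 1)) ^ (n + 1) =
          ((n : ℝ) + 1) ^ (n + 1) * ((n : ℝ) + 1) ^ (n + 1) := by rw [mul_one, mul_pow]
        rw [mul_one 2, pow_one, one_mul, hM2, h2]
        set a := ((n : ℝ) + 1) ^ (n + 1) with ha
        have ha0 : 0 ≤ a := by positivity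
        calc (a * a) ^ 2 = a ^ 2 * (a * (2 * a) / 2) := by ring
          _ ≤ a ^ 2 * (a * (γ ^ (n + 1) * (n + 1).factorial) / 2) := by gcongr
          _ = _ := by rw [mul_comm 2 (n + 1), pow_mul, ← ha]; ring)
    exact ⟨T, hcard 1 T (by exact_mod_cast hd.le) hT, hTv⟩
  · obtain ⟨τ, hτ, hτn⟩ := h.exists_prod_det_sq_ge hn (k := 16) (by norm_num) (r := 16 / 9)
      (by norm_num)
    obtain ⟨T, hT, hTv⟩ := h.exists_finset_factorial_mul_volume_le hn (k := 16) (by norm_num)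
      τ (η := 7 / 16) (s := 1 / 3) (M := M) (by norm_num) (by norm_num) (Real.sqrt_nonneg _)
      (by norm_num at hτ ⊢; exact hτ)
      (by
        refine le_of_pow_le_pow_left₀ two_ne_zero (by positivity) (hτn.trans (le_of_eq ?_))
        push_cast; ring)
      (by
        have h1 := div_three_add_one_pow_le hn
        rw [pow_mul, pow_mul, mul_left_comm, ← mul_pow, hM2]
        have h2 : ((((n : ℝ) + 1) * (n * (1 / 3) + 1)) ^ (n + 1)) ^ 2 =
          ((n : ℝ) + 1) ^ (2 * (n + 1)) * ((n : ℝ) / 3 + 1) ^ (2 * (n + 1)) := by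
          rw [← pow_mul, mul_comm (n + 1) 2, mul_pow, mul_one_div]
        rw [h2]
        set a := ((n : ℝ) + 1) ^ (2 * (n + 1))
        have ha0 : 0 ≤ a := by positivity
        set b := ((n : ℝ) / 3 + 1) ^ (2 * (n + 1))
        have hb0 : 0 ≤ b := by positivity
        set c := ((n : ℝ) + 1) ^ (n + 1) * (n + 1).factorial
        have hc0 : 0 ≤ c := by positivity
        have hγn : 1 ≤ γ ^ (n + 1) := one_le_pow₀ hγ1
        calc (a * b) ^ 16 ≤ 7 / 16 * (53 / 50) ^ 16 * (a * b) ^ 16 :=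
              le_mul_of_one_le_left (by positivity) (by norm_num)
          _ = 7 / 16 * (a * ((53 / 25 * b) / 2)) ^ 16 := by ring
          _ ≤ 7 / 16 * (a * ((γ ^ (n + 1) * c) / 2)) ^ 16 := by
              gcongr 7 / 16 * (a * (?_ / 2)) ^ 16
              exact h1.trans (le_mul_of_one_le_left hc0 hγn))
    exact ⟨T, hcard 16 T (by exact_mod_cast hd') hT, hTv⟩

end IsJohnDecomposition

theorem volume_image_const_add_continuousLinearMap {n : ℕ}
    (A : EuclideanSpace ℝ (Fin n) →L[ℝ] EuclideanSpace ℝ (Fin n)) (c : EuclideanSpace ℝ (Fin n))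
    (s : Set (EuclideanSpace ℝ (Fin n))) :
    volume ((fun y => c + A y) '' s) = ENNReal.ofReal |LinearMap.det A.toLinearMap| * volume s := by
  rw [← Set.image_image (fun x => c + x) A, Set.image_add_left, measure_preimage_add]
  exact Measure.addHaar_image_continuousLinearMap _ _ _

theorem exists_finset_volume_biInter_halfSpace_le {n : ℕ} (hn : n ≠ 0) {J : Type} [Finite J]
    (v : J → EuclideanSpace ℝ (Fin n))
    (hb : Bornology.IsBounded (⋂ i, {x : EuclideanSpace ℝ (Fin n) | ⟪x, v i⟫ ≤ 1}))
    {d : ℝ} (hd : 1 < d) :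
    ∃ T : Finset J, (T.card : ℝ) ≤ (d + 1) * (n + 1) ∧
      n.factorial * volume (Metric.closedBall (0 : EuclideanSpace ℝ (Fin n)) 1) *
          volume (⋂ i ∈ T, {x : EuclideanSpace ℝ (Fin n) | ⟪x, v i⟫ ≤ 1}) ≤
        ENNReal.ofReal √((((√d + 1) / (√d - 1)) ^ 2) ^ (n + 1) * (n : ℝ) ^ n *
          ((n : ℝ) + 1) ^ (3 * (n + 1)) / 2) *
        volume (⋂ i, {x : EuclideanSpace ℝ (Fin n) | ⟪x, v i⟫ ≤ 1}) := by
  classical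
  obtain ⟨A, c, ι, hι, p, u, f, hA, hball, hJ, hf⟩ := exists_ellipsoid_isJohnDecomposition hn v hb
  obtain ⟨T, hT, hTv⟩ := hJ.exists_finset_card_le_and_factorial_mul_volume_le hn hd
  refine ⟨T.image f, le_trans (by exact_mod_cast Finset.card_image_le) hT, ?_⟩
  have hsub : (fun y => c + A y) '' Metric.closedBall 0 1 ⊆
      ⋂ i, {x : EuclideanSpace ℝ (Fin n) | ⟪x, v i⟫ ≤ 1} := by
    rintro _ ⟨y, hy, rfl⟩
    exact Set.mem_iInter.2 fun i => hball y (by simpa using hy) i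
  have heq : (⋂ i ∈ T.image f, {x : EuclideanSpace ℝ (Fin n) | ⟪x, v i⟫ ≤ 1}) ⊆
      (fun y => c + A y) '' {y | ∀ i ∈ T, ⟪y, u i⟫ ≤ 1} := by
    intro x hx
    obtain ⟨y, hy⟩ : ∃ y, A y = x - c :=
      (LinearMap.equivOfDetNeZero A.toLinearMap hA).surjective (x - c)
    have hxy : c + A y = x := by rw [hy]; abel
    refine ⟨y, fun i hi => (hf i y).1 ?_, hxy⟩
    rw [hxy]
    exact Set.mem_iInter₂.1 hx _ (Finset.mem_image_of_mem f hi)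
  calc _ ≤ n.factorial * volume (Metric.closedBall (0 : EuclideanSpace ℝ (Fin n)) 1) *
          (ENNReal.ofReal |LinearMap.det A.toLinearMap| *
            volume {y : EuclideanSpace ℝ (Fin n) | ∀ i ∈ T, ⟪y, u i⟫ ≤ 1}) := by
        rw [← volume_image_const_add_continuousLinearMap]
        gcongr
    _ = (n.factorial * volume {y : EuclideanSpace ℝ (Fin n) | ∀ i ∈ T, ⟪y, u i⟫ ≤ 1}) *
          (ENNReal.ofReal |LinearMap.det A.toLinearMap| *
            volume (Metric.closedBall (0 : EuclideanSpace ℝ (Fin n)) 1)) := by ring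
    _ ≤ _ := by
        rw [← volume_image_const_add_continuousLinearMap]
        gcongr

theorem Convex.interior_nonempty_of_measure_pos {E : Type*} [NormedAddCommGroup E]
    [NormedSpace ℝ E] [FiniteDimensional ℝ E] [MeasurableSpace E] [BorelSpace E] (μ : Measure E)
    [μ.IsAddHaarMeasure] {s : Set E} (hs : Convex ℝ s) (hpos : 0 < μ s) :
    (interior s).Nonempty := by
  by_contra h
  rw [Set.not_nonempty_iff_eq_empty] at h
  have hsub : s ⊆ frontier s := by
    rw [frontier, h, Set.sdiff_empty]; exact subset_closure
  exact hpos.ne' (measure_mono_null hsub (hs.addHaar_frontier μ))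

theorem quantitativeHelly_constant_eq {n : ℕ} (hn : n ≠ 0) {γ : ℝ} (hγ : 0 < γ) :
    √(γ ^ (n + 1) * (n : ℝ) ^ n * ((n : ℝ) + 1) ^ (3 * (n + 1)) / 2) * √2 =
      γ ^ (((n : ℝ) + 1) / 2) * ((n : ℝ) ^ ((n : ℝ) / 2) *
        ((n : ℝ) + 1) ^ (3 * ((n : ℝ) + 1) / 2) / (Real.pi ^ ((n : ℝ) / 2) * (n.factorial : ℝ))) *
        Real.Gamma ((n : ℝ) / 2 + 1) *
        (n.factorial * (√Real.pi ^ n / Real.Gamma ((n : ℝ) / 2 + 1))) := by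
  have hn0 : (0 : ℝ) < n := by exact_mod_cast Nat.pos_of_ne_zero hn
  have hG : 0 < Real.Gamma ((n : ℝ) / 2 + 1) := Real.Gamma_pos_of_pos (by positivity)
  have hf : (0 : ℝ) < n.factorial := by exact_mod_cast Nat.factorial_pos _
  have hroot : ∀ {x : ℝ} (m : ℕ), 0 < x → x ^ ((m : ℝ) / 2) = √(x ^ m) := fun {x} m hx => by
    rw [Real.sqrt_eq_rpow, ← Real.rpow_natCast, ← Real.rpow_mul hx.le, mul_one_div]
  have h1 := hroot (n + 1) hγ
  have h2 := hroot n hn0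
  have h3 := hroot (3 * (n + 1)) (x := (n : ℝ) + 1) (by positivity)
  have h4 : Real.pi ^ ((n : ℝ) / 2) = √Real.pi ^ n := by
    rw [Real.sqrt_eq_rpow, ← Real.rpow_natCast, ← Real.rpow_mul Real.pi_pos.le, one_div_mul_eq_div]
  push_cast at h1 h3
  rw [h1, h2, h3, h4, ← Real.sqrt_mul (by positivity), div_mul_cancel₀ _ two_ne_zero,
    Real.sqrt_mul (by positivity), Real.sqrt_mul (by positivity)]
  have : 0 < √Real.pi ^ n := pow_pos (Real.sqrt_pos.2 Real.pi_pos) n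
  field_simp

end

/-- Quantitative Helly for half-spaces: if `P = ⋂ᵢ {x : ⟪x, vᵢ⟫ ≤ 1}` has positive volume,
then for every `d > 1` there are `s ≤ (d+1)(n+1)` of the half-spaces whose intersection has
volume at most `γ_d^{(n+1)/2} · n^{n/2} (n+1)^{3(n+1)/2} / (π^{n/2} n!) · Γ(n/2+1) · |P|`,
where `γ_d = ((√d + 1)/(√d − 1))²`. -/
theorem quantitative_helly_halfspaces (n : ℕ) (I : Type)
    (v : I → EuclideanSpace ℝ (Fin n))
    (hP : 0 < volume (⋂ i, {x : EuclideanSpace ℝ (Fin n) | ⟪x, v i⟫ ≤ 1}))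
    (d : ℝ) (hd : 1 < d) :
    ∃ (s : ℕ) (idx : Fin s → I), (s : ℝ) ≤ (d + 1) * (n + 1) ∧
      volume (⋂ j, {x : EuclideanSpace ℝ (Fin n) | ⟪x, v (idx j)⟫ ≤ 1}) ≤
        ENNReal.ofReal
            ((((Real.sqrt d + 1) / (Real.sqrt d - 1)) ^ 2) ^ (((n : ℝ) + 1) / 2) *
              ((n : ℝ) ^ ((n : ℝ) / 2) * ((n : ℝ) + 1) ^ (3 * ((n : ℝ) + 1) / 2) /
                (Real.pi ^ ((n : ℝ) / 2) * (n.factorial : ℝ))) *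
              Real.Gamma ((n : ℝ) / 2 + 1)) *
          volume (⋂ i, {x : EuclideanSpace ℝ (Fin n) | ⟪x, v i⟫ ≤ 1}) := by
  have hγ1 := one_le_sqrt_ratio_sq hd
  have hfac : (0 : ℝ) < n.factorial := by exact_mod_cast Nat.factorial_pos _
  have hG : 0 < Real.Gamma ((n : ℝ) / 2 + 1) := Real.Gamma_pos_of_pos (by positivity)
  have hγ0 : 0 < ((√d + 1) / (√d - 1)) ^ 2 := by linarith
  rcases eq_or_ne n 0 with rfl | hn
  · refine ⟨0, Fin.elim0, by push_cast; positivity, ?_⟩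
    have huniv : ∀ i, {x : EuclideanSpace ℝ (Fin 0) | ⟪x, v i⟫ ≤ 1} = Set.univ := fun i => by
      ext x
      simp [Subsingleton.elim x 0]
    simp only [huniv, Set.iInter_univ]
    refine le_mul_of_one_le_left zero_le ?_
    rw [ENNReal.one_le_ofReal]
    simpa using Real.one_le_rpow hγ1 (by norm_num : (0 : ℝ) ≤ 1 / 2)
  have hn0 : (0 : ℝ) < n := by exact_mod_cast Nat.pos_of_ne_zero hn
  rcases eq_or_ne (volume (⋂ i, {x : EuclideanSpace ℝ (Fin n) | ⟪x, v i⟫ ≤ 1})) ⊤ with htop | htop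
  · refine ⟨0, Fin.elim0, by push_cast; positivity, ?_⟩
    rw [htop, ENNReal.mul_top]
    · exact le_top
    · rw [ENNReal.ofReal_ne_zero_iff]
      have := Real.pi_pos
      have := Real.rpow_pos_of_pos hγ0 (((n : ℝ) + 1) / 2)
      positivity
  have hclosed : ∀ i, IsClosed {x : EuclideanSpace ℝ (Fin n) | ⟪x, v i⟫ ≤ 1} := fun i =>
    isClosed_le (by fun_prop) continuous_const
  have hconv : ∀ i, Convex ℝ {x : EuclideanSpace ℝ (Fin n) | ⟪x, v i⟫ ≤ 1} := fun i =>
    convex_halfSpace_le (f := fun x => ⟪x, v i⟫)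
      ⟨fun x y => inner_add_left x y _, fun r x => by simp [inner_smul_left]⟩ 1
  have hPc := convex_iInter hconv
  have hPb := hPc.isBounded_of_measure_ne_top volume
    (hPc.interior_nonempty_of_measure_pos volume hP) htop
  have hlt : volume (⋂ i, {x : EuclideanSpace ℝ (Fin n) | ⟪x, v i⟫ ≤ 1}) <
      ENNReal.ofReal √2 * volume (⋂ i, {x : EuclideanSpace ℝ (Fin n) | ⟪x, v i⟫ ≤ 1}) := by
    conv_lhs => rw [← one_mul (volume _)]
    refine ENNReal.mul_lt_mul_left hP.ne' htop ?_
    rw [ENNReal.one_lt_ofReal, Real.lt_sqrt (by norm_num)]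
    norm_num
  obtain ⟨F, hFb, hFv⟩ := exists_finset_biInter_bounded_measure_lt volume _ hclosed hconv
    (fun i => by simp) hPb hlt
  have hFeq : (⋂ i ∈ F, {x : EuclideanSpace ℝ (Fin n) | ⟪x, v i⟫ ≤ 1}) =
      ⋂ i : F, {x : EuclideanSpace ℝ (Fin n) | ⟪x, v i⟫ ≤ 1} := by
    ext x; simp
  rw [hFeq] at hFb hFv
  obtain ⟨T, hT, hTv⟩ := exists_finset_volume_biInter_halfSpace_le hn (fun i : F => v i) hFb hd
  refine ⟨T.card, fun j => (T.equivFin.symm j : F), hT, ?_⟩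
  have hTeq : (⋂ j, {x : EuclideanSpace ℝ (Fin n) | ⟪x, v (T.equivFin.symm j : F)⟫ ≤ 1}) =
      ⋂ i ∈ T, {x : EuclideanSpace ℝ (Fin n) | ⟪x, v i⟫ ≤ 1} := by
    rw [T.equivFin.symm.surjective.iInter_comp
      fun i : T => {x : EuclideanSpace ℝ (Fin n) | ⟪x, v (i : F)⟫ ≤ 1}]
    ext x; simp
  rw [hTeq]
  have : Nonempty (Fin n) := ⟨⟨0, Nat.pos_of_ne_zero hn⟩⟩
  have hB : (n.factorial : ENNReal) * volume (Metric.closedBall (0 : EuclideanSpace ℝ (Fin n)) 1) =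
      ENNReal.ofReal (n.factorial * (√Real.pi ^ n / Real.Gamma ((n : ℝ) / 2 + 1))) := by
    rw [EuclideanSpace.volume_closedBall, ENNReal.ofReal_mul hfac.le, ENNReal.ofReal_natCast]
    simp
  have hB0 : 0 < n.factorial * (√Real.pi ^ n / Real.Gamma ((n : ℝ) / 2 + 1)) := by
    have := Real.pi_pos
    positivity
  rw [hB] at hTv
  refine (ENNReal.mul_le_mul_iff_right (ENNReal.ofReal_pos.2 hB0).ne' ENNReal.ofReal_ne_top).1
    (hTv.trans ?_)
  rw [← mul_assoc, mul_comm (ENNReal.ofReal (n.factorial * _)), ← ENNReal.ofReal_mul' hB0.le,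
    ← quantitativeHelly_constant_eq hn hγ0, ENNReal.ofReal_mul (Real.sqrt_nonneg _),
    mul_assoc (ENNReal.ofReal _)]
  gcongr ENNReal.ofReal _ * ?_
end
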